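/- For every integer n ≥ 4 there exist constants ε₃ = ε₃(n) > 0 and c(n) > 0 such that the following holds: if K ⊆ ℝⁿ is a C¹ ε₃-perturbation of a ball, then there exists x̄ ∈ ℝⁿ such that (∫_{∂K} H⁺ dH^{n-1})^{1/(n-2)} / |K|^{1/n} − ((n-1)·H^{n-1}(S^{n-1}))^{1/(n-2)} / |B₁|^{1/n} ≥ c(n) · ⨍_{∂K} |ν(x) − (x−x̄)/|x−x̄||² dH^{n-1}(x), where ⨍ denotes the average integral over ∂K and B₁ is the unit ball of ℝⁿ. -/

import Mathlib

open MeasureTheory Metric Set Real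
open scoped ENNReal RealInnerProductSpace

noncomputable section

abbrev Euc (n : ℕ) := EuclideanSpace ℝ (Fin n)

/-- Divergence of a vector field on Euclidean space: trace of its Fréchet derivative. -/
def divg {n : ℕ} (W : Euc n → Euc n) (x : Euc n) : ℝ :=
  LinearMap.trace ℝ (Euc n) (fderiv ℝ W x).toLinearMap

/-- A bounded domain with smooth boundary, encoded by a smooth defining function `F`:
the domain is `{F < 0}` and its boundary is `{F = 0}`, on which `0` is a regular value. -/
structure SmoothBody (n : ℕ) where
  F : Euc n → ℝ
  smooth : ContDiff ℝ (⊤ : ℕ∞) F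
  bounded : Bornology.IsBounded {x : Euc n | F x ≤ 0}
  connected : IsConnected {x : Euc n | F x < 0}
  regular : ∀ x : Euc n, F x = 0 → gradient F x ≠ 0

namespace SmoothBody

variable {n : ℕ} (K : SmoothBody n)

/-- The (open) domain `K`. -/
def body : Set (Euc n) := {x : Euc n | K.F x < 0}

/-- The boundary `∂K`. -/
def bdry : Set (Euc n) := {x : Euc n | K.F x = 0}

/-- The outer unit normal to `∂K` (extended to a neighbourhood as the normalized
gradient of the defining function). -/
def normal (x : Euc n) : Euc n := ‖gradient K.F x‖⁻¹ • gradient K.F x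

/-- The mean curvature of `∂K` (trace of the second fundamental form with respect to the
outer unit normal), computed as the divergence of the unit normal field. -/
def meanCurv (x : Euc n) : ℝ := divg K.normal x

/-- The orthogonal projection onto the hyperplane orthogonal to `ν`, as a linear map. -/
def tangentProj (ν : Euc n) : Euc n →ₗ[ℝ] Euc n :=
  LinearMap.id - LinearMap.smulRight (innerSL ℝ ν).toLinearMap ν

/-- The shape operator (Weingarten map) of `∂K` at `x`, extended by `0` on the normal
direction: `P ∘ Dν ∘ P` with `P` the orthogonal projection on the tangent space
`(ν x)^⊥` of `∂K`. Its eigenvalues are the principal curvatures of `∂K` together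
with one extra `0`. -/
def shapeOp (x : Euc n) : Euc n →ₗ[ℝ] Euc n :=
  (tangentProj (K.normal x)) ∘ₗ (fderiv ℝ K.normal x).toLinearMap ∘ₗ (tangentProj (K.normal x))

/-- The nuclear norm `‖II‖₁` of the second fundamental form of `∂K` at `x`: the sum of the
absolute values of the principal curvatures (eigenvalues of the shape operator). -/
def nuclearNormII (x : Euc n) : ℝ :=
  let M := LinearMap.toMatrix (EuclideanSpace.basisFun (Fin n) ℝ).toBasis
      (EuclideanSpace.basisFun (Fin n) ℝ).toBasis (K.shapeOp x)
  if h : M.IsHermitian then ∑ i, |h.eigenvalues i| else 0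

/-- The perimeter of `K`: the `(n-1)`-dimensional Hausdorff measure of `∂K`. -/
def perim : ℝ := (μH[(n : ℝ) - 1] K.bdry).toReal

/-- `K` is a `C¹` `ε`-perturbation of a ball: for some `x̄ ∈ ℝⁿ`, the outer unit normal
satisfies `|ν(x) - (x - x̄)/|x - x̄|| ≤ ε` for every `x ∈ ∂K`. -/
def IsPerturbedBall (ε : ℝ) : Prop :=
  ∃ c : Euc n, ∀ x ∈ K.bdry, ‖K.normal x - ‖x - c‖⁻¹ • (x - c)‖ ≤ ε

end SmoothBody

/-- The area of the unit sphere `S^{n-1} ⊆ ℝⁿ`, i.e. its `(n-1)`-dimensional Hausdorff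
measure (which is also the perimeter of the unit ball `B₁`). -/
def sphereArea (n : ℕ) : ℝ := (μH[(n : ℝ) - 1] (sphere (0 : Euc n) 1)).toReal

/-- The unit sphere of `ℝⁿ`. -/
abbrev Sph (n : ℕ) := sphere (0 : Euc n) 1

/-- The surface measure of the unit sphere. -/
abbrev sphMeas (n : ℕ) : Measure (Sph n) := (volume : Measure (Euc n)).toSphere

/-- Positive homogeneity of integer degree. -/
def PosHom {n : ℕ} (m : ℤ) (h : Euc n → ℝ) : Prop :=
  ∀ s : ℝ, 0 < s → ∀ x : Euc n, x ≠ 0 → h (s • x) = s ^ m * h x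

lemma volume_compl_zero_restrict {n : ℕ} (hn : 0 < n) :
    (volume : Measure (Euc n)).restrict {0}ᶜ = volume := by
  have : Nonempty (Fin n) := ⟨⟨0, hn⟩⟩
  exact restrict_compl_singleton _

lemma measurePreserving_polar (n : ℕ) :
    MeasurePreserving (homeomorphUnitSphereProd (Euc n))
      ((volume : Measure (Euc n)).comap (↑)) ((sphMeas n).prod (.volumeIoiPow (n - 1))) := by
  have := (volume : Measure (Euc n)).measurePreserving_homeomorphUnitSphereProd
  rwa [finrank_euclideanSpace, Fintype.card_fin] at this

lemma integral_polar_prod {n : ℕ} (hn : 0 < n) (F : Euc n → ℝ) :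
    ∫ x, F x = ∫ z : Sph n × Ioi (0 : ℝ), F (z.2.1 • (z.1 : Euc n))
      ∂((sphMeas n).prod (.volumeIoiPow (n - 1))) := by
  rw [← (measurePreserving_polar n).integral_comp (Homeomorph.measurableEmbedding _)
    (fun z : Sph n × Ioi (0 : ℝ) => F (z.2.1 • (z.1 : Euc n)))]
  have h2 : ∫ x, F x = ∫ x : ({(0 : Euc n)}ᶜ : Set (Euc n)), F x.1 ∂(volume.comap Subtype.val) := by
    rw [integral_subtype_comap (measurableSet_singleton _).compl F, volume_compl_zero_restrict hn]
  rw [h2]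
  refine integral_congr_ae (Filter.Eventually.of_forall fun x => ?_)
  have hx : ‖(x : Euc n)‖ ≠ 0 := norm_ne_zero_iff.2 x.2
  simp [smul_smul, hx]

lemma integrable_polar_prod {n : ℕ} (hn : 0 < n) (F : Euc n → ℝ) :
    Integrable F ↔ Integrable (fun z : Sph n × Ioi (0 : ℝ) => F (z.2.1 • (z.1 : Euc n)))
      ((sphMeas n).prod (.volumeIoiPow (n - 1))) := by
  rw [← (measurePreserving_polar n).integrable_comp_emb (Homeomorph.measurableEmbedding _)]
  conv_lhs => rw [← volume_compl_zero_restrict hn]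
  rw [← IntegrableOn, integrableOn_iff_comap_subtypeVal (measurableSet_singleton _).compl]
  refine integrable_congr (Filter.Eventually.of_forall fun x => ?_)
  have hx : ‖(x : Euc n)‖ ≠ 0 := norm_ne_zero_iff.2 x.2
  simp [smul_smul, hx]

lemma integral_volumeIoiPow (k : ℕ) (g : ℝ → ℝ) :
    ∫ s : Ioi (0 : ℝ), g s ∂(Measure.volumeIoiPow k) = ∫ s in Ioi (0 : ℝ), s ^ k * g s := by
  simp only [Measure.volumeIoiPow, ENNReal.ofReal]
  rw [integral_withDensity_eq_integral_smul,
    integral_subtype_comap measurableSet_Ioi fun a ↦ Real.toNNReal (a ^ k) • g a,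
    setIntegral_congr_fun measurableSet_Ioi fun x hx ↦ ?_]
  · rw [NNReal.smul_def, Real.coe_toNNReal _ (pow_nonneg hx.out.le _), smul_eq_mul]
  · exact (measurable_subtype_coe.pow_const _).real_toNNReal

lemma integral_polar {n : ℕ} (hn : 0 < n) (F : Euc n → ℝ) (hF : Integrable F) :
    ∫ x, F x = ∫ θ : Sph n, ∫ s in Ioi (0 : ℝ), s ^ (n - 1) * F (s • (θ : Euc n)) ∂(volume) ∂(sphMeas n) := by
  rw [integral_polar_prod hn, integral_prod _ ((integrable_polar_prod hn F).1 hF)]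
  refine integral_congr_ae (Filter.Eventually.of_forall fun θ => ?_)
  exact integral_volumeIoiPow (n - 1) fun s => F (s • (θ : Euc n))

lemma sph_ne_zero {n : ℕ} (θ : Sph n) : (θ : Euc n) ≠ 0 :=
  ne_zero_of_mem_unit_sphere θ

lemma sph_norm {n : ℕ} (θ : Sph n) : ‖(θ : Euc n)‖ = 1 := norm_eq_of_mem_sphere θ

lemma integral_radial_mul {n : ℕ} (hn : 0 < n) {m : ℤ} {h : Euc n → ℝ} (hh : PosHom m h)
    (g : ℝ → ℝ) :
    ∫ x, g ‖x‖ * h x = (∫ θ : Sph n, h θ ∂(sphMeas n)) *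
      ∫ s in Ioi (0 : ℝ), s ^ (n - 1) * (g s * s ^ m) := by
  rw [integral_polar_prod hn, ← integral_volumeIoiPow (n - 1) (fun s => g s * s ^ m),
    ← integral_prod_mul]
  refine integral_congr_ae (Filter.Eventually.of_forall fun z => ?_)
  have h0 : (0 : ℝ) < z.2 := z.2.2
  simp only
  rw [hh _ h0 _ (sph_ne_zero z.1), norm_smul, sph_norm, Real.norm_of_nonneg h0.le]
  ring_nf

lemma PosHom.fderiv_apply {n : ℕ} {m : ℤ} {f : Euc n → ℝ} (hf : PosHom m f)
    (hd : ∀ x, x ≠ 0 → DifferentiableAt ℝ f x) (v : Euc n) :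
    PosHom (m - 1) (fun x => fderiv ℝ f x v) := by
  intro s hs x hx
  have hsx : s • x ≠ 0 := smul_ne_zero hs.ne' hx
  have h1 : HasFDerivAt (fun y : Euc n => f (s • y)) (s • fderiv ℝ f (s • x)) x := by
    exact ((hd _ hsx).hasFDerivAt.comp x ((hasFDerivAt_id x).const_smul s)).congr_fderiv
      (by ext w; simp)
  have h2 : HasFDerivAt (fun y : Euc n => f (s • y)) (s ^ m • fderiv ℝ f x) x := by
    refine ((hd x hx).hasFDerivAt.const_mul (s ^ m)).congr_of_eventuallyEq ?_
    filter_upwards [isOpen_ne.mem_nhds hx] with y hy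
    exact hf s hs y hy
  have h3 := congrArg (fun A : Euc n →L[ℝ] ℝ => A v) (h1.unique h2)
  simp only [_root_.smul_apply, smul_eq_mul] at h3
  rw [zpow_sub_one₀ hs.ne']
  field_simp
  linarith

lemma PosHom.mul {n : ℕ} {m k : ℤ} {f g : Euc n → ℝ} (hf : PosHom m f) (hg : PosHom k g) :
    PosHom (m + k) (fun x => f x * g x) := by
  intro s hs x hx
  simp only [hf s hs x hx, hg s hs x hx, zpow_add₀ hs.ne']
  ring

lemma posHom_inner_left {n : ℕ} (v : Euc n) : PosHom 1 (fun x : Euc n => ⟪x, v⟫) := by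
  intro s hs x hx
  simp [real_inner_smul_left]

lemma posHom_norm_zpow {n : ℕ} (k : ℤ) : PosHom k (fun x : Euc n => ‖x‖ ^ k) := by
  intro s hs x hx
  simp only [norm_smul, Real.norm_of_nonneg hs.le, mul_zpow]

/-- Divergence theorem on the sphere, for homogeneous functions on `ℝⁿ ∖ {0}`. -/
theorem integral_sphere_fderiv {n : ℕ} (hn : 0 < n) {m : ℤ} {f : Euc n → ℝ} (hf : PosHom m f)
    (hd : ∀ x, x ≠ 0 → ContDiffAt ℝ 1 f x) (v : Euc n) :
    ∫ θ : Sph n, fderiv ℝ f θ v ∂(sphMeas n) =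
      (n - 1 + m : ℝ) * ∫ θ : Sph n, f θ * ⟪(θ : Euc n), v⟫ ∂(sphMeas n) := by
  let g0 : ContDiffBump (2 : ℝ) := ⟨1 / 2, 1, by norm_num, by norm_num⟩
  set k : ℤ := -(m + n - 1) with hk
  set g : ℝ → ℝ := fun s => s ^ k * g0 s with hg
  set χ : Euc n → ℝ := fun x => g ‖x‖ with hχ
  have hg0supp : ∀ s : ℝ, ¬ (1 < s ∧ s < 3) → g0 s = 0 := by
    intro s hs
    refine g0.zero_of_le_dist ?_
    change (1 : ℝ) ≤ dist s 2
    rw [Real.dist_eq]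
    by_contra hlt
    rw [not_le, abs_lt] at hlt
    exact hs ⟨by linarith, by linarith⟩
  have hgd : ∀ s : ℝ, s ≠ 0 → HasDerivAt g (k * s ^ (k - 1) * g0 s + s ^ k * deriv g0 s) s := by
    intro s hs
    exact (hasDerivAt_zpow k s (Or.inl hs)).mul
      ((g0.contDiff (n := 1)).differentiable (by norm_num) s).hasDerivAt
  have hχ0 : ∀ x : Euc n, ‖x‖ < 1 → χ x = 0 := fun x hx => by
    simp only [hχ, hg, hg0supp ‖x‖ (fun h => by linarith [h.1]), mul_zero]
  have hχ3 : ∀ x : Euc n, 3 < ‖x‖ → χ x = 0 := fun x hx => by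
    simp only [hχ, hg, hg0supp ‖x‖ (fun h => by linarith [h.2]), mul_zero]
  have hχs : ContDiff ℝ 1 χ := by
    rw [contDiff_iff_contDiffAt]
    intro x
    by_cases hx : x = 0
    · refine (contDiffAt_const (c := (0 : ℝ))).congr_of_eventuallyEq ?_
      filter_upwards [isOpen_lt continuous_norm continuous_const |>.mem_nhds
        (show ‖x‖ < 1 by simp [hx])] with y hy
      exact hχ0 y hy
    · have hx' : ‖x‖ ≠ 0 := norm_ne_zero_iff.2 hx
      have h1 : ContDiffAt ℝ 1 (fun y : Euc n => ‖y‖) x := contDiffAt_norm ℝ hx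
      have h2 : ContDiffAt ℝ 1 g ‖x‖ := by
        refine ContDiffAt.mul ?_ g0.contDiff.contDiffAt
        rcases k with k | k
        · simpa using contDiffAt_id.pow k
        · simp only [zpow_negSucc]
          exact ContDiffAt.inv (f := fun s : ℝ => s ^ (k + 1)) (contDiffAt_id.pow (k + 1))
            (pow_ne_zero _ hx')
      exact h2.comp x h1
  have hsupp : tsupport χ ⊆ {x | 1 ≤ ‖x‖ ∧ ‖x‖ ≤ 3} := by
    refine closure_minimal ?_ ?_
    · intro x hx
      constructor
      · by_contra h; exact hx (hχ0 x (not_le.1 h))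
      · by_contra h; exact hx (hχ3 x (not_le.1 h))
    · exact (isClosed_le continuous_const continuous_norm).inter
        (isClosed_le continuous_norm continuous_const)
  have hcs : HasCompactSupport χ := by
    refine HasCompactSupport.of_support_subset_isCompact (isCompact_closedBall (0 : Euc n) 3) ?_
    intro x hx
    simpa using (hsupp (subset_tsupport _ hx)).2
  have hne : ∀ x ∈ tsupport χ, x ≠ 0 := by
    rintro x hx rfl
    have := (hsupp hx).1
    simp at this
    linarith
  have hcont : ∀ x ∈ tsupport χ, ContinuousAt f x := fun x hx => (hd x (hne x hx)).continuousAt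
  have hcontd : ∀ x ∈ tsupport χ, ContinuousAt (fun y => fderiv ℝ f y v) x := fun x hx =>
    ((hd x (hne x hx)).continuousAt_fderiv (by norm_num)).clm_apply continuousAt_const
  have aux : ∀ (a b : Euc n → ℝ), Continuous a → tsupport a ⊆ tsupport χ →
      (∀ x ∈ tsupport χ, ContinuousAt b x) → Integrable (fun x => a x * b x) := by
    intro a b ha hs hb
    refine Continuous.integrable_of_hasCompactSupport ?_ ?_
    · rw [continuous_iff_continuousAt]
      intro x
      by_cases hx : x ∈ tsupport χ
      · exact ha.continuousAt.mul (hb x hx)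
      · have hx' : x ∉ tsupport a := fun h => hx (hs h)
        refine (continuousAt_const (y := (0 : ℝ))).congr ?_
        rw [notMem_tsupport_iff_eventuallyEq] at hx'
        filter_upwards [hx'] with y hy
        simp [hy]
    · exact (hcs.mono' ((subset_tsupport a).trans hs)).mul_right
  have hfχ : tsupport (fun x => fderiv ℝ χ x v) ⊆ tsupport χ := by
    exact tsupport_fderiv_apply_subset ℝ v
  have hibp := integral_mul_fderiv_eq_neg_fderiv_mul_of_integrable (μ := (volume : Measure (Euc n)))
    (f := χ) (g := f) (v := v)
    (aux _ _ ((hχs.continuous_fderiv (by norm_num)).clm_apply continuous_const) hfχ hcont)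
    (aux _ _ hχs.continuous subset_rfl hcontd) (aux _ _ hχs.continuous subset_rfl hcont)
    (fun x _ => hχs.differentiable (by norm_num) x)
    (fun x hx => (hd x (hne x hx)).differentiableAt (by norm_num))
  have hL := integral_radial_mul hn
    (hf.fderiv_apply (fun x hx => (hd x hx).differentiableAt (by norm_num)) v) g
  have hR := integral_radial_mul hn
    ((hf.mul (posHom_inner_left v)).mul (posHom_norm_zpow (n := n) (-1))) (deriv g)
  have hderχ : ∀ x : Euc n, fderiv ℝ χ x v * f x =
      deriv g ‖x‖ * (f x * ⟪x, v⟫ * ‖x‖ ^ (-1 : ℤ)) := by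
    intro x
    by_cases hx : x = 0
    · have h1 : fderiv ℝ χ x = 0 := by
        have : χ =ᶠ[nhds x] fun _ => 0 := by
          filter_upwards [isOpen_lt continuous_norm continuous_const |>.mem_nhds
            (show ‖x‖ < 1 by simp [hx])] with y hy
          exact hχ0 y hy
        rw [this.fderiv_eq]; simp
      rw [h1, hx]; simp
    · have hx' : ‖x‖ ≠ 0 := norm_ne_zero_iff.2 hx
      have h1 : HasFDerivAt (fun y : Euc n => ‖y‖) (‖x‖⁻¹ • innerSL ℝ x) x := by
        have h0 := (hasStrictFDerivAt_norm_sq x).hasFDerivAt.sqrt (pow_ne_zero 2 hx')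
        simp only [Real.sqrt_sq (norm_nonneg _)] at h0
        refine h0.congr_fderiv ?_
        ext w
        simp
        field_simp
      have h2 := (hgd _ hx').differentiableAt.hasDerivAt.comp_hasFDerivAt x h1
      rw [show fderiv ℝ χ x = _ from h2.fderiv]
      simp
      ring
  have hR' : ∫ x, fderiv ℝ χ x v * f x = _ := (integral_congr_ae
    (Filter.Eventually.of_forall hderχ)).trans hR
  rw [hR'] at hibp
  rw [show ∫ x, χ x * fderiv ℝ f x v = _ from hL] at hibp
  simp only [sph_norm, one_zpow, mul_one] at hibp
  have hpow : ∀ s : ℝ, 0 < s → s ^ (n - 1) = s ^ ((n : ℤ) - 1) := fun s _ => by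
    rw [← zpow_natCast, Nat.cast_sub hn, Nat.cast_one]
  have hI1 : ∫ s in Ioi (0 : ℝ), s ^ (n - 1) * (g s * s ^ (m - 1)) =
      ∫ s in Ioi (0 : ℝ), s⁻¹ * g0 s := by
    refine setIntegral_congr_fun measurableSet_Ioi fun s hs => ?_
    have hs : (0 : ℝ) < s := hs
    simp only [hg, hpow s hs]
    rw [show s ^ ((n : ℤ) - 1) * (s ^ k * g0 s * s ^ (m - 1)) =
      (s ^ ((n : ℤ) - 1) * s ^ k * s ^ (m - 1)) * g0 s by ring, ← zpow_add₀ hs.ne',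
      ← zpow_add₀ hs.ne', show (n : ℤ) - 1 + k + (m - 1) = -1 by rw [hk]; ring, zpow_neg_one]
  have hI2 : ∫ s in Ioi (0 : ℝ), s ^ (n - 1) * (deriv g s * s ^ (m + 1 + -1)) =
      ∫ s in Ioi (0 : ℝ), (k * (s⁻¹ * g0 s) + deriv g0 s) := by
    refine setIntegral_congr_fun measurableSet_Ioi fun s hs => ?_
    have hs : (0 : ℝ) < s := hs
    simp only [(hgd s hs.ne').deriv, hpow s hs]
    rw [show s ^ ((n : ℤ) - 1) * ((k * s ^ (k - 1) * g0 s + s ^ k * deriv g0 s) * s ^ (m + 1 + -1))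
      = k * ((s ^ ((n : ℤ) - 1) * s ^ (k - 1) * s ^ (m + 1 + -1)) * g0 s) +
        (s ^ ((n : ℤ) - 1) * s ^ k * s ^ (m + 1 + -1)) * deriv g0 s by ring, ← zpow_add₀ hs.ne',
      ← zpow_add₀ hs.ne', ← zpow_add₀ hs.ne', ← zpow_add₀ hs.ne',
      show (n : ℤ) - 1 + (k - 1) + (m + 1 + -1) = -1 by rw [hk]; ring, zpow_neg_one,
      show (n : ℤ) - 1 + k + (m + 1 + -1) = 0 by rw [hk]; ring, zpow_zero, one_mul]
  have hg0c : ContDiff ℝ 1 g0 := g0.contDiff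
  have hg0cs : HasCompactSupport (g0 : ℝ → ℝ) := g0.hasCompactSupport
  have hcont1 : Continuous (fun s : ℝ => s⁻¹ * g0 s) := by
    rw [continuous_iff_continuousAt]
    intro s
    by_cases hs : s = 0
    · refine (continuousAt_const (y := (0 : ℝ))).congr ?_
      filter_upwards [isOpen_lt continuous_id continuous_const |>.mem_nhds
        (show s < 1 by simp [hs])] with y hy
      rw [hg0supp y (fun h => absurd h.1 (not_lt.2 (le_of_lt hy))), mul_zero]
    · exact (continuousAt_inv₀ hs).mul g0.continuous.continuousAt
  have hint1 : Integrable (fun s : ℝ => s⁻¹ * g0 s) :=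
    hcont1.integrable_of_hasCompactSupport hg0cs.mul_left
  have hint2 : Integrable (deriv (g0 : ℝ → ℝ)) :=
    (hg0c.continuous_deriv (by norm_num)).integrable_of_hasCompactSupport hg0cs.deriv
  have hsplit : ∫ s in Ioi (0 : ℝ), (k * (s⁻¹ * g0 s) + deriv g0 s) =
      k * ∫ s in Ioi (0 : ℝ), s⁻¹ * g0 s := by
    rw [integral_add (hint1.integrableOn.const_mul _) hint2.integrableOn, integral_const_mul,
      hg0cs.integral_Ioi_deriv_eq hg0c 0, hg0supp 0 (fun h => by linarith [h.1])]
    simp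
  have hposI : 0 < ∫ s in Ioi (0 : ℝ), s⁻¹ * g0 s := by
    have h1 : ∫ s in Ioi (0 : ℝ), s⁻¹ * g0 s = ∫ s, s⁻¹ * g0 s := by
      refine setIntegral_eq_integral_of_forall_compl_eq_zero fun s hs => ?_
      have hs : s ≤ 0 := not_lt.1 hs
      rw [hg0supp s (fun h => by linarith [h.1]), mul_zero]
    rw [h1]
    refine hcont1.integral_pos_of_hasCompactSupport_nonneg_nonzero hg0cs.mul_left (x := 2) ?_ ?_
    · intro s
      by_cases hs : 1 < s ∧ s < 3
      · exact mul_nonneg (inv_nonneg.2 (by linarith [hs.1])) g0.nonneg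
      · simp [hg0supp s hs]
    · have : g0 (2 : ℝ) = 1 := g0.one_of_mem_closedBall (by simp [g0.rIn_pos.le])
      simp [this]
  rw [hI1, hI2, hsplit] at hibp
  have hkr : (k : ℝ) = -(m + n - 1) := by rw [hk]; push_cast; ring
  rw [hkr] at hibp
  refine mul_right_cancel₀ hposI.ne' ?_
  rw [hibp]
  ring

/-- Admissible potentials: functions of class `C¹` on `ℝⁿ ∖ {0}`, positively homogeneous of
degree zero. -/
def Adm {n : ℕ} (u : Euc n → ℝ) : Prop :=
  PosHom 0 u ∧ ∀ x, x ≠ 0 → ContDiffAt ℝ 1 u x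

/-- The Dirichlet form on the unit sphere. -/
def dirichlet {n : ℕ} (u v : Euc n → ℝ) : ℝ :=
  ∫ θ : Sph n, ⟪gradient u (θ : Euc n), gradient v (θ : Euc n)⟫ ∂(sphMeas n)

/-- Evaluation of a polynomial at a point of Euclidean space. -/
def pev {n : ℕ} (P : MvPolynomial (Fin n) ℝ) (x : Euc n) : ℝ := MvPolynomial.eval x.ofLp P

/-- The Laplacian of a polynomial. -/
def polyLap {n : ℕ} (P : MvPolynomial (Fin n) ℝ) : MvPolynomial (Fin n) ℝ :=
  ∑ i, MvPolynomial.pderiv i (MvPolynomial.pderiv i P)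

/-- Standard basis vectors. -/
abbrev eb {n : ℕ} (i : Fin n) : Euc n := EuclideanSpace.single i (1 : ℝ)

lemma sph_integrable {n : ℕ} {f : Sph n → ℝ} (hf : Continuous f) : Integrable f (sphMeas n) :=
  hf.integrable_of_hasCompactSupport (HasCompactSupport.of_compactSpace f)

lemma gradient_apply {n : ℕ} (f : Euc n → ℝ) (x : Euc n) (i : Fin n) :
    gradient f x i = fderiv ℝ f x (eb i) := by
  rw [← inner_gradient_left, EuclideanSpace.inner_single_right]
  simp

lemma inner_eq_sum {n : ℕ} (a b : Euc n) : ⟪a, b⟫ = ∑ i, a i * b i := by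
  simp [PiLp.inner_apply, mul_comm]

lemma continuousOn_gradient {n : ℕ} {f : Euc n → ℝ} {x : Euc n} (h : ContDiffAt ℝ 1 f x) :
    ContinuousAt (gradient f) x := by
  have h1 := h.continuousAt_fderiv (by norm_num)
  exact (InnerProductSpace.toDual ℝ (Euc n)).symm.continuous.continuousAt.comp h1

lemma continuous_gradient_sph {n : ℕ} {f : Euc n → ℝ} (h : ∀ x, x ≠ 0 → ContDiffAt ℝ 1 f x) :
    Continuous (fun θ : Sph n => gradient f (θ : Euc n)) := by
  rw [continuous_iff_continuousAt]
  intro θ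
  exact (continuousOn_gradient (h θ (sph_ne_zero θ))).comp continuous_subtype_val.continuousAt

lemma continuous_sph {n : ℕ} {f : Euc n → ℝ} (h : ∀ x, x ≠ 0 → ContDiffAt ℝ 1 f x) :
    Continuous (fun θ : Sph n => f (θ : Euc n)) := by
  rw [continuous_iff_continuousAt]
  intro θ
  exact (h θ (sph_ne_zero θ)).continuousAt.comp continuous_subtype_val.continuousAt

namespace Adm

variable {n : ℕ} {u v : Euc n → ℝ}

lemma differentiableAt (hu : Adm u) {x : Euc n} (hx : x ≠ 0) : DifferentiableAt ℝ u x :=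
  (hu.2 x hx).differentiableAt (by norm_num)

lemma sub (hu : Adm u) (hv : Adm v) : Adm (fun x => u x - v x) := by
  refine ⟨fun s hs x hx => ?_, fun x hx => (hu.2 x hx).sub (hv.2 x hx)⟩
  simp only [hu.1 s hs x hx, hv.1 s hs x hx]
  ring

lemma sub_const (hu : Adm u) (c : ℝ) : Adm (fun x => u x - c) := by
  refine ⟨fun s hs x hx => ?_, fun x hx => (hu.2 x hx).sub contDiffAt_const⟩
  simp [hu.1 s hs x hx]

lemma gradient_sub (hu : Adm u) (hv : Adm v) {x : Euc n} (hx : x ≠ 0) :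
    gradient (fun x => u x - v x) x = gradient u x - gradient v x := by
  simp only [gradient]
  rw [fderiv_fun_sub (hu.differentiableAt hx) (hv.differentiableAt hx), map_sub]

lemma inner_self_gradient (hu : Adm u) {x : Euc n} (hx : x ≠ 0) : ⟪gradient u x, x⟫ = 0 := by
  rw [inner_gradient_left]
  have h1 : HasDerivAt (fun s : ℝ => u (s • x)) (fderiv ℝ u x x) 1 := by
    have h2 : HasDerivAt (fun s : ℝ => s • x) ((1 : ℝ) • x) 1 := (hasDerivAt_id 1).smul_const x
    have h3 : HasFDerivAt u (fderiv ℝ u x) ((1 : ℝ) • x) := by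
      rw [one_smul]; exact (hu.differentiableAt hx).hasFDerivAt
    have h4 := h3.comp_hasDerivAt (1 : ℝ) h2
    rw [one_smul] at h4
    exact h4
  have h2 : HasDerivAt (fun s : ℝ => u (s • x)) 0 1 := by
    refine (hasDerivAt_const (1 : ℝ) (u x)).congr_of_eventuallyEq ?_
    filter_upwards [lt_mem_nhds (show (0 : ℝ) < 1 by norm_num)] with s hs
    simp [hu.1 s hs x hx]
  exact h1.unique h2

lemma continuous_sph (hu : Adm u) : Continuous (fun θ : Sph n => u (θ : Euc n)) :=
  _root_.continuous_sph hu.2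

lemma continuous_grad (hu : Adm u) : Continuous (fun θ : Sph n => gradient u (θ : Euc n)) :=
  continuous_gradient_sph hu.2

end Adm

lemma dirichlet_comm {n : ℕ} (u v : Euc n → ℝ) : dirichlet u v = dirichlet v u := by
  simp only [dirichlet, real_inner_comm]

lemma dirichlet_self_nonneg {n : ℕ} (u : Euc n → ℝ) : 0 ≤ dirichlet u u :=
  integral_nonneg fun _ => real_inner_self_nonneg

lemma dirichlet_sub_left {n : ℕ} {u v w : Euc n → ℝ} (hu : Adm u) (hv : Adm v)
    (hw : ∀ x, x ≠ 0 → ContDiffAt ℝ 1 w x) :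
    dirichlet (fun x => u x - v x) w = dirichlet u w - dirichlet v w := by
  simp only [dirichlet]
  rw [← integral_sub]
  · refine integral_congr_ae (Filter.Eventually.of_forall fun θ => ?_)
    simp only [hu.gradient_sub hv (sph_ne_zero θ), inner_sub_left]
  · exact sph_integrable (hu.continuous_grad.inner (continuous_gradient_sph hw))
  · exact sph_integrable (hv.continuous_grad.inner (continuous_gradient_sph hw))

/-- Composition with the radial projection onto the unit sphere. -/
def radExt {n : ℕ} (f : Euc n → ℝ) (x : Euc n) : ℝ := f (‖x‖⁻¹ • x)

lemma radExt_sph {n : ℕ} (f : Euc n → ℝ) (θ : Sph n) : radExt f (θ : Euc n) = f θ := by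
  simp [radExt]

lemma adm_radExt {n : ℕ} {f : Euc n → ℝ} (hf : ContDiff ℝ 1 f) : Adm (radExt f) := by
  refine ⟨fun s hs x hx => ?_, fun x hx => ?_⟩
  · simp only [radExt, norm_smul, Real.norm_of_nonneg hs.le, zpow_zero, one_mul, smul_smul]
    congr 2
    field_simp
  · exact hf.contDiffAt.comp x
      (((contDiffAt_norm ℝ hx).inv (norm_ne_zero_iff.2 hx)).smul contDiffAt_id)

lemma dirichlet_radExt {n : ℕ} {u f : Euc n → ℝ} (hu : Adm u) (hf : ContDiff ℝ 1 f) :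
    dirichlet u (radExt f) = dirichlet u f := by
  refine integral_congr_ae (Filter.Eventually.of_forall fun θ => ?_)
  have hθ := sph_ne_zero θ
  have hn : HasFDerivAt (fun y : Euc n => ‖y‖) (innerSL ℝ (θ : Euc n)) (θ : Euc n) := by
    have h0 := (hasStrictFDerivAt_norm_sq (θ : Euc n)).hasFDerivAt.sqrt
      (by rw [sph_norm]; norm_num)
    simp only [Real.sqrt_sq (norm_nonneg _)] at h0
    refine h0.congr_fderiv ?_
    ext w
    simp
  have hi : HasFDerivAt (fun y : Euc n => ‖y‖⁻¹) (-innerSL ℝ (θ : Euc n)) (θ : Euc n) := by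
    have h1 : HasDerivAt (fun s : ℝ => s⁻¹) (-1) ‖(θ : Euc n)‖ := by
      have := hasDerivAt_inv (x := ‖(θ : Euc n)‖) (by simp)
      simpa using this
    refine (h1.comp_hasFDerivAt _ hn).congr_fderiv ?_
    ext w; simp
  have hr : HasFDerivAt (radExt f) ((fderiv ℝ f (θ : Euc n)).comp
      (ContinuousLinearMap.id ℝ _ - (innerSL ℝ (θ : Euc n)).smulRight (θ : Euc n))) θ := by
    have hs := hi.fun_smul (hasFDerivAt_id (θ : Euc n))
    have hd : HasFDerivAt f (fderiv ℝ f (θ : Euc n)) (‖(θ : Euc n)‖⁻¹ • (θ : Euc n)) := by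
      have : ‖(θ : Euc n)‖⁻¹ • (θ : Euc n) = θ := by simp
      rw [this]
      exact (hf.differentiable (by norm_num) _).hasFDerivAt
    refine (HasFDerivAt.comp (f := fun y : Euc n => ‖y‖⁻¹ • y) (θ : Euc n) hd hs).congr_fderiv ?_
    ext w
    simp [sub_eq_add_neg]
  simp only
  rw [real_inner_comm, inner_gradient_left, hr.fderiv, real_inner_comm, inner_gradient_left]
  have := hu.inner_self_gradient hθ
  rw [real_inner_comm] at this
  simp [this]

section Poly

open MvPolynomial

variable {n : ℕ}

lemma pev_add (P Q : MvPolynomial (Fin n) ℝ) : pev (P + Q) = fun x => pev P x + pev Q x := by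
  ext x; simp [pev]

lemma pev_smul (a : ℝ) (P : MvPolynomial (Fin n) ℝ) : pev (a • P) = fun x => a * pev P x := by
  ext x; simp [pev, smul_eval]

lemma contDiff_pev (P : MvPolynomial (Fin n) ℝ) : ContDiff ℝ 1 (pev P) := by
  induction P using MvPolynomial.induction_on with
  | C a =>
    have : pev (C a) = fun _ : Euc n => a := by ext x; simp [pev]
    rw [this]
    exact contDiff_const
  | add p q hp hq => rw [pev_add]; exact hp.add hq
  | mul_X p i hp =>
    have : pev (p * X i) = fun x : Euc n => pev p x * x i := by ext x; simp [pev]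
    rw [this]
    exact hp.mul (by fun_prop)

lemma fderiv_pev (P : MvPolynomial (Fin n) ℝ) (x : Euc n) (i : Fin n) :
    fderiv ℝ (pev P) x (eb i) = pev (pderiv i P) x := by
  induction P using MvPolynomial.induction_on with
  | C a =>
    have : pev (C a) = fun _ : Euc n => a := by ext x; simp [pev]
    rw [this, pderiv_C]
    simp [pev]
  | add p q hp hq =>
    rw [pev_add, fderiv_fun_add ((contDiff_pev p).differentiable (by norm_num) x)
      ((contDiff_pev q).differentiable (by norm_num) x), map_add, pev_add]
    simp [hp, hq]
  | mul_X p j hp =>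
    have h1 : pev (p * X j) = fun x : Euc n => pev p x * x j := by ext x; simp [pev]
    have h2 : HasFDerivAt (fun x : Euc n => x j) (EuclideanSpace.proj j : Euc n →L[ℝ] ℝ) x :=
      (EuclideanSpace.proj j : Euc n →L[ℝ] ℝ).hasFDerivAt
    rw [h1, (((contDiff_pev p).differentiable (by norm_num) x).hasFDerivAt.fun_mul h2).fderiv]
    simp only [_root_.add_apply, _root_.smul_apply, hp, pderiv_mul, pderiv_X]
    by_cases h : i = j
    · subst h; simp [pev]; ring
    · simp [pev, Ne.symm h, mul_comm]

lemma posHom_pev {P : MvPolynomial (Fin n) ℝ} {N : ℕ} (hP : P.IsHomogeneous N) :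
    PosHom (N : ℤ) (pev P) := by
  intro s hs x hx
  simp only [pev, eval_eq, Finset.mul_sum, zpow_natCast]
  refine Finset.sum_congr rfl fun d hd => ?_
  have hN : ∑ i, d i = N := by
    have := hP (mem_support_iff.1 hd)
    rw [← this, Finsupp.weight_apply, Finsupp.sum_fintype] <;> simp
  simp only [PiLp.smul_apply, smul_eq_mul, mul_pow]
  have : ∏ i ∈ d.support, (s ^ d i * x.ofLp i ^ d i) =
      s ^ N * ∏ i ∈ d.support, x.ofLp i ^ d i := by
    rw [Finset.prod_mul_distrib, Finset.prod_pow_eq_pow_sum, ← hN]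
    congr 2
    exact Finset.sum_subset (Finset.subset_univ _) (by simp)
  rw [this]; ring

lemma dirichlet_pev_homogeneous (hn : 0 < n) {u : Euc n → ℝ} (hu : Adm u)
    {P : MvPolynomial (Fin n) ℝ} {N : ℕ} (hP : P.IsHomogeneous N) :
    dirichlet u (pev P) = N * (N + n - 2) * ∫ θ : Sph n, u θ * pev P (θ : Euc n) ∂(sphMeas n) -
      ∫ θ : Sph n, u θ * pev (polyLap P) (θ : Euc n) ∂(sphMeas n) := by
  have hc := fun P : MvPolynomial (Fin n) ℝ => continuous_sph
    (f := pev P) fun x _ => (contDiff_pev P).contDiffAt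
  have hcg := hu.continuous_grad
  have hcu := hu.continuous_sph
  have hmain : ∀ i, ∫ θ : Sph n, gradient u (θ : Euc n) i * pev (pderiv i P) (θ : Euc n) ∂(sphMeas n)
      = (N + n - 2) * ∫ θ : Sph n, u θ * ((θ : Euc n) i * pev (pderiv i P) (θ : Euc n)) ∂(sphMeas n)
        - ∫ θ : Sph n, u θ * pev (pderiv i (pderiv i P)) (θ : Euc n) ∂(sphMeas n) := by
    intro i
    rcases N with _ | N
    · rw [← totalDegree_zero_iff_isHomogeneous, totalDegree_eq_zero_iff_eq_C] at hP
      rw [hP, pderiv_C]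
      simp [pev]
    · have hQ : PosHom (N : ℤ) (pev (pderiv i P)) := posHom_pev hP.pderiv
      have hd : ∀ x : Euc n, x ≠ 0 → ContDiffAt ℝ 1 (fun y => u y * pev (pderiv i P) y) x :=
        fun x hx => (hu.2 x hx).mul (contDiff_pev _).contDiffAt
      have h := integral_sphere_fderiv hn (hu.1.mul hQ) hd (eb i)
      have hexp : ∀ θ : Sph n, fderiv ℝ (fun y => u y * pev (pderiv i P) y) (θ : Euc n) (eb i) =
          gradient u (θ : Euc n) i * pev (pderiv i P) (θ : Euc n) +
            u θ * pev (pderiv i (pderiv i P)) (θ : Euc n) := by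
        intro θ
        rw [((hu.differentiableAt (sph_ne_zero θ)).hasFDerivAt.fun_mul
          (((contDiff_pev (pderiv i P)).differentiable (by norm_num) _).hasFDerivAt)).fderiv]
        simp only [_root_.add_apply, _root_.smul_apply, fderiv_pev, gradient_apply, smul_eq_mul]
        ring
      simp only [hexp] at h
      rw [integral_add] at h
      · rw [eq_sub_iff_add_eq, h]
        push_cast
        rw [show (n : ℝ) - 1 + (0 + N) = N + 1 + n - 2 by ring]
        congr 1
        refine integral_congr_ae (Filter.Eventually.of_forall fun θ => ?_)
        simp only [EuclideanSpace.inner_single_right]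
        simp
        ring
      · exact sph_integrable (((EuclideanSpace.proj i : Euc n →L[ℝ] ℝ).continuous.comp hcg).mul
          (hc _))
      · exact sph_integrable (hcu.mul (hc _))
  have hpr : ∀ i : Fin n, Continuous fun θ : Sph n => (θ : Euc n) i := fun i =>
    (EuclideanSpace.proj i : Euc n →L[ℝ] ℝ).continuous.comp continuous_subtype_val
  have e1 : dirichlet u (pev P) = ∑ i, ∫ θ : Sph n, gradient u (θ : Euc n) i *
      pev (pderiv i P) (θ : Euc n) ∂(sphMeas n) := by
    rw [← integral_finsetSum]
    · refine integral_congr_ae (Filter.Eventually.of_forall fun θ => ?_)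
      simp only [inner_eq_sum, gradient_apply (pev P), fderiv_pev]
    · intro i _
      exact sph_integrable (((EuclideanSpace.proj i : Euc n →L[ℝ] ℝ).continuous.comp hcg).mul (hc _))
  rw [e1, Finset.sum_congr rfl fun i _ => hmain i, Finset.sum_sub_distrib, ← Finset.mul_sum,
    ← integral_finsetSum, ← integral_finsetSum]
  · congr 1
    · rw [mul_comm (N : ℝ), mul_assoc, ← integral_const_mul (N : ℝ)]
      congr 1
      refine integral_congr_ae (Filter.Eventually.of_forall fun θ => ?_)
      have h := congrArg (fun Q => pev Q (θ : Euc n)) hP.sum_X_mul_pderiv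
      simp only [pev, map_sum, map_mul, eval_X, nsmul_eq_mul, map_natCast] at h
      simp only [← Finset.mul_sum]
      simp only [pev]
      rw [h]
      ring
    · refine integral_congr_ae (Filter.Eventually.of_forall fun θ => ?_)
      simp [polyLap, pev, Finset.mul_sum]
  · intro i _
    exact sph_integrable (hcu.mul (hc _))
  · intro i _
    exact sph_integrable (hcu.mul ((hpr i).mul (hc _)))

end Poly

/-- Continuity of the restriction to the unit sphere. -/
def SphCont {n : ℕ} (f : Euc n → ℝ) : Prop := Continuous fun θ : Sph n => f (θ : Euc n)

/-- The `L²` inner product on the unit sphere. -/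
def sip {n : ℕ} (f g : Euc n → ℝ) : ℝ := ∫ θ : Sph n, f θ * g θ ∂(sphMeas n)

section Sip

variable {n : ℕ} {f g h : Euc n → ℝ}

lemma sip_comm (f g : Euc n → ℝ) : sip f g = sip g f := by simp only [sip, mul_comm]

lemma sip_add_left (hf : SphCont f) (hg : SphCont g) (hh : SphCont h) :
    sip (fun x => f x + g x) h = sip f h + sip g h := by
  simp only [sip, add_mul]
  exact integral_add (sph_integrable (hf.mul hh)) (sph_integrable (hg.mul hh))

lemma sip_sub_left (hf : SphCont f) (hg : SphCont g) (hh : SphCont h) :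
    sip (fun x => f x - g x) h = sip f h - sip g h := by
  simp only [sip, sub_mul]
  exact integral_sub (sph_integrable (hf.mul hh)) (sph_integrable (hg.mul hh))

lemma sip_add_right (hf : SphCont f) (hg : SphCont g) (hh : SphCont h) :
    sip h (fun x => f x + g x) = sip h f + sip h g := by
  rw [sip_comm, sip_add_left hf hg hh, sip_comm f, sip_comm g]

lemma sip_sub_right (hf : SphCont f) (hg : SphCont g) (hh : SphCont h) :
    sip h (fun x => f x - g x) = sip h f - sip h g := by
  rw [sip_comm, sip_sub_left hf hg hh, sip_comm f, sip_comm g]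

lemma sip_const_mul_right (a : ℝ) : sip h (fun x => a * f x) = a * sip h f := by
  simp only [sip, ← integral_const_mul]
  congr 1; ext; ring

lemma sip_const_mul_left (a : ℝ) : sip (fun x => a * f x) h = a * sip f h := by
  rw [sip_comm, sip_const_mul_right, sip_comm]

lemma sip_self_nonneg (f : Euc n → ℝ) : 0 ≤ sip f f := integral_nonneg fun _ => mul_self_nonneg _

lemma sip_congr {f' g' : Euc n → ℝ} (hf : ∀ θ : Sph n, f θ = f' θ) (hg : ∀ θ : Sph n, g θ = g' θ) :
    sip f g = sip f' g' := by
  simp only [sip, hf, hg]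

lemma SphCont.add (hf : SphCont f) (hg : SphCont g) : SphCont fun x => f x + g x :=
  Continuous.add hf hg

lemma SphCont.sub (hf : SphCont f) (hg : SphCont g) : SphCont fun x => f x - g x :=
  Continuous.sub hf hg

lemma sphCont_pev (P : MvPolynomial (Fin n) ℝ) : SphCont (pev P) :=
  continuous_sph fun _ _ => (contDiff_pev P).contDiffAt

end Sip

lemma dirichlet_add_right {n : ℕ} {u v w : Euc n → ℝ} (hu : ∀ x, x ≠ 0 → ContDiffAt ℝ 1 u x)
    (hv : ∀ x, x ≠ 0 → ContDiffAt ℝ 1 v x) (hw : ∀ x, x ≠ 0 → ContDiffAt ℝ 1 w x) :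
    dirichlet w (fun x => u x + v x) = dirichlet w u + dirichlet w v := by
  simp only [dirichlet]
  rw [← integral_add]
  · refine integral_congr_ae (Filter.Eventually.of_forall fun θ => ?_)
    have h1 := (hu θ (sph_ne_zero θ)).differentiableAt (by norm_num)
    have h2 := (hv θ (sph_ne_zero θ)).differentiableAt (by norm_num)
    simp only [gradient, ← inner_add_right]
    rw [fderiv_fun_add h1 h2, map_add]
  · exact sph_integrable ((continuous_gradient_sph hw).inner (continuous_gradient_sph hu))
  · exact sph_integrable ((continuous_gradient_sph hw).inner (continuous_gradient_sph hv))

/-- Polynomials of degree at most `M`. -/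
abbrev PolyLe (n M : ℕ) : Submodule ℝ (MvPolynomial (Fin n) ℝ) :=
  MvPolynomial.restrictTotalDegree (Fin n) ℝ M

section Spectral

open MvPolynomial

variable {n : ℕ}

lemma PolyLe.mono {M N : ℕ} (h : M ≤ N) : PolyLe n M ≤ PolyLe n N := by
  intro P hP
  rw [mem_restrictTotalDegree] at *
  exact hP.trans h

lemma pev_sub (P Q : MvPolynomial (Fin n) ℝ) : pev (P - Q) = fun x => pev P x - pev Q x := by
  ext x; simp [pev]

lemma mem_polyLe_of_homogeneous {P : MvPolynomial (Fin n) ℝ} {N M : ℕ} (h : P.IsHomogeneous N)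
    (hNM : N ≤ M) : P ∈ PolyLe n M :=
  (mem_restrictTotalDegree _ _ _).2 (h.totalDegree_le.trans hNM)

/-- The Dirichlet form against a polynomial is the `L²` product with a polynomial of at most the
same degree, with the spherical Laplacian's eigenvalue as leading factor. -/
lemma exists_sphLap (hn : 0 < n) {M : ℕ} {P : MvPolynomial (Fin n) ℝ} (hP : P ∈ PolyLe n (M + 1)) :
    ∃ Q ∈ PolyLe n (M + 1), Q - ((M + 1 : ℝ) * (M + 1 + n - 2)) • P ∈ PolyLe n M ∧
      ∀ u, Adm u → dirichlet u (pev P) = sip u (pev Q) := by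
  rw [mem_restrictTotalDegree] at hP
  rw [← sum_homogeneousComponent P]
  refine Finset.sum_induction (fun i => homogeneousComponent i P)
    (fun P => ∃ Q ∈ PolyLe n (M + 1), Q - ((M + 1 : ℝ) * (M + 1 + n - 2)) • P ∈ PolyLe n M ∧
      ∀ u, Adm u → dirichlet u (pev P) = sip u (pev Q)) ?_ ?_ ?_
  · rintro P₁ P₂ ⟨Q₁, h₁, h₁', h₁''⟩ ⟨Q₂, h₂, h₂', h₂''⟩
    refine ⟨Q₁ + Q₂, add_mem h₁ h₂, ?_, fun u hu => ?_⟩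
    · have := add_mem h₁' h₂'
      convert this using 1
      rw [smul_add]; abel
    · rw [pev_add, pev_add, dirichlet_add_right (fun x _ => (contDiff_pev _).contDiffAt)
        (fun x _ => (contDiff_pev _).contDiffAt) hu.2, h₁'' u hu, h₂'' u hu,
        sip_add_right (sphCont_pev _) (sphCont_pev _) hu.continuous_sph]
  · refine ⟨0, zero_mem _, by simp, fun u hu => ?_⟩
    have h0 : pev (0 : MvPolynomial (Fin n) ℝ) = fun _ : Euc n => 0 := by ext x; simp [pev]
    simp [h0, sip, dirichlet, gradient]
  · intro i hi
    have hi' : i ≤ M + 1 := (Nat.lt_succ_iff.1 (Finset.mem_range.1 hi)).trans hP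
    set R := homogeneousComponent i P with hR
    have hh : R.IsHomogeneous i := homogeneousComponent_isHomogeneous i P
    have hlap : (polyLap R).IsHomogeneous (i - 1 - 1) :=
      IsHomogeneous.sum _ _ _ fun j _ => hh.pderiv.pderiv
    refine ⟨((i : ℝ) * (i + n - 2)) • R - polyLap R, ?_, ?_, fun u hu => ?_⟩
    · exact sub_mem (Submodule.smul_mem _ _ (mem_polyLe_of_homogeneous hh hi'))
        (mem_polyLe_of_homogeneous hlap (by omega))
    · have hl : polyLap R ∈ PolyLe n M := mem_polyLe_of_homogeneous hlap (by omega)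
      rcases hi'.lt_or_eq with h | h
      · have hm : R ∈ PolyLe n M := mem_polyLe_of_homogeneous hh (by omega)
        exact sub_mem (sub_mem (Submodule.smul_mem _ _ hm) hl) (Submodule.smul_mem _ _ hm)
      · rw [h]
        push_cast
        rw [sub_sub_cancel_left]
        exact neg_mem hl
    · rw [dirichlet_pev_homogeneous hn hu hh, pev_sub, pev_smul,
        sip_sub_right ?_ (sphCont_pev _) hu.continuous_sph, sip_const_mul_right]
      · rfl
      · exact continuous_const.mul (sphCont_pev R)

/-- Restriction of polynomials to the sphere, as elements of `L²`. -/
def pevL2 (n : ℕ) : MvPolynomial (Fin n) ℝ →ₗ[ℝ] Lp ℝ 2 (sphMeas n) where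
  toFun P := ContinuousMap.toLp 2 (sphMeas n) ℝ ⟨fun θ => pev P θ, sphCont_pev P⟩
  map_add' P Q := by
    rw [← map_add]; congr 1; ext θ; exact congrFun (pev_add P Q) θ
  map_smul' a P := by
    rw [RingHom.id_apply, ← map_smul]; congr 1; ext θ; exact congrFun (pev_smul a P) θ

lemma exists_proj {f : Euc n → ℝ} (hf : SphCont f) (M : ℕ) :
    ∃ P ∈ PolyLe n M, ∀ Q ∈ PolyLe n M, sip (fun x => f x - pev P x) (pev Q) = 0 := by
  set U : Submodule ℝ (Lp ℝ 2 (sphMeas n)) := (PolyLe n M).map (pevL2 n) with hU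
  have hfin : Module.Finite ℝ (PolyLe n M) := inferInstance
  have : FiniteDimensional ℝ U := by rw [hU]; infer_instance
  set F : Lp ℝ 2 (sphMeas n) := ContinuousMap.toLp 2 (sphMeas n) ℝ ⟨fun θ => f θ, hf⟩ with hF
  obtain ⟨P, hP, hPeq⟩ := (Submodule.mem_map).1 (U.starProjection_apply_mem F)
  refine ⟨P, hP, fun Q hQ => ?_⟩
  have h := U.starProjection_inner_eq_zero F (pevL2 n Q) (Submodule.mem_map_of_mem hQ)
  rw [← hPeq] at h
  simp only [hF, pevL2, LinearMap.coe_mk, AddHom.coe_mk] at h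
  rw [← map_sub, ContinuousMap.inner_toLp] at h
  simp only [ContinuousMap.coe_sub, Pi.sub_apply, conj_trivial] at h
  rw [sip_comm]
  exact h

lemma exists_poly_near {f : Euc n → ℝ} (hf : SphCont f) {δ : ℝ} (hδ : 0 < δ) :
    ∃ P : MvPolynomial (Fin n) ℝ, ∀ θ : Sph n, |f θ - pev P θ| < δ := by
  let T : MvPolynomial (Fin n) ℝ →ₐ[ℝ] C(Sph n, ℝ) :=
    MvPolynomial.aeval fun i => ⟨fun θ => (θ : Euc n) i,
      (EuclideanSpace.proj i : Euc n →L[ℝ] ℝ).continuous.comp continuous_subtype_val⟩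
  have hT : ∀ P (θ : Sph n), T P θ = pev P θ := by
    intro P θ
    induction P using MvPolynomial.induction_on with
    | C a => simp [T, pev]
    | add p q hp hq => simp [hp, hq, pev_add]
    | mul_X p i hp => simp only [map_mul, ContinuousMap.mul_apply, hp]; simp [T, pev]; exact Or.inl rfl
  have hsep : T.range.SeparatesPoints := by
    intro a b hab
    have : ∃ i, (a : Euc n) i ≠ (b : Euc n) i := by
      by_contra! h
      exact hab (Subtype.ext (by ext i; exact h i))
    obtain ⟨i, hi⟩ := this
    refine ⟨_, ⟨T (X i), ⟨X i, rfl⟩, rfl⟩, ?_⟩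
    simpa [hT, pev] using hi
  obtain ⟨⟨g, P, hP⟩, hg⟩ :=
    ContinuousMap.exists_mem_subalgebra_near_continuous_of_separatesPoints T.range hsep
      (fun θ => f θ) hf δ hδ
  refine ⟨P, fun θ => ?_⟩
  have := hg θ
  simp only [← hP] at this
  rw [Real.norm_eq_abs, abs_sub_comm] at this
  rw [← hT P θ]
  exact this

lemma dirichlet_add_right_pev {u : Euc n → ℝ} (hu : Adm u) (P Q : MvPolynomial (Fin n) ℝ) :
    dirichlet u (pev (P + Q)) = dirichlet u (pev P) + dirichlet u (pev Q) := by
  rw [pev_add]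
  exact dirichlet_add_right (fun x _ => (contDiff_pev _).contDiffAt)
    (fun x _ => (contDiff_pev _).contDiffAt) hu.2

lemma adm_rp (P : MvPolynomial (Fin n) ℝ) : Adm (radExt (pev P)) := adm_radExt (contDiff_pev P)

lemma sip_rp_left (P : MvPolynomial (Fin n) ℝ) (f : Euc n → ℝ) :
    sip (radExt (pev P)) f = sip (pev P) f :=
  sip_congr (fun θ => radExt_sph _ θ) fun _ => rfl

lemma dirichlet_poly_ge (hn : 0 < n) (M : ℕ) : ∀ P ∈ PolyLe n (M + 2),
    (∀ Q ∈ PolyLe n 2, sip (pev P) (pev Q) = 0) →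
      3 * (n + 1) * sip (pev P) (pev P) ≤ dirichlet (radExt (pev P)) (radExt (pev P)) := by
  induction M with
  | zero =>
    intro P hP h
    rw [h P hP, mul_zero]
    exact dirichlet_self_nonneg _
  | succ M ih =>
    intro P hP h
    obtain ⟨Q, hQ, hPQ⟩ := exists_proj (sphCont_pev P) (M + 2)
    obtain ⟨z, hz⟩ : ∃ z, z = P - Q := ⟨_, rfl⟩
    have hzp : ∀ R ∈ PolyLe n (M + 2), sip (pev z) (pev R) = 0 := fun R hR => by
      rw [hz, pev_sub]; exact hPQ R hR
    have hzm : z ∈ PolyLe n (M + 2 + 1) := by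
      rw [hz]
      exact sub_mem hP (PolyLe.mono (Nat.le_succ _) hQ)
    have hPz : P = Q + z := by rw [hz]; abel
    obtain ⟨LQ, hLQ, -, hLQ'⟩ := exists_sphLap hn (M := M + 1) hQ
    obtain ⟨Lz, hLz, hLz1, hLz'⟩ := exists_sphLap hn hzm
    have hQ2 : ∀ R ∈ PolyLe n 2, sip (pev Q) (pev R) = 0 := by
      intro R hR
      have h1 := h R hR
      rw [hPz, pev_add, sip_add_left (sphCont_pev _) (sphCont_pev _) (sphCont_pev _),
        hzp R (PolyLe.mono (by omega) hR), add_zero] at h1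
      exact h1
    have h1 := ih Q hQ hQ2
    rw [dirichlet_radExt (adm_rp Q) (contDiff_pev Q), hLQ' _ (adm_rp Q), sip_rp_left] at h1
    have h2 : sip (pev Q) (pev Lz) = 0 := by
      rw [← sip_rp_left, ← hLz' _ (adm_rp Q), ← dirichlet_radExt (adm_rp Q) (contDiff_pev z),
        dirichlet_comm, dirichlet_radExt (adm_rp z) (contDiff_pev Q), hLQ' _ (adm_rp z),
        sip_rp_left]
      exact hzp _ hLQ
    have h3 := hzp _ hLz1
    rw [pev_sub, sip_sub_right (sphCont_pev _) (sphCont_pev _) (sphCont_pev _), pev_smul,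
      sip_const_mul_right] at h3
    have h4 := hzp _ hLQ
    have h5 := hzp _ hQ
    have h6 := h5
    rw [sip_comm] at h6
    have h7 := sip_self_nonneg (pev z)
    rw [dirichlet_radExt (adm_rp P) (contDiff_pev P)]
    nth_rw 4 [hPz]
    rw [dirichlet_add_right_pev (adm_rp P), hLQ' _ (adm_rp P), hLz' _ (adm_rp P), sip_rp_left,
      sip_rp_left, hPz]
    simp only [pev_add]
    rw [sip_add_left (sphCont_pev _) (sphCont_pev _) (sphCont_pev _),
      sip_add_left (sphCont_pev _) (sphCont_pev _) (sphCont_pev _), h2, h4,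
      sip_add_left (sphCont_pev _) (sphCont_pev _) (SphCont.add (sphCont_pev Q) (sphCont_pev z)),
      sip_add_right (sphCont_pev _) (sphCont_pev _) (sphCont_pev _),
      sip_add_right (sphCont_pev _) (sphCont_pev _) (sphCont_pev _), h5, h6]
    push_cast at h3
    have hM : (0 : ℝ) ≤ M := Nat.cast_nonneg M
    have hn' : (1 : ℝ) ≤ n := by exact_mod_cast hn
    have h8 : 3 * ((n : ℝ) + 1) ≤ (M + 2 + 1) * (M + 2 + 1 + n - 2) := by nlinarith
    nlinarith [mul_le_mul_of_nonneg_right h8 h7]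

/-- Third eigenvalue gap on the sphere. -/
theorem dirichlet_gap (hn : 0 < n) {u : Euc n → ℝ} (hu : Adm u)
    (h : ∀ Q ∈ PolyLe n 2, sip u (pev Q) = 0) :
    3 * (n + 1) * sip u u ≤ dirichlet u u := by
  have hcu : SphCont u := hu.continuous_sph
  set s := (sphMeas n).real univ with hs
  have hs0 : 0 ≤ s := measureReal_nonneg
  have key : ∀ δ : ℝ, 0 < δ → 3 * (n + 1) * (sip u u - δ ^ 2 * s) ≤ dirichlet u u := by
    intro δ hδ
    obtain ⟨R, hR⟩ := exists_poly_near hcu hδ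
    set M := R.totalDegree with hM
    have hRM : R ∈ PolyLe n (M + 2) := (mem_restrictTotalDegree _ _ _).2 (by omega)
    obtain ⟨P, hP, hPu⟩ := exists_proj hcu (M + 2)
    have hcP := sphCont_pev P
    have hcR := sphCont_pev R
    have hP2 : ∀ Q ∈ PolyLe n 2, sip (pev P) (pev Q) = 0 := by
      intro Q hQ
      have h1 := hPu Q (PolyLe.mono (by omega) hQ)
      rw [sip_sub_left hcu hcP (sphCont_pev Q), h Q hQ] at h1
      linarith
    have h1 := dirichlet_poly_ge hn M P hP hP2
    set v := radExt (pev P) with hv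
    have hav : Adm v := adm_rp P
    have hd := hu.sub hav
    obtain ⟨L, hL, -, hL'⟩ := exists_sphLap hn (M := M + 1) hP
    have h2 : dirichlet (fun x => u x - v x) v = 0 := by
      rw [hv, dirichlet_radExt hd (contDiff_pev P), hL' _ hd]
      rw [← hPu L hL]
      exact sip_congr (fun θ => by rw [hv, radExt_sph]) fun _ => rfl
    have h3 := dirichlet_self_nonneg (fun x => u x - v x)
    rw [dirichlet_sub_left hu hav hd.2, dirichlet_comm u, dirichlet_comm v,
      dirichlet_sub_left hu hav hu.2, h2] at h3
    rw [dirichlet_sub_left hu hav hav.2] at h2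
    rw [dirichlet_comm v u] at h3
    have h4 : sip u u ≤ sip (pev P) (pev P) + δ ^ 2 * s := by
      have e1 := hPu P hP
      have e2 := hPu R hRM
      have e3 : sip (fun x => u x - pev R x) (fun x => u x - pev R x) ≤ δ ^ 2 * s := by
        have : ∫ θ : Sph n, δ ^ 2 ∂(sphMeas n) = δ ^ 2 * s := by
          rw [integral_const, smul_eq_mul, mul_comm]
        rw [← this]
        refine integral_mono (sph_integrable ((hcu.sub hcR).mul (hcu.sub hcR)))
          (integrable_const _) fun θ => ?_
        simp only
        rw [← sq, ← sq_abs]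
        exact pow_le_pow_left₀ (abs_nonneg _) (hR θ).le 2
      have e4 := sip_self_nonneg (fun x => pev P x - pev R x)
      have hsw := sip_comm (pev P) (pev R)
      have hsw1 := sip_comm u (pev R)
      have hsw2 := sip_comm u (pev P)
      rw [sip_sub_left hcu hcP hcP] at e1
      rw [sip_sub_left hcu hcP hcR] at e2
      rw [sip_sub_left hcu hcR (SphCont.sub hcu hcR), sip_sub_right hcu hcR hcu,
        sip_sub_right hcu hcR hcR] at e3
      rw [sip_sub_left hcP hcR (SphCont.sub hcP hcR), sip_sub_right hcP hcR hcP,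
        sip_sub_right hcP hcR hcR] at e4
      linarith
    have hn' : (0 : ℝ) ≤ n := Nat.cast_nonneg n
    nlinarith
  have hlim : Filter.Tendsto (fun δ : ℝ => 3 * (n + 1) * (sip u u - δ ^ 2 * s))
      (nhdsWithin 0 (Ioi 0)) (nhds (3 * (n + 1) * (sip u u - 0 ^ 2 * s))) := by
    refine Filter.Tendsto.mono_left ?_ nhdsWithin_le_nhds
    exact Continuous.tendsto (by fun_prop) 0
  have := le_of_tendsto hlim (by filter_upwards [self_mem_nhdsWithin] with δ hδ using key δ hδ)
  simpa using this

end Spectral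

/-- The total surface measure of the unit sphere. -/
def sarea (n : ℕ) : ℝ := (sphMeas n).real univ

lemma divg_eq_sum {n : ℕ} (X : Euc n → Euc n) (x : Euc n) :
    divg X x = ∑ i, fderiv ℝ X x (eb i) i := by
  rw [divg, LinearMap.trace_eq_sum_inner _ (EuclideanSpace.basisFun (Fin n) ℝ)]
  refine Finset.sum_congr rfl fun i _ => ?_
  simp [EuclideanSpace.inner_single_left]

/-- Divergence theorem on the sphere for homogeneous vector fields. -/
theorem integral_sphere_divg {n : ℕ} (hn : 0 < n) {m : ℤ} {X : Euc n → Euc n}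
    (hX : ∀ s : ℝ, 0 < s → ∀ x : Euc n, x ≠ 0 → X (s • x) = s ^ m • X x)
    (hd : ∀ x, x ≠ 0 → ContDiffAt ℝ 1 X x) :
    ∫ θ : Sph n, divg X θ ∂(sphMeas n) =
      (n - 1 + m : ℝ) * ∫ θ : Sph n, ⟪X θ, (θ : Euc n)⟫ ∂(sphMeas n) := by
  have hproj : ∀ i : Fin n, ∀ x : Euc n, x ≠ 0 → ContDiffAt ℝ 1 (fun y => X y i) x := by
    intro i x hx
    exact (EuclideanSpace.proj i : Euc n →L[ℝ] ℝ).contDiff.contDiffAt.comp x (hd x hx)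
  have hfd : ∀ i : Fin n, ∀ θ : Sph n, ∀ v : Euc n, fderiv ℝ (fun y => X y i) (θ : Euc n) v =
      fderiv ℝ X (θ : Euc n) v i := by
    intro i θ v
    have := ((EuclideanSpace.proj i : Euc n →L[ℝ] ℝ).hasFDerivAt.comp (θ : Euc n)
      ((hd θ (sph_ne_zero θ)).differentiableAt (by norm_num)).hasFDerivAt).fderiv
    exact congrArg (fun A : Euc n →L[ℝ] ℝ => A v) this
  have hpr : ∀ i : Fin n, Continuous fun θ : Sph n => (θ : Euc n) i := fun i =>
    (EuclideanSpace.proj i : Euc n →L[ℝ] ℝ).continuous.comp continuous_subtype_val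
  simp only [divg_eq_sum, inner_eq_sum]
  rw [integral_finsetSum, integral_finsetSum, Finset.mul_sum]
  · refine Finset.sum_congr rfl fun i _ => ?_
    have h := integral_sphere_fderiv hn (f := fun y => X y i) (m := m)
      (fun s hs x hx => by simp [hX s hs x hx]) (hproj i) (eb i)
    simp only [hfd] at h
    rw [h]
    congr 1
    refine integral_congr_ae (Filter.Eventually.of_forall fun θ => ?_)
    simp [EuclideanSpace.inner_single_right]
  · intro i _
    exact sph_integrable ((continuous_sph (hproj i)).mul (hpr i))
  · intro i _
    have := (continuous_gradient_sph (hproj i))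
    have h2 := (EuclideanSpace.proj i : Euc n →L[ℝ] ℝ).continuous.comp this
    refine sph_integrable (h2.congr fun θ => ?_)
    simp [gradient_apply, hfd]

/-- Symmetric traceless endomorphisms of Euclidean space. -/
def SymTr0 {n : ℕ} (B : Euc n →L[ℝ] Euc n) : Prop :=
  (∀ x y, ⟪B x, y⟫ = ⟪x, B y⟫) ∧ LinearMap.trace ℝ (Euc n) B.toLinearMap = 0

section Moments

variable {n : ℕ}

lemma hasFDerivAt_quad {B : Euc n →L[ℝ] Euc n} (hB : ∀ x y, ⟪B x, y⟫ = ⟪x, B y⟫) (x : Euc n) :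
    HasFDerivAt (fun y => ⟪B y, y⟫) ((2 : ℝ) • innerSL ℝ (B x)) x := by
  refine (B.hasFDerivAt.inner ℝ (hasFDerivAt_id x)).congr_fderiv ?_
  ext w
  simp [real_inner_comm, ← hB x w, two_mul]

lemma integral_sph_linear (hn : 2 ≤ n) (v : Euc n) :
    ∫ θ : Sph n, ⟪v, (θ : Euc n)⟫ ∂(sphMeas n) = 0 := by
  have h := integral_sphere_fderiv (n := n) (by omega) (m := 0) (f := fun _ => 1)
    (fun s _ x _ => by simp) (fun x _ => contDiffAt_const) v
  simp only [fderiv_fun_const, Pi.zero_apply, _root_.zero_apply, integral_zero, one_mul] at h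
  have hn' : (2 : ℝ) ≤ n := by exact_mod_cast hn
  have h2 : ((n : ℝ) - 1 + (0 : ℤ)) ≠ 0 := by push_cast; linarith
  have := (mul_eq_zero.1 h.symm).resolve_left h2
  simpa only [real_inner_comm] using this

lemma integral_sph_quad (hn : 0 < n) (A : Euc n →L[ℝ] Euc n) :
    ∫ θ : Sph n, ⟪A (θ : Euc n), (θ : Euc n)⟫ ∂(sphMeas n) =
      LinearMap.trace ℝ (Euc n) A.toLinearMap * sarea n / n := by
  have h := integral_sphere_divg (n := n) hn (m := 1) (X := fun x => A x)
    (fun s _ x _ => by simp) (fun x _ => A.contDiff.contDiffAt)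
  have h1 : ∀ θ : Sph n, divg (fun x => A x) (θ : Euc n) = LinearMap.trace ℝ (Euc n) A.toLinearMap := by
    intro θ
    rw [divg, A.fderiv]
  simp only [h1, integral_const, smul_eq_mul] at h
  have hn' : (n : ℝ) ≠ 0 := by positivity
  field_simp
  rw [sarea, mul_comm (LinearMap.trace _ _ _), h]
  push_cast
  ring

lemma integral_sph_linear_mul (hn : 0 < n) (v w : Euc n) :
    ∫ θ : Sph n, ⟪v, (θ : Euc n)⟫ * ⟪w, (θ : Euc n)⟫ ∂(sphMeas n) = sarea n / n * ⟪v, w⟫ := by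
  have h := integral_sphere_fderiv (n := n) hn (m := 1) (f := fun x => ⟪v, x⟫)
    (fun s _ x _ => by simp [inner_smul_right]) (fun x _ => (innerSL ℝ v).contDiff.contDiffAt) w
  have h1 : ∀ θ : Sph n, fderiv ℝ (fun x => ⟪v, x⟫) (θ : Euc n) w = ⟪v, w⟫ := by
    intro θ
    have : fderiv ℝ (fun x : Euc n => ⟪v, x⟫) (θ : Euc n) = innerSL ℝ v := (innerSL ℝ v).fderiv
    rw [this]; simp
  simp only [h1, integral_const, smul_eq_mul] at h
  have hn' : (n : ℝ) ≠ 0 := by positivity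
  rw [div_mul_eq_mul_div, eq_div_iff hn', sarea, h]
  push_cast
  simp only [real_inner_comm]
  ring

lemma SymTr0.integral_quad (hn : 0 < n) {B : Euc n →L[ℝ] Euc n} (hB : SymTr0 B) :
    ∫ θ : Sph n, ⟪B (θ : Euc n), (θ : Euc n)⟫ ∂(sphMeas n) = 0 := by
  rw [integral_sph_quad hn, hB.2]; simp

lemma SymTr0.integral_linear_quad (hn : 2 ≤ n) {B : Euc n →L[ℝ] Euc n} (hB : SymTr0 B)
    (v : Euc n) :
    ∫ θ : Sph n, ⟪v, (θ : Euc n)⟫ * ⟪B (θ : Euc n), (θ : Euc n)⟫ ∂(sphMeas n) = 0 := by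
  have h := integral_sphere_fderiv (n := n) (by omega) (m := 2) (f := fun x => ⟪B x, x⟫)
    (fun s _ x _ => by simp [inner_smul_right, inner_smul_left]; ring)
    (fun x _ => (B.contDiff.inner ℝ contDiff_id).contDiffAt) v
  have h1 : ∀ θ : Sph n, fderiv ℝ (fun x => ⟪B x, x⟫) (θ : Euc n) v = 2 * ⟪B v, (θ : Euc n)⟫ := by
    intro θ
    rw [(hasFDerivAt_quad hB.1 _).fderiv]
    simp only [_root_.smul_apply, innerSL_apply_apply, smul_eq_mul]
    rw [hB.1, real_inner_comm, hB.1, real_inner_comm]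
  simp only [h1, integral_const_mul, integral_sph_linear hn, mul_zero] at h
  have h2 : ((n : ℝ) - 1 + (2 : ℤ)) ≠ 0 := by
    have hn0 : (0 : ℝ) ≤ n := Nat.cast_nonneg n
    push_cast
    linarith
  have := (mul_eq_zero.1 h.symm).resolve_left h2
  simpa only [real_inner_comm, mul_comm] using this

lemma SymTr0.integral_norm_sq (hn : 0 < n) {B : Euc n →L[ℝ] Euc n} (hB : SymTr0 B) :
    ∫ θ : Sph n, ‖B (θ : Euc n)‖ ^ 2 ∂(sphMeas n) =
      (n + 2) / 2 * ∫ θ : Sph n, ⟪B (θ : Euc n), (θ : Euc n)⟫ ^ 2 ∂(sphMeas n) := by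
  have hcB : Continuous fun θ : Sph n => B (θ : Euc n) := B.continuous.comp continuous_subtype_val
  have h := integral_sphere_divg (n := n) hn (m := 3) (X := fun x => ⟪B x, x⟫ • B x)
    (fun s _ x _ => by
      simp only [map_smul, inner_smul_right, inner_smul_left, smul_smul, conj_trivial]
      congr 1
      rw [show (3 : ℤ) = ((3 : ℕ) : ℤ) from rfl, zpow_natCast]
      ring)
    (fun x _ => ((B.contDiff.inner ℝ contDiff_id).smul B.contDiff).contDiffAt)
  have h1 : ∀ θ : Sph n, divg (fun x => ⟪B x, x⟫ • B x) (θ : Euc n) = 2 * ‖B (θ : Euc n)‖ ^ 2 := by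
    intro θ
    rw [divg, ((hasFDerivAt_quad hB.1 _).fun_smul B.hasFDerivAt).fderiv]
    have : ((⟪B (θ : Euc n), (θ : Euc n)⟫ • B + ((2 : ℝ) • innerSL ℝ (B (θ : Euc n))).smulRight
        (B (θ : Euc n)) : Euc n →L[ℝ] Euc n) : Euc n →ₗ[ℝ] Euc n) =
        ⟪B (θ : Euc n), (θ : Euc n)⟫ • B.toLinearMap +
          (2 : ℝ) • LinearMap.smulRight (innerSL ℝ (B (θ : Euc n))).toLinearMap (B (θ : Euc n)) := by
      ext; simp [smul_smul]
    rw [this, map_add, map_smul, hB.2, map_smul, LinearMap.trace_smulRight]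
    simp
  simp only [h1, integral_const_mul] at h
  have h2 : ∀ θ : Sph n, ⟪⟪B (θ : Euc n), (θ : Euc n)⟫ • B (θ : Euc n), (θ : Euc n)⟫ =
      ⟪B (θ : Euc n), (θ : Euc n)⟫ ^ 2 := fun θ => by
    rw [real_inner_smul_left, sq]
  simp only [h2] at h
  push_cast at h
  linarith

lemma integral_grad_linear (hn : 0 < n) {u : Euc n → ℝ} (hu : Adm u) (v : Euc n) :
    ∫ θ : Sph n, ⟪gradient u (θ : Euc n), v⟫ ∂(sphMeas n) =
      (n - 1) * ∫ θ : Sph n, u θ * ⟪v, (θ : Euc n)⟫ ∂(sphMeas n) := by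
  have h := integral_sphere_fderiv hn hu.1 hu.2 v
  simp only [inner_gradient_left, h]
  push_cast
  simp only [real_inner_comm, add_zero]

lemma SymTr0.integral_grad_quad (hn : 0 < n) {B : Euc n →L[ℝ] Euc n} (hB : SymTr0 B)
    {u : Euc n → ℝ} (hu : Adm u) :
    ∫ θ : Sph n, ⟪gradient u (θ : Euc n), B (θ : Euc n)⟫ ∂(sphMeas n) =
      n * ∫ θ : Sph n, u θ * ⟪B (θ : Euc n), (θ : Euc n)⟫ ∂(sphMeas n) := by
  have h := integral_sphere_divg (n := n) hn (m := 1) (X := fun x => u x • B x)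
    (fun s hs x hx => by
      simp only [map_smul, smul_smul, hu.1 s hs x hx]
      congr 1
      simp [mul_comm])
    (fun x hx => (hu.2 x hx).smul B.contDiff.contDiffAt)
  have h1 : ∀ θ : Sph n, divg (fun x => u x • B x) (θ : Euc n) =
      ⟪gradient u (θ : Euc n), B (θ : Euc n)⟫ := by
    intro θ
    rw [divg, ((hu.differentiableAt (sph_ne_zero θ)).hasFDerivAt.fun_smul B.hasFDerivAt).fderiv]
    have : ((u (θ : Euc n) • B + (fderiv ℝ u (θ : Euc n)).smulRight
        (B (θ : Euc n)) : Euc n →L[ℝ] Euc n) : Euc n →ₗ[ℝ] Euc n) =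
        u (θ : Euc n) • B.toLinearMap +
          LinearMap.smulRight (fderiv ℝ u (θ : Euc n)).toLinearMap (B (θ : Euc n)) := by
      ext; simp
    rw [this, map_add, map_smul, hB.2, LinearMap.trace_smulRight, inner_gradient_left]
    simp
  simp only [h1, real_inner_smul_left] at h
  rw [h]
  push_cast
  ring

end Moments

section Modes

open MvPolynomial

variable {n : ℕ}

/-- The endomorphism with the given matrix. -/
def ofCoeffs (h : Fin n → Fin n → ℝ) : Euc n →L[ℝ] Euc n :=
  ∑ i, ∑ j, h i j • (innerSL ℝ (eb j : Euc n)).smulRight (eb i : Euc n)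

lemma inner_ofCoeffs (h : Fin n → Fin n → ℝ) (x y : Euc n) :
    ⟪ofCoeffs h x, y⟫ = ∑ i, ∑ j, h i j * (x j * y i) := by
  simp only [ofCoeffs, _root_.sum_apply, sum_inner]
  refine Finset.sum_congr rfl fun i _ => Finset.sum_congr rfl fun j _ => ?_
  simp [real_inner_smul_left, EuclideanSpace.inner_single_left]

lemma trace_clm_eq_sum (B : Euc n →L[ℝ] Euc n) :
    LinearMap.trace ℝ (Euc n) B.toLinearMap = ∑ i, ⟪eb i, B (eb i)⟫ := by
  rw [LinearMap.trace_eq_sum_inner _ (EuclideanSpace.basisFun (Fin n) ℝ)]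
  refine Finset.sum_congr rfl fun i _ => ?_
  simp

/-- Removing the trace and antisymmetric part of a quadratic form on the unit sphere. -/
lemma exists_symTr0 (hn : 0 < n) (h : Fin n → Fin n → ℝ) :
    ∃ (B : Euc n →L[ℝ] Euc n) (c : ℝ), SymTr0 B ∧ ∀ θ : Sph n,
      ∑ i, ∑ j, h i j * ((θ : Euc n) j * (θ : Euc n) i) = c + ⟪B (θ : Euc n), (θ : Euc n)⟫ := by
  set k : Fin n → Fin n → ℝ := fun i j => (h i j + h j i) / 2 with hk
  set A := ofCoeffs k with hA
  set t := LinearMap.trace ℝ (Euc n) A.toLinearMap with ht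
  have hn' : (n : ℝ) ≠ 0 := by positivity
  have hAs : ∀ x y, ⟪A x, y⟫ = ⟪x, A y⟫ := by
    intro x y
    rw [real_inner_comm (A y), hA, inner_ofCoeffs, inner_ofCoeffs, Finset.sum_comm]
    refine Finset.sum_congr rfl fun i _ => Finset.sum_congr rfl fun j _ => ?_
    simp only [hk]
    ring
  refine ⟨A - (t / n) • ContinuousLinearMap.id ℝ _, t / n, ⟨fun x y => ?_, ?_⟩, fun θ => ?_⟩
  · simp [inner_sub_left, inner_sub_right, hAs, real_inner_smul_left, inner_smul_right]
  · have : (A - (t / n) • ContinuousLinearMap.id ℝ (Euc n)).toLinearMap =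
        A.toLinearMap - (t / n) • LinearMap.id := by ext; simp
    rw [this, map_sub, map_smul, LinearMap.trace_id, ← ht]
    simp
    field_simp
    ring
  · have h1 : ⟪A (θ : Euc n), (θ : Euc n)⟫ = ∑ i, ∑ j, h i j * ((θ : Euc n) j * (θ : Euc n) i) := by
      rw [hA, inner_ofCoeffs]
      have e1 : ∑ i, ∑ j, h j i * ((θ : Euc n) j * (θ : Euc n) i) =
          ∑ i, ∑ j, h i j * ((θ : Euc n) j * (θ : Euc n) i) := by
        rw [Finset.sum_comm]
        refine Finset.sum_congr rfl fun i _ => Finset.sum_congr rfl fun j _ => ?_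
        ring
      have e2 : ∀ i j, k i j * ((θ : Euc n) j * (θ : Euc n) i) =
          (1 / 2) * (h i j * ((θ : Euc n) j * (θ : Euc n) i)) +
            (1 / 2) * (h j i * ((θ : Euc n) j * (θ : Euc n) i)) := fun i j => by
        simp only [hk]; ring
      simp only [e2, Finset.sum_add_distrib, ← Finset.mul_sum, e1]
      ring
    simp only [_root_.sub_apply, _root_.smul_apply, ContinuousLinearMap.coe_id', id_eq,
      inner_sub_left, real_inner_smul_left, h1, real_inner_self_eq_norm_sq, sph_norm]
    ring

lemma pev_of_totalDegree_zero {P : MvPolynomial (Fin n) ℝ} (hP : P.IsHomogeneous 0) (x : Euc n) :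
    pev P x = coeff 0 P := by
  rw [← totalDegree_zero_iff_isHomogeneous, totalDegree_eq_zero_iff_eq_C] at hP
  rw [hP]; simp [pev]

/-- A polynomial of degree at most two on the unit sphere. -/
lemma exists_quadratic_form (hn : 0 < n) {P : MvPolynomial (Fin n) ℝ} (hP : P ∈ PolyLe n 2) :
    ∃ (c : ℝ) (w : Euc n) (B : Euc n →L[ℝ] Euc n), SymTr0 B ∧
      ∀ θ : Sph n, pev P θ = c + ⟪w, (θ : Euc n)⟫ + ⟪B (θ : Euc n), (θ : Euc n)⟫ := by
  rw [mem_restrictTotalDegree] at hP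
  set P0 := homogeneousComponent 0 P
  set P1 := homogeneousComponent 1 P
  set P2 := homogeneousComponent 2 P
  have h0 : P0.IsHomogeneous 0 := homogeneousComponent_isHomogeneous 0 P
  have h1 : P1.IsHomogeneous 1 := homogeneousComponent_isHomogeneous 1 P
  have h2 : P2.IsHomogeneous 2 := homogeneousComponent_isHomogeneous 2 P
  have hsum : P = P0 + P1 + P2 := by
    conv_lhs => rw [← sum_homogeneousComponent P]
    rw [Finset.sum_subset (s₂ := Finset.range 3)]
    · simp [Finset.sum_range_succ, P0, P1, P2]
    · intro i hi; simp at *; omega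
    · intro i _ hi
      refine homogeneousComponent_eq_zero _ _ ?_
      simpa using hi
  have e1 : ∀ x : Euc n, pev P1 x = ∑ i, x i * coeff 0 (pderiv i P1) := by
    intro x
    have h := congrArg (fun Q => pev Q x) h1.sum_X_mul_pderiv
    simp only [pev, map_sum, map_mul, eval_X, one_smul] at h
    rw [pev, ← h]
    refine Finset.sum_congr rfl fun i _ => ?_
    congr 1
    exact pev_of_totalDegree_zero h1.pderiv x
  have e2 : ∀ x : Euc n, pev P2 x =
      ∑ i, ∑ j, (coeff 0 (pderiv j (pderiv i P2)) / 2) * (x j * x i) := by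
    intro x
    have h := congrArg (fun Q => pev Q x) h2.sum_X_mul_pderiv
    simp only [pev, map_sum, map_mul, eval_X, map_nsmul] at h
    have h' : pev P2 x = (1 / 2) * ∑ i, x i * pev (pderiv i P2) x := by
      simp only [pev, h, nsmul_eq_mul]; push_cast; ring
    rw [h', Finset.mul_sum]
    refine Finset.sum_congr rfl fun i _ => ?_
    have h3 := congrArg (fun Q => pev Q x) (h2.pderiv (i := i)).sum_X_mul_pderiv
    simp only [pev, map_sum, map_mul, eval_X, Nat.add_one_sub_one, one_smul] at h3
    rw [pev, ← h3, Finset.mul_sum, Finset.mul_sum]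
    refine Finset.sum_congr rfl fun j _ => ?_
    have h4 := pev_of_totalDegree_zero ((h2.pderiv (i := i)).pderiv (i := j)) x
    rw [pev] at h4
    rw [h4]
    ring
  obtain ⟨B, c, hB, hBc⟩ := exists_symTr0 hn fun i j => coeff 0 (pderiv j (pderiv i P2)) / 2
  refine ⟨coeff 0 P0 + c, WithLp.toLp 2 fun i => coeff 0 (pderiv i P1), B, hB, fun θ => ?_⟩
  rw [hsum, pev_add, pev_add]
  simp only
  rw [pev_of_totalDegree_zero h0, e1, e2, hBc]
  have h3 : ⟪(WithLp.toLp 2 fun i => coeff 0 (pderiv i P1) : Euc n), (θ : Euc n)⟫ =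
      ∑ i, (θ : Euc n) i * coeff 0 (pderiv i P1) := by
    rw [inner_eq_sum]
    exact Finset.sum_congr rfl fun i _ => mul_comm _ _
  rw [h3]
  ring

lemma exists_poly_quadratic (c : ℝ) (w : Euc n) (B : Euc n →L[ℝ] Euc n) :
    ∃ P ∈ PolyLe n 2, pev P = fun x => c + ⟪w, x⟫ + ⟪B x, x⟫ := by
  refine ⟨C c + ∑ i, C (w i) * X i + ∑ i, ∑ j, C (B (eb j) i) * (X j * X i), ?_, ?_⟩
  · refine add_mem (add_mem ?_ (sum_mem fun i _ => ?_)) (sum_mem fun i _ => sum_mem fun j _ => ?_)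
    · exact mem_polyLe_of_homogeneous (isHomogeneous_C _ c) (by norm_num)
    · exact mem_polyLe_of_homogeneous ((isHomogeneous_C _ _).mul (isHomogeneous_X _ i)) (by norm_num)
    · exact mem_polyLe_of_homogeneous ((isHomogeneous_C _ _).mul
        ((isHomogeneous_X _ j).mul (isHomogeneous_X _ i))) (by norm_num)
  · ext x
    have hx : B x = ∑ j, x j • B (eb j) := by
      conv_lhs => rw [← (EuclideanSpace.basisFun (Fin n) ℝ).sum_repr x]
      simp
    simp only [pev, map_add, map_sum, map_mul, eval_C, eval_X, inner_eq_sum, hx]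
    congr 1
    refine Finset.sum_congr rfl fun i _ => ?_
    simp [Finset.sum_mul]
    refine Finset.sum_congr rfl fun j _ => ?_
    ring

/-- Decomposition of the `L²` norm and the Dirichlet energy on the sphere into spherical
harmonics of degree `0`, `1`, `2`, and a remainder controlled by the third spectral gap. -/
theorem exists_mode_decomp (hn : 2 ≤ n) {u : Euc n → ℝ} (hu : Adm u) :
    ∃ (c : ℝ) (w : Euc n) (B : Euc n →L[ℝ] Euc n), SymTr0 B ∧
      ∫ θ : Sph n, u θ ∂(sphMeas n) = c * sarea n ∧
      (∀ v : Euc n, sip u (fun x => ⟪v, x⟫) = sarea n / n * ⟪w, v⟫) ∧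
      sip u (fun x => ⟪B x, x⟫) = sip (fun x => ⟪B x, x⟫) (fun x => ⟪B x, x⟫) ∧
      0 ≤ sip u u - c ^ 2 * sarea n - sarea n / n * ‖w‖ ^ 2 -
        sip (fun x => ⟪B x, x⟫) (fun x => ⟪B x, x⟫) ∧
      3 * (n + 1) * (sip u u - c ^ 2 * sarea n - sarea n / n * ‖w‖ ^ 2 -
        sip (fun x => ⟪B x, x⟫) (fun x => ⟪B x, x⟫)) ≤
        dirichlet u u - (n - 1) * (sarea n / n) * ‖w‖ ^ 2 -
          2 * n * sip (fun x => ⟪B x, x⟫) (fun x => ⟪B x, x⟫) := by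
  have hn0 : 0 < n := by omega
  have hcu : SphCont u := hu.continuous_sph
  obtain ⟨P₀, hP₀, hproj₀⟩ := exists_proj hcu 2
  obtain ⟨c, w, B, hB, hq⟩ := exists_quadratic_form hn0 hP₀
  obtain ⟨P, hP, hPq⟩ := exists_poly_quadratic c w B
  have hproj : ∀ Q ∈ PolyLe n 2, sip (fun x => u x - pev P x) (pev Q) = 0 := by
    intro Q hQ
    rw [← hproj₀ Q hQ]
    exact sip_congr (fun θ => by rw [hPq, hq θ]) fun _ => rfl
  have hcP := sphCont_pev P
  have hl : ∀ v : Euc n, ∃ Q ∈ PolyLe n 2, pev Q = fun x => ⟪v, x⟫ := fun v => by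
    obtain ⟨Q, hQ, h⟩ := exists_poly_quadratic 0 v (0 : Euc n →L[ℝ] Euc n)
    exact ⟨Q, hQ, by rw [h]; ext x; simp⟩
  obtain ⟨Q1, hQ1, hQ1'⟩ : ∃ Q ∈ PolyLe n 2, pev Q = fun _ : Euc n => 1 := by
    obtain ⟨Q, hQ, h⟩ := exists_poly_quadratic 1 (0 : Euc n) (0 : Euc n →L[ℝ] Euc n)
    exact ⟨Q, hQ, by rw [h]; ext x; simp⟩
  obtain ⟨Q2, hQ2, hQ2'⟩ : ∃ Q ∈ PolyLe n 2, pev Q = fun x : Euc n => ⟪B x, x⟫ := by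
    obtain ⟨Q, hQ, h⟩ := exists_poly_quadratic 0 (0 : Euc n) B
    exact ⟨Q, hQ, by rw [h]; ext x; simp⟩
  have hcv : ∀ v : Euc n, SphCont (fun x => ⟪v, x⟫) := fun v => by
    obtain ⟨Q, -, h⟩ := hl v; rw [← h]; exact sphCont_pev Q
  have hcB : SphCont (fun x => ⟪B x, x⟫) := hQ2' ▸ sphCont_pev Q2
  have hc1 : SphCont (fun _ : Euc n => c) := continuous_const
  have hsplit : ∀ f : Euc n → ℝ, SphCont f → sip (pev P) f =
      sip (fun _ => c) f + sip (fun x => ⟪w, x⟫) f + sip (fun x => ⟪B x, x⟫) f := by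
    intro f hf
    rw [hPq, sip_add_left (f := fun x => c + ⟪w, x⟫) (hc1.add (hcv w)) hcB hf,
      sip_add_left hc1 (hcv w) hf]
  have hperp : ∀ Q ∈ PolyLe n 2, sip u (pev Q) = sip (pev P) (pev Q) := by
    intro Q hQ
    have := hproj Q hQ
    rw [sip_sub_left hcu hcP (sphCont_pev Q)] at this
    linarith
  have m1 : ∀ v : Euc n, sip (fun _ => c) (fun x => ⟪v, x⟫) = 0 := fun v => by
    simp only [sip, integral_const_mul, integral_sph_linear hn, mul_zero]
  have m2 : sip (fun _ => c) (fun x => ⟪B x, x⟫) = 0 := by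
    simp only [sip, integral_const_mul, hB.integral_quad hn0, mul_zero]
  have m3 : ∀ v : Euc n, sip (fun x => ⟪v, x⟫) (fun x => ⟪B x, x⟫) = 0 :=
    fun v => hB.integral_linear_quad hn v
  have m3' : ∀ v : Euc n, sip (fun x => ⟪B x, x⟫) (fun x => ⟪v, x⟫) = 0 := fun v => by
    rw [sip_comm]; exact m3 v
  have m4 : ∀ v : Euc n, sip (fun x => ⟪w, x⟫) (fun x => ⟪v, x⟫) = sarea n / n * ⟪w, v⟫ :=
    fun v => integral_sph_linear_mul hn0 w v
  have s1 : ∀ v : Euc n, sip (pev P) (fun x => ⟪v, x⟫) = sarea n / n * ⟪w, v⟫ := fun v => by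
    rw [hsplit _ (hcv v), m1, m4, m3']; ring
  have s2 : sip (pev P) (fun x => ⟪B x, x⟫) = sip (fun x => ⟪B x, x⟫) (fun x => ⟪B x, x⟫) := by
    rw [hsplit _ hcB, m2, m3]; ring
  have s0 : sip (pev P) (fun _ => 1) = c * sarea n := by
    rw [hsplit (fun _ => 1) (continuous_const : Continuous fun _ : Sph n => (1 : ℝ))]
    have h1 : sip (fun x => ⟪w, x⟫) (fun _ => (1 : ℝ)) = 0 := by
      simp only [sip, mul_one, integral_sph_linear hn]
    have h2 : sip (fun x => ⟪B x, x⟫) (fun _ => (1 : ℝ)) = 0 := by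
      simp only [sip, mul_one, hB.integral_quad hn0]
    have h3 : sip (fun _ : Euc n => c) (fun _ => (1 : ℝ)) = c * sarea n := by
      simp only [sip, mul_one, integral_const, smul_eq_mul, sarea, mul_comm]
    rw [h1, h2, h3]; ring
  have s0' : sip (pev P) (fun _ => c) = c ^ 2 * sarea n := by
    have := sip_const_mul_right (f := fun _ => 1) (h := pev P) c
    simp only [mul_one] at this
    rw [this, s0]; ring
  have sP : sip (pev P) (pev P) = c ^ 2 * sarea n + sarea n / n * ‖w‖ ^ 2 +
      sip (fun x => ⟪B x, x⟫) (fun x => ⟪B x, x⟫) := by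
    rw [hsplit _ hcP, sip_comm _ (pev P), sip_comm _ (pev P), sip_comm _ (pev P), s0', s1, s2,
      real_inner_self_eq_norm_sq]
  set v := radExt (pev P) with hv
  have hav : Adm v := adm_rp P
  have hd := hu.sub hav
  have hds : ∀ f : Euc n → ℝ, sip (fun x => u x - v x) f = sip (fun x => u x - pev P x) f :=
    fun f => sip_congr (fun θ => by rw [hv, radExt_sph]) fun _ => rfl
  have hgap := dirichlet_gap hn0 hd (fun Q hQ => by rw [hds]; exact hproj Q hQ)
  have e1 : sip (fun x => u x - v x) (fun x => u x - v x) = sip u u - sip (pev P) (pev P) := by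
    rw [hds, sip_comm, hds]
    have h1 := hperp P hP
    have h2 := sip_comm u (pev P)
    rw [sip_sub_left hcu hcP (SphCont.sub hcu hcP), sip_sub_right hcu hcP hcu,
      sip_sub_right hcu hcP hcP]
    linarith
  have e2 : ∀ f : Euc n → ℝ, Adm f → dirichlet f v = (n - 1) * sip f (fun x => ⟪w, x⟫) +
      2 * n * sip f (fun x => ⟪B x, x⟫) := by
    intro f hf
    rw [hv, dirichlet_radExt hf (contDiff_pev P), hPq]
    have hg : ∀ θ : Sph n, gradient (fun x => c + ⟪w, x⟫ + ⟪B x, x⟫) (θ : Euc n) =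
        w + (2 : ℝ) • B (θ : Euc n) := by
      intro θ
      refine HasGradientAt.gradient (hasGradientAt_iff_hasFDerivAt.2 ?_)
      refine (((innerSL ℝ w).hasFDerivAt.const_add c).add (hasFDerivAt_quad hB.1 _)).congr_fderiv ?_
      ext y
      simp
    simp only [dirichlet, hg, inner_add_right, inner_smul_right]
    have hcB' : Continuous fun θ : Sph n => B (θ : Euc n) := B.continuous.comp continuous_subtype_val
    rw [integral_add (sph_integrable (hf.continuous_grad.inner continuous_const))
      ((sph_integrable (hf.continuous_grad.inner hcB')).const_mul 2),
      integral_const_mul, integral_grad_linear hn0 hf, hB.integral_grad_quad hn0 hf]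
    simp only [sip]
    ring
  have e3 : dirichlet (fun x => u x - v x) (fun x => u x - v x) = dirichlet u u -
      ((n - 1) * (sarea n / n) * ‖w‖ ^ 2 +
        2 * n * sip (fun x => ⟪B x, x⟫) (fun x => ⟪B x, x⟫)) := by
    have h1 := e2 u hu
    have h2 := e2 v hav
    have h3 : ∀ f : Euc n → ℝ, sip v f = sip (pev P) f := fun f => sip_rp_left P f
    obtain ⟨Q, hQ, hQw⟩ := hl w
    have h4 := hperp Q hQ
    have h5 := hperp Q2 hQ2
    rw [hQw] at h4
    rw [hQ2'] at h5
    rw [h4, h5, s1, s2, real_inner_self_eq_norm_sq] at h1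
    rw [h3, h3, s1, s2, real_inner_self_eq_norm_sq] at h2
    rw [dirichlet_sub_left hu hav hd.2, dirichlet_comm u, dirichlet_comm v,
      dirichlet_sub_left hu hav hu.2, dirichlet_sub_left hu hav hav.2, dirichlet_comm v u, h1, h2]
    ring
  refine ⟨c, w, B, hB, ?_, fun v => ?_, ?_, ?_, ?_⟩
  · have := hperp Q1 hQ1
    rw [hQ1', s0] at this
    simpa [sip] using this
  · obtain ⟨Q, hQ, hQv⟩ := hl v
    rw [← s1, ← hQv]
    exact hperp Q hQ
  · rw [← s2, ← hQ2']
    exact hperp Q2 hQ2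
  · have := sip_self_nonneg (fun x => u x - v x)
    rw [e1, sP] at this
    linarith
  · rw [e1, e3, sP] at hgap
    have : sip u u - c ^ 2 * sarea n - sarea n / n * ‖w‖ ^ 2 -
        sip (fun x => ⟪B x, x⟫) (fun x => ⟪B x, x⟫) = sip u u - (c ^ 2 * sarea n +
          sarea n / n * ‖w‖ ^ 2 + sip (fun x => ⟪B x, x⟫) (fun x => ⟪B x, x⟫)) := by ring
    rw [this]
    linarith

/-- A traceless symmetric endomorphism is controlled by the `L²` norm of its quadratic form. -/
lemma SymTr0.norm_sq_le (hn : 0 < n) {B : Euc n →L[ℝ] Euc n} (hB : SymTr0 B) (x : Euc n) :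
    ‖B x‖ ^ 2 * sarea n ≤
      n * (n + 2) / 2 * sip (fun x => ⟪B x, x⟫) (fun x => ⟪B x, x⟫) * ‖x‖ ^ 2 := by
  have h1 : ∀ θ : Sph n, ‖B (θ : Euc n)‖ ^ 2 = ⟪(B.comp B) (θ : Euc n), (θ : Euc n)⟫ := by
    intro θ
    rw [ContinuousLinearMap.comp_apply, hB.1, real_inner_self_eq_norm_sq]
  have h2 := integral_sph_quad hn (B.comp B)
  simp only [← h1] at h2
  rw [hB.integral_norm_sq hn, trace_clm_eq_sum] at h2
  have h3 : ∀ i : Fin n, ⟪eb i, (B.comp B) (eb i)⟫ = ‖B (eb i)‖ ^ 2 := fun i => by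
    rw [ContinuousLinearMap.comp_apply, ← hB.1, real_inner_self_eq_norm_sq]
  simp only [h3] at h2
  have h4 : ‖B x‖ ^ 2 ≤ (∑ i, ‖B (eb i)‖ ^ 2) * ‖x‖ ^ 2 := by
    rw [EuclideanSpace.norm_sq_eq, Finset.sum_mul]
    refine Finset.sum_le_sum fun i _ => ?_
    have : B x i = ⟪x, B (eb i)⟫ := by
      rw [← hB.1, EuclideanSpace.inner_single_right]; simp
    rw [this, Real.norm_eq_abs, ← mul_pow]
    refine pow_le_pow_left₀ (abs_nonneg _) ?_ 2
    rw [mul_comm]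
    exact abs_real_inner_le_norm x _
  have hs : 0 ≤ sarea n := measureReal_nonneg
  have hn' : (n : ℝ) ≠ 0 := by positivity
  have h5 : sip (fun x => ⟪B x, x⟫) (fun x => ⟪B x, x⟫) =
      ∫ θ : Sph n, ⟪B (θ : Euc n), (θ : Euc n)⟫ ^ 2 ∂(sphMeas n) := by
    simp only [sip, sq]
  rw [h5]
  calc ‖B x‖ ^ 2 * sarea n ≤ (∑ i, ‖B (eb i)‖ ^ 2) * ‖x‖ ^ 2 * sarea n :=
        mul_le_mul_of_nonneg_right h4 hs
    _ = n * ((∑ i, ‖B (eb i)‖ ^ 2) * sarea n / n) * ‖x‖ ^ 2 := by field_simp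
    _ = _ := by rw [← h2]; ring

end Modes

section Taylor

open Filter Asymptotics Topology

variable {α : Type*} {l : Filter α} {ρ : α → ℝ}

/-- `f` has the expansion `f₀ + f₁ + f₂ + O(ρ³)` with `fᵢ = O(ρⁱ)`. -/
structure Graded (l : Filter α) (ρ f : α → ℝ) (f₀ : ℝ) (f₁ f₂ : α → ℝ) : Prop where
  one : f₁ =O[l] ρ
  two : f₂ =O[l] fun x => ρ x ^ 2
  rem : (fun x => f x - f₀ - f₁ x - f₂ x) =O[l] fun x => ρ x ^ 3

lemma isBigO_one_of (hρ : Tendsto ρ l (𝓝 0)) {f : α → ℝ} {k : ℕ}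
    (hf : f =O[l] fun x => ρ x ^ k) : f =O[l] fun _ => (1 : ℝ) := by
  refine hf.trans ?_
  have := (hρ.pow k).isBigO_one ℝ
  exact this

lemma isBigO_pow_of_le (hρ : Tendsto ρ l (𝓝 0)) {f : α → ℝ} {j k : ℕ} (hjk : j ≤ k)
    (hf : f =O[l] fun x => ρ x ^ k) : f =O[l] fun x => ρ x ^ j := by
  obtain ⟨i, rfl⟩ := Nat.exists_eq_add_of_le hjk
  have h1 : (fun x => ρ x ^ (j + i)) =O[l] fun x => ρ x ^ j * 1 := by
    simp only [pow_add]
    exact (isBigO_refl _ _).mul (isBigO_one_of hρ (isBigO_refl (fun x => ρ x ^ i) l))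
  simpa using hf.trans h1

lemma isBigO_mul_pow {f g : α → ℝ} {j k : ℕ} (hf : f =O[l] fun x => ρ x ^ j)
    (hg : g =O[l] fun x => ρ x ^ k) : (fun x => f x * g x) =O[l] fun x => ρ x ^ (j + k) := by
  simpa only [pow_add] using hf.mul hg

lemma Graded.mul (hρ : Tendsto ρ l (𝓝 0)) {f g f₁ f₂ g₁ g₂ : α → ℝ} {f₀ g₀ : ℝ}
    (hf : Graded l ρ f f₀ f₁ f₂) (hg : Graded l ρ g g₀ g₁ g₂) :
    Graded l ρ (fun x => f x * g x) (f₀ * g₀) (fun x => f₀ * g₁ x + f₁ x * g₀)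
      (fun x => f₀ * g₂ x + f₁ x * g₁ x + f₂ x * g₀) := by
  have hf1 : f₁ =O[l] fun x => ρ x ^ 1 := by simpa using hf.one
  have hg1 : g₁ =O[l] fun x => ρ x ^ 1 := by simpa using hg.one
  have c0 : ∀ c : ℝ, (fun _ => c) =O[l] fun x => ρ x ^ 0 := fun c => by
    simpa using isBigO_const_const c (one_ne_zero (α := ℝ)) l
  refine ⟨?_, ?_, ?_⟩
  · exact (hg.one.const_mul_left f₀).add (by simpa [mul_comm] using hf.one.const_mul_left g₀)
  · exact ((hg.two.const_mul_left f₀).add (isBigO_mul_pow hf1 hg1)).add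
      (by simpa [mul_comm] using hf.two.const_mul_left g₀)
  · have hgO : g =O[l] fun x => ρ x ^ 0 := by
      have := (((isBigO_pow_of_le hρ (Nat.zero_le 3) hg.rem).add
        (isBigO_pow_of_le hρ (Nat.zero_le 2) hg.two)).add
        (isBigO_pow_of_le hρ (Nat.zero_le 1) hg1)).add (c0 g₀)
      refine this.congr_left fun x => ?_
      ring
    have t1 := isBigO_mul_pow hf.rem hgO
    have t2 := isBigO_mul_pow (c0 f₀) hg.rem
    have t3 := isBigO_pow_of_le hρ (show 3 ≤ 1 + 3 by norm_num) (isBigO_mul_pow hf1 hg.rem)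
    have t4 := isBigO_pow_of_le hρ (show 3 ≤ 2 + 3 by norm_num) (isBigO_mul_pow hf.two hg.rem)
    have t5 := isBigO_mul_pow hf1 hg.two
    have t6 := isBigO_mul_pow hf.two hg1
    have t7 := isBigO_pow_of_le hρ (show 3 ≤ 2 + 2 by norm_num) (isBigO_mul_pow hf.two hg.two)
    refine ((((((t1.add t2).add t3).add t4).add t5).add t6).add t7).congr_left fun x => ?_
    ring

/-- Second order expansion of `(1 + s)^{-1/2}`. -/
lemma inv_sqrt_expansion {s : ℝ} (hs : |s| ≤ 1 / 2) :
    |(√(1 + s))⁻¹ - (1 - s / 2 + 3 / 8 * s ^ 2)| ≤ 4 * |s| ^ 3 := by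
  obtain ⟨h1, h2⟩ := abs_le.1 hs
  have hpos : 0 < 1 + s := by linarith
  obtain ⟨y, hy⟩ : ∃ y, y = (√(1 + s))⁻¹ := ⟨_, rfl⟩
  have hy0 : 0 < y := by rw [hy]; positivity
  have hy2 : y ^ 2 * (1 + s) = 1 := by
    rw [hy, inv_pow, sq_sqrt hpos.le, inv_mul_cancel₀ hpos.ne']
  rw [← hy]
  obtain ⟨q, hq⟩ : ∃ q, q = 1 - s / 2 + 3 / 8 * s ^ 2 := ⟨_, rfl⟩
  rw [← hq]
  have hq0 : 1 / 2 ≤ q := by rw [hq]; nlinarith [sq_nonneg s]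
  have hq2 : (y - q) * ((y + q) * (1 + s)) = s ^ 3 * (- (5 / 8) + 15 / 64 * s - 9 / 64 * s ^ 2) := by
    have : (y - q) * ((y + q) * (1 + s)) = 1 - q ^ 2 * (1 + s) := by
      linear_combination hy2
    rw [this, hq]; ring
  have hD : 1 / 4 ≤ (y + q) * (1 + s) := by nlinarith
  have h3 : |y - q| * (1 / 4) ≤ |s| ^ 3 * 1 := by
    calc |y - q| * (1 / 4) ≤ |y - q| * ((y + q) * (1 + s)) := by gcongr
      _ = |(y - q) * ((y + q) * (1 + s))| := by
        rw [abs_mul, abs_of_pos (show 0 < (y + q) * (1 + s) by linarith)]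
      _ = |s| ^ 3 * |- (5 / 8) + 15 / 64 * s - 9 / 64 * s ^ 2| := by rw [hq2, abs_mul, abs_pow]
      _ ≤ |s| ^ 3 * 1 := by
        gcongr
        rw [abs_le]; constructor <;> nlinarith [sq_nonneg s]
  linarith

lemma Graded.inv_sqrt (hρ : Tendsto ρ l (𝓝 0)) {s₁ s₂ : α → ℝ} (h1 : s₁ =O[l] ρ)
    (h2 : s₂ =O[l] fun x => ρ x ^ 2) :
    Graded l ρ (fun x => (√(1 + (s₁ x + s₂ x)))⁻¹) 1 (fun x => - s₁ x / 2)
      (fun x => - s₂ x / 2 + 3 / 8 * s₁ x ^ 2) := by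
  have h1' : s₁ =O[l] fun x => ρ x ^ 1 := by simpa using h1
  have hs : (fun x => s₁ x + s₂ x) =O[l] ρ :=
    h1.add (by simpa using isBigO_pow_of_le hρ one_le_two h2)
  have hs0 : Tendsto (fun x => s₁ x + s₂ x) l (𝓝 0) := hs.trans_tendsto hρ
  refine ⟨?_, ?_, ?_⟩
  · simpa [div_eq_inv_mul] using h1.const_mul_left (-(1 / 2))
  · have := (h2.const_mul_left (-(1 / 2))).add ((isBigO_mul_pow h1' h1').const_mul_left (3 / 8))
    refine this.congr_left fun x => ?_
    ring
  · have e1 : (fun x => (√(1 + (s₁ x + s₂ x)))⁻¹ -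
        (1 - (s₁ x + s₂ x) / 2 + 3 / 8 * (s₁ x + s₂ x) ^ 2)) =O[l] fun x => ρ x ^ 3 := by
      refine IsBigO.trans ?_ (hs.pow 3)
      refine IsBigO.of_bound 4 ?_
      have : ∀ᶠ x in l, |s₁ x + s₂ x| ≤ 1 / 2 := by
        have := hs0.abs
        rw [abs_zero] at this
        exact this.eventually_le_const (by norm_num)
      filter_upwards [this] with x hx
      simpa using inv_sqrt_expansion hx
    have e2 := (isBigO_mul_pow h1' h2).const_mul_left (3 / 4)
    have e3 := (isBigO_pow_of_le hρ (show 3 ≤ 2 + 2 by norm_num)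
      (isBigO_mul_pow h2 h2)).const_mul_left (3 / 8)
    refine ((e1.add e2).add e3).congr_left fun x => ?_
    ring

lemma Graded.exp_mul (hρ : Tendsto ρ l (𝓝 0)) {u : α → ℝ} (hu : u =O[l] ρ) (c : ℝ) :
    Graded l ρ (fun x => Real.exp (c * u x)) 1 (fun x => c * u x)
      (fun x => c ^ 2 / 2 * u x ^ 2) := by
  have hu' : u =O[l] fun x => ρ x ^ 1 := by simpa using hu
  have hcu := hu.const_mul_left c
  refine ⟨hcu, ?_, ?_⟩
  · refine ((isBigO_mul_pow hu' hu').const_mul_left (c ^ 2 / 2)).congr_left fun x => ?_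
    ring
  · have h := (Real.exp_sub_sum_range_isBigO_pow 3).comp_tendsto (hcu.trans_tendsto hρ)
    refine (h.trans (hcu.pow 3)).congr_left fun x => ?_
    simp [Finset.sum_range_succ]
    ring

lemma Graded.of_eq {f f₁ f₂ f₃ : α → ℝ} {f₀ : ℝ} (h1 : f₁ =O[l] ρ)
    (h2 : f₂ =O[l] fun x => ρ x ^ 2) (h3 : f₃ =O[l] fun x => ρ x ^ 3)
    (h : ∀ x, f x = f₀ + f₁ x + f₂ x + f₃ x) : Graded l ρ f f₀ f₁ f₂ :=
  ⟨h1, h2, h3.congr_left fun x => by rw [h]; ring⟩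

variable {n : ℕ}

/-- The integrand of the lower bound for the total positive mean curvature, in terms of the
logarithm `u` of the radial function, its gradient `p`, the direction `θ`, and the matrix `B`. -/
def Jfun (n : ℕ) (u : ℝ) (θ p : Euc n) (B : Euc n →L[ℝ] Euc n) : ℝ :=
  Real.exp ((n - 2) * u) * (‖θ - p‖ * ‖θ + B θ‖⁻¹ *
    (n - ⟪(θ + B θ) + B (θ + B θ), θ + B θ⟫ / ‖θ + B θ‖ ^ 2
      - ⟪(θ - p) + B (θ - p), θ - p⟫ / ‖θ - p‖ ^ 2
      + ⟪θ + B θ, θ - p⟫ * ⟪(θ + B θ) + B (θ + B θ), θ - p⟫ / (‖θ + B θ‖ ^ 2 * ‖θ - p‖ ^ 2)))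

/-- The second order Taylor polynomial of `Jfun`. -/
def Qfun (n : ℕ) (u : ℝ) (θ p : Euc n) (B : Euc n →L[ℝ] Euc n) : ℝ :=
  (n - 1) - n * ⟪B θ, θ⟫ + (n - 3) / 2 * ‖p‖ ^ 2 - ⟪p, B θ⟫ - (n + 3) / 2 * ‖B θ‖ ^ 2
    + (3 * n + 3) / 2 * ⟪B θ, θ⟫ ^ 2 + (n - 1) * (n - 2) * u + (n - 1) * (n - 2) ^ 2 / 2 * u ^ 2
    - n * (n - 2) * (u * ⟪B θ, θ⟫)

/-- The numerator of `Jfun` after clearing denominators. -/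
def Nfun (n : ℕ) (θ p : Euc n) (B : Euc n →L[ℝ] Euc n) : ℝ :=
  n * (1 + (2 * ⟪B θ, θ⟫ + ‖B θ‖ ^ 2)) * (1 + ‖p‖ ^ 2)
    - (1 + 3 * ⟪B θ, θ⟫ + 3 * ‖B θ‖ ^ 2 + ⟪B (B θ), B θ⟫) * (1 + ‖p‖ ^ 2)
    - (1 + ‖p‖ ^ 2 + ⟪B θ, θ⟫ - 2 * ⟪p, B θ⟫ + ⟪B p, p⟫) * (1 + (2 * ⟪B θ, θ⟫ + ‖B θ‖ ^ 2))
    + (1 + ⟪B θ, θ⟫ - ⟪p, B θ⟫) * (1 + 2 * ⟪B θ, θ⟫ - 2 * ⟪p, B θ⟫ + ‖B θ‖ ^ 2 - ⟪B θ, B p⟫)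

lemma Jfun_eq {u : ℝ} {θ p : Euc n} {B : Euc n →L[ℝ] Euc n} (hθ : ‖θ‖ = 1) (hp : ⟪p, θ⟫ = 0)
    (hB : ∀ x y, ⟪B x, y⟫ = ⟪x, B y⟫) :
    Jfun n u θ p B = Real.exp ((n - 2) * u) * ((√(1 + (0 + ‖p‖ ^ 2)))⁻¹ *
      (((√(1 + (2 * ⟪B θ, θ⟫ + ‖B θ‖ ^ 2)))⁻¹ * ((√(1 + (2 * ⟪B θ, θ⟫ + ‖B θ‖ ^ 2)))⁻¹ *
        (√(1 + (2 * ⟪B θ, θ⟫ + ‖B θ‖ ^ 2)))⁻¹)) * Nfun n θ p B)) := by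
  have hθ2 : ⟪θ, θ⟫ = 1 := by rw [real_inner_self_eq_norm_sq, hθ]; norm_num
  have hpθ : ⟪θ, p⟫ = 0 := by rw [real_inner_comm]; exact hp
  have ha : ‖θ + B θ‖ ^ 2 = 1 + (2 * ⟪B θ, θ⟫ + ‖B θ‖ ^ 2) := by
    rw [← real_inner_self_eq_norm_sq, ← real_inner_self_eq_norm_sq, inner_add_left,
      inner_add_right, inner_add_right, hθ2, real_inner_comm (B θ) θ]
    ring
  have hm : ‖θ - p‖ ^ 2 = 1 + (0 + ‖p‖ ^ 2) := by
    rw [← real_inner_self_eq_norm_sq, ← real_inner_self_eq_norm_sq, inner_sub_left,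
      inner_sub_right, inner_sub_right, hθ2, hp, hpθ]
    ring
  have ha' : ‖θ + B θ‖ = √(1 + (2 * ⟪B θ, θ⟫ + ‖B θ‖ ^ 2)) := by
    rw [← ha, Real.sqrt_sq (norm_nonneg _)]
  have hm' : ‖θ - p‖ = √(1 + (0 + ‖p‖ ^ 2)) := by
    rw [← hm, Real.sqrt_sq (norm_nonneg _)]
  have s1 : ⟪θ, B θ⟫ = ⟪B θ, θ⟫ := real_inner_comm _ _
  have s2 : ⟪B (B θ), θ⟫ = ‖B θ‖ ^ 2 := by rw [hB, real_inner_self_eq_norm_sq]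
  have s3 : ⟪B p, θ⟫ = ⟪p, B θ⟫ := hB _ _
  have s4 : ⟪B θ, p⟫ = ⟪p, B θ⟫ := real_inner_comm _ _
  have s5 : ⟪θ, B p⟫ = ⟪p, B θ⟫ := by rw [← hB, real_inner_comm]
  have s6 : ⟪B (B θ), p⟫ = ⟪B θ, B p⟫ := hB _ _
  have e1 : ⟪(θ + B θ) + B (θ + B θ), θ + B θ⟫ =
      1 + 3 * ⟪B θ, θ⟫ + 3 * ‖B θ‖ ^ 2 + ⟪B (B θ), B θ⟫ := by
    simp only [map_add, inner_add_left, inner_add_right, s1, s2, hθ2, real_inner_self_eq_norm_sq]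
    ring
  have e2 : ⟪(θ - p) + B (θ - p), θ - p⟫ =
      1 + ‖p‖ ^ 2 + ⟪B θ, θ⟫ - 2 * ⟪p, B θ⟫ + ⟪B p, p⟫ := by
    simp only [map_sub, inner_add_left, inner_sub_left, inner_sub_right, s3, s4, hθ2, hp, hpθ,
      real_inner_self_eq_norm_sq]
    ring
  have e3 : ⟪θ + B θ, θ - p⟫ = 1 + ⟪B θ, θ⟫ - ⟪p, B θ⟫ := by
    simp only [inner_add_left, inner_sub_right, s4, hθ2, hpθ]
    ring
  have e4 : ⟪(θ + B θ) + B (θ + B θ), θ - p⟫ =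
      1 + 2 * ⟪B θ, θ⟫ - 2 * ⟪p, B θ⟫ + ‖B θ‖ ^ 2 - ⟪B θ, B p⟫ := by
    simp only [map_add, inner_add_left, inner_sub_right, s2, s4, s6, hθ2, hpθ]
    ring
  rw [Jfun, e1, e2, e3, e4, Nfun, ha, hm, ha', hm']
  obtain ⟨P, hP, hP2⟩ : ∃ P : ℝ, √(1 + (0 + ‖p‖ ^ 2)) = P ∧ P ^ 2 = 1 + (0 + ‖p‖ ^ 2) :=
    ⟨_, rfl, Real.sq_sqrt (by positivity)⟩
  obtain ⟨S, hS, hS2⟩ : ∃ S : ℝ, √(1 + (2 * ⟪B θ, θ⟫ + ‖B θ‖ ^ 2)) = S ∧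
      S ^ 2 = 1 + (2 * ⟪B θ, θ⟫ + ‖B θ‖ ^ 2) := ⟨_, rfl, Real.sq_sqrt (by rw [← ha]; positivity)⟩
  have hP0 : P ≠ 0 := by
    rintro rfl
    have := sq_nonneg ‖p‖
    norm_num at hP2
    linarith
  have hP3 : (1 + ‖p‖ ^ 2) = P ^ 2 := by rw [hP2]; ring
  rw [hP, hS, ← hP2, ← hS2, hP3]
  by_cases h0 : S = 0
  · simp [h0]
  · field_simp

lemma Jfun_taylor (hρ : Tendsto ρ l (𝓝 0)) {u : α → ℝ} {θ p : α → Euc n}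
    {B : α → Euc n →L[ℝ] Euc n} (hθ : ∀ x, ‖θ x‖ = 1) (hp : ∀ x, ⟪p x, θ x⟫ = 0)
    (hB : ∀ x y z, ⟪B x y, z⟫ = ⟪y, B x z⟫) (hu : u =O[l] ρ) (hpO : p =O[l] ρ)
    (hBO : B =O[l] ρ) :
    (fun x => Jfun n (u x) (θ x) (p x) (B x) - Qfun n (u x) (θ x) (p x) (B x)) =O[l]
      fun x => ρ x ^ 3 := by
  have hBn : (fun x => ‖B x‖) =O[l] fun x => ρ x ^ 1 := by simpa using hBO.norm_left
  have hpn : (fun x => ‖p x‖) =O[l] fun x => ρ x ^ 1 := by simpa using hpO.norm_left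
  have hu' : u =O[l] fun x => ρ x ^ 1 := by simpa using hu
  have nB : ∀ x y, ‖B x y‖ ≤ ‖B x‖ * ‖y‖ := fun x y => (B x).le_opNorm y
  have hBθ : ∀ x, ‖B x (θ x)‖ ≤ ‖B x‖ := fun x => by simpa [hθ] using nB x (θ x)
  have ob : (fun x => ⟪B x (θ x), θ x⟫) =O[l] fun x => ρ x ^ 1 := by
    refine (IsBigO.of_bound 1 (Eventually.of_forall fun x => ?_)).trans hBn
    rw [one_mul, Real.norm_of_nonneg (norm_nonneg (B x))]
    refine (abs_real_inner_le_norm _ _).trans ?_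
    rw [hθ, mul_one]; exact hBθ x
  have oBθ : (fun x => ‖B x (θ x)‖) =O[l] fun x => ρ x ^ 1 := by
    refine (IsBigO.of_bound 1 (Eventually.of_forall fun x => ?_)).trans hBn
    simpa using hBθ x
  have oβ : (fun x => ‖B x (θ x)‖ ^ 2) =O[l] fun x => ρ x ^ 2 := by
    simpa [sq] using isBigO_mul_pow oBθ oBθ
  have oπ : (fun x => ‖p x‖ ^ 2) =O[l] fun x => ρ x ^ 2 := by
    simpa [sq] using isBigO_mul_pow hpn hpn
  have ok : (fun x => ⟪p x, B x (θ x)⟫) =O[l] fun x => ρ x ^ 2 := by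
    refine (IsBigO.of_bound 1 (Eventually.of_forall fun x => ?_)).trans (isBigO_mul_pow hpn oBθ)
    simpa using abs_real_inner_le_norm (p x) (B x (θ x))
  have og : (fun x => ⟪B x (B x (θ x)), B x (θ x)⟫) =O[l] fun x => ρ x ^ 3 := by
    refine (IsBigO.of_bound 1 (Eventually.of_forall fun x => ?_)).trans
      (isBigO_mul_pow (isBigO_mul_pow hBn oBθ) oBθ)
    rw [one_mul, norm_mul, norm_mul, norm_norm, norm_norm, Real.norm_eq_abs]
    exact (abs_real_inner_le_norm _ _).trans (by gcongr; exact nB _ _)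
  have oh : (fun x => ⟪B x (p x), p x⟫) =O[l] fun x => ρ x ^ 3 := by
    refine (IsBigO.of_bound 1 (Eventually.of_forall fun x => ?_)).trans
      (isBigO_mul_pow (isBigO_mul_pow hBn hpn) hpn)
    rw [one_mul, norm_mul, norm_mul, norm_norm, norm_norm, Real.norm_eq_abs]
    exact (abs_real_inner_le_norm _ _).trans (by gcongr; exact nB _ _)
  have ol : (fun x => ⟪B x (θ x), B x (p x)⟫) =O[l] fun x => ρ x ^ 3 := by
    refine (IsBigO.of_bound 1 (Eventually.of_forall fun x => ?_)).trans
      (isBigO_mul_pow (isBigO_mul_pow hBn hBn) hpn)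
    rw [one_mul, norm_mul, norm_mul, norm_norm, norm_norm, Real.norm_eq_abs]
    refine (abs_real_inner_le_norm _ _).trans ?_
    rw [mul_assoc]
    gcongr
    · exact hBθ x
    · exact nB _ _
  have ob1 : (fun x => ⟪B x (θ x), θ x⟫) =O[l] ρ := by simpa using ob
  have oz : (fun _ : α => (0 : ℝ)) =O[l] ρ := isBigO_zero _ _
  have oz2 : (fun _ : α => (0 : ℝ)) =O[l] fun x => ρ x ^ 2 := isBigO_zero _ _
  have gE := Graded.exp_mul hρ hu ((n : ℝ) - 2)
  have gP := Graded.inv_sqrt hρ oz oπ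
  have gS := Graded.inv_sqrt hρ (ob1.const_mul_left 2) oβ
  have gs : Graded l ρ (fun x => 1 + (2 * ⟪B x (θ x), θ x⟫ + ‖B x (θ x)‖ ^ 2)) 1
      (fun x => 2 * ⟪B x (θ x), θ x⟫) (fun x => ‖B x (θ x)‖ ^ 2) :=
    Graded.of_eq (ob1.const_mul_left 2) oβ (isBigO_zero _ _) fun x => by ring
  have gπ : Graded l ρ (fun x => 1 + ‖p x‖ ^ 2) 1 (fun _ => 0) (fun x => ‖p x‖ ^ 2) :=
    Graded.of_eq oz oπ (isBigO_zero _ _) fun x => by ring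
  have g1 : Graded l ρ (fun x => 1 + 3 * ⟪B x (θ x), θ x⟫ + 3 * ‖B x (θ x)‖ ^ 2 +
      ⟪B x (B x (θ x)), B x (θ x)⟫) 1 (fun x => 3 * ⟪B x (θ x), θ x⟫)
      (fun x => 3 * ‖B x (θ x)‖ ^ 2) :=
    Graded.of_eq (ob1.const_mul_left 3) (oβ.const_mul_left 3) og fun x => by ring
  have g2 : Graded l ρ (fun x => 1 + ‖p x‖ ^ 2 + ⟪B x (θ x), θ x⟫ - 2 * ⟪p x, B x (θ x)⟫ +
      ⟪B x (p x), p x⟫) 1 (fun x => ⟪B x (θ x), θ x⟫)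
      (fun x => ‖p x‖ ^ 2 - 2 * ⟪p x, B x (θ x)⟫) :=
    Graded.of_eq ob1 (oπ.sub (ok.const_mul_left 2)) oh fun x => by ring
  have g3 : Graded l ρ (fun x => 1 + ⟪B x (θ x), θ x⟫ - ⟪p x, B x (θ x)⟫) 1
      (fun x => ⟪B x (θ x), θ x⟫) (fun x => - ⟪p x, B x (θ x)⟫) :=
    Graded.of_eq ob1 ok.neg_left (isBigO_zero _ _) fun x => by ring
  have g4 : Graded l ρ (fun x => 1 + 2 * ⟪B x (θ x), θ x⟫ - 2 * ⟪p x, B x (θ x)⟫ +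
      ‖B x (θ x)‖ ^ 2 - ⟪B x (θ x), B x (p x)⟫) 1 (fun x => 2 * ⟪B x (θ x), θ x⟫)
      (fun x => ‖B x (θ x)‖ ^ 2 - 2 * ⟪p x, B x (θ x)⟫) :=
    Graded.of_eq (ob1.const_mul_left 2) (oβ.sub (ok.const_mul_left 2)) ol.neg_left
      fun x => by ring
  have k1 := gs.mul hρ gπ
  have k2 := g1.mul hρ gπ
  have k3 := g2.mul hρ gs
  have k4 := g3.mul hρ g4
  have gN : Graded l ρ (fun x => Nfun n (θ x) (p x) (B x)) (n - 1)
      (fun x => (2 * n - 3) * ⟪B x (θ x), θ x⟫)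
      (fun x => (n - 3) * ‖B x (θ x)‖ ^ 2 + (n - 2) * ‖p x‖ ^ 2 - ⟪p x, B x (θ x)⟫) := by
    refine ⟨ob1.const_mul_left _, ((oβ.const_mul_left _).add (oπ.const_mul_left _)).sub ok, ?_⟩
    refine ((((k1.rem.const_mul_left n).sub k2.rem).sub k3.rem).add k4.rem).congr_left fun x => ?_
    rw [Nfun]
    ring
  have key := (gE.mul hρ (gP.mul hρ ((gS.mul hρ (gS.mul hρ gS)).mul hρ gN))).rem
  refine key.congr_left fun x => ?_
  rw [Jfun_eq (hθ x) (hp x) (hB x), Qfun]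
  ring

end Taylor

section CoreExpansion

open Filter Asymptotics Topology

variable {n : ℕ}

lemma exists_Jfun_bound (n : ℕ) : ∃ C r₀ : ℝ, 0 < C ∧ 0 < r₀ ∧
    ∀ (u : ℝ) (θ p : Euc n) (B : Euc n →L[ℝ] Euc n), ‖θ‖ = 1 → ⟪p, θ⟫ = 0 →
      (∀ x y, ⟪B x, y⟫ = ⟪x, B y⟫) → |u| + ‖p‖ + ‖B‖ < r₀ →
      |Jfun n u θ p B - Qfun n u θ p B| ≤ C * (|u| + ‖p‖ + ‖B‖) ^ 3 := by
  let α := {x : ℝ × Euc n × Euc n × (Euc n →L[ℝ] Euc n) //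
    ‖x.2.1‖ = 1 ∧ ⟪x.2.2.1, x.2.1⟫ = 0 ∧ ∀ y z, ⟪x.2.2.2 y, z⟫ = ⟪y, x.2.2.2 z⟫}
  let ρ : α → ℝ := fun x => |x.1.1| + ‖x.1.2.2.1‖ + ‖x.1.2.2.2‖
  have hρ0 : ∀ x, 0 ≤ ρ x := fun x => by positivity
  have hρ : Tendsto ρ (comap ρ (𝓝 0)) (𝓝 0) := tendsto_comap
  have key := Jfun_taylor (n := n) hρ (u := fun x => x.1.1) (θ := fun x => x.1.2.1)
    (p := fun x => x.1.2.2.1) (B := fun x => x.1.2.2.2) (fun x => x.2.1) (fun x => x.2.2.1)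
    (fun x => x.2.2.2)
    (IsBigO.of_bound 1 (Eventually.of_forall fun x => by
      rw [one_mul, Real.norm_of_nonneg (hρ0 x), Real.norm_eq_abs]
      have := norm_nonneg x.1.2.2.1
      have := norm_nonneg x.1.2.2.2
      simp only [ρ]; linarith))
    (IsBigO.of_bound 1 (Eventually.of_forall fun x => by
      rw [one_mul, Real.norm_of_nonneg (hρ0 x)]
      have := abs_nonneg x.1.1
      have := norm_nonneg x.1.2.2.2
      simp only [ρ]; linarith))
    (IsBigO.of_bound 1 (Eventually.of_forall fun x => by
      rw [one_mul, Real.norm_of_nonneg (hρ0 x)]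
      have := abs_nonneg x.1.1
      have := norm_nonneg x.1.2.2.1
      simp only [ρ]; linarith))
  obtain ⟨C, hC, hb⟩ := key.exists_pos
  have hb := hb.bound
  rw [eventually_comap] at hb
  obtain ⟨r, hr, hball⟩ := Metric.eventually_nhds_iff.1 hb
  refine ⟨C, r, hC, hr, fun u θ p B hθ hp hB h => ?_⟩
  let x : α := ⟨(u, θ, p, B), hθ, hp, hB⟩
  have hx : ρ x = |u| + ‖p‖ + ‖B‖ := rfl
  have := hball (y := ρ x) (by rw [dist_zero_right, Real.norm_of_nonneg (hρ0 x), hx]; exact h) x rfl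
  rwa [Real.norm_eq_abs, Real.norm_of_nonneg (by have := hρ0 x; positivity), hx] at this

lemma Adm.norm_fderiv_le {u : Euc n → ℝ} (hu : Adm u) {ε : ℝ}
    (hε : ∀ θ : Sph n, ‖gradient u (θ : Euc n)‖ ≤ ε) {x : Euc n} (hx : x ≠ 0) :
    ‖fderiv ℝ u x‖ ≤ ‖x‖⁻¹ * ε := by
  have hx' : 0 < ‖x‖ := norm_pos_iff.2 hx
  have hmem : ‖x‖⁻¹ • x ∈ sphere (0 : Euc n) 1 := by
    simp [norm_smul, hx'.ne']
  have h1 := hε ⟨_, hmem⟩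
  have hε0 : 0 ≤ ε := (norm_nonneg _).trans h1
  refine ContinuousLinearMap.opNorm_le_bound _ (by positivity) fun v => ?_
  have h2 := hu.1.fderiv_apply (fun y hy => hu.differentiableAt hy) v ‖x‖ hx' (‖x‖⁻¹ • x)
    (by simp [hx, hx'.ne'])
  rw [smul_smul, mul_inv_cancel₀ hx'.ne', one_smul] at h2
  simp only at h2
  rw [← inner_gradient_left (x := ‖x‖⁻¹ • x)] at h2
  rw [h2, zero_sub, zpow_neg_one, norm_mul, norm_inv, norm_norm, mul_assoc]
  gcongr
  exact (norm_inner_le_norm _ _).trans (by gcongr)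

lemma Adm.abs_sub_le_of_orthogonal {u : Euc n → ℝ} (hu : Adm u) {ε : ℝ}
    (hε : ∀ θ : Sph n, ‖gradient u (θ : Euc n)‖ ≤ ε) {x y : Euc n} (hx : ‖x‖ = 1) (hy : ‖y‖ = 1)
    (hxy : ⟪x, y⟫ = 0) : |u x - u y| ≤ 4 * ε := by
  have hε0 : 0 ≤ ε := (norm_nonneg _).trans (hε ⟨x, by simpa using hx⟩)
  have hseg : ∀ z ∈ segment ℝ y x, 1 / 2 ≤ ‖z‖ := by
    rintro z ⟨a, b, ha, hb, hab, rfl⟩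
    have : ‖a • y + b • x‖ ^ 2 = a ^ 2 + b ^ 2 := by
      rw [norm_add_sq_real, norm_smul, norm_smul, inner_smul_left, inner_smul_right,
        real_inner_comm, hxy, hx, hy]
      simp [sq_abs]
    nlinarith [sq_nonneg (a - b), norm_nonneg (a • y + b • x)]
  have h := (convex_segment (𝕜 := ℝ) y x).norm_image_sub_le_of_norm_fderiv_le (𝕜 := ℝ) (f := u)
    (C := 2 * ε)
    (fun z hz => hu.differentiableAt (norm_pos_iff.1 (by have := hseg z hz; linarith)))
    (fun z hz => (hu.norm_fderiv_le hε
      (norm_pos_iff.1 (by have := hseg z hz; linarith))).trans (by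
        gcongr
        rw [inv_le_comm₀ (by have := hseg z hz; linarith) (by norm_num)]
        linarith [hseg z hz])) (left_mem_segment ℝ y x) (right_mem_segment ℝ y x)
  refine h.trans ?_
  have : ‖x - y‖ ≤ 2 := (norm_sub_le _ _).trans (by rw [hx, hy]; norm_num)
  nlinarith

lemma exists_orthogonal_unit (hn : 3 ≤ n) (x y : Euc n) :
    ∃ z : Euc n, ‖z‖ = 1 ∧ ⟪x, z⟫ = 0 ∧ ⟪y, z⟫ = 0 := by
  have hlt : Module.finrank ℝ (Submodule.span ℝ ({x, y} : Set (Euc n))) < Module.finrank ℝ (Euc n) := by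
    refine (finrank_span_le_card _).trans_lt ?_
    rw [finrank_euclideanSpace_fin]
    refine lt_of_le_of_lt ?_ (show 2 < n by omega)
    rw [Set.toFinset_insert, Set.toFinset_singleton]
    exact Finset.card_le_two
  obtain ⟨z, hz, hz0⟩ := (Submodule.ne_bot_iff _).1 (fun h =>
    hlt.ne (by rw [Submodule.orthogonal_eq_bot_iff.1 h, finrank_top]) :
      (Submodule.span ℝ ({x, y} : Set (Euc n)))ᗮ ≠ ⊥)
  rw [Submodule.mem_orthogonal] at hz
  refine ⟨‖z‖⁻¹ • z, by simp [norm_smul, hz0], ?_, ?_⟩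
  · rw [inner_smul_right, hz x (Submodule.subset_span (by simp)), mul_zero]
  · rw [inner_smul_right, hz y (Submodule.subset_span (by simp)), mul_zero]

lemma Adm.abs_sub_le (hn : 3 ≤ n) {u : Euc n → ℝ} (hu : Adm u) {ε : ℝ}
    (hε : ∀ θ : Sph n, ‖gradient u (θ : Euc n)‖ ≤ ε) (θ θ' : Sph n) :
    |u θ - u θ'| ≤ 8 * ε := by
  obtain ⟨z, hz, h1, h2⟩ := exists_orthogonal_unit hn (θ : Euc n) (θ' : Euc n)
  have a1 := hu.abs_sub_le_of_orthogonal hε (sph_norm θ) hz h1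
  have a2 := hu.abs_sub_le_of_orthogonal hε (sph_norm θ') hz h2
  rw [abs_sub_comm] at a2
  calc |u θ - u θ'| ≤ |u θ - u z| + |u z - u θ'| := _root_.abs_sub_le _ _ _
    _ ≤ _ := by linarith

lemma sarea_pos (hn : 0 < n) : 0 < sarea n := by
  have : Nonempty (Fin n) := ⟨⟨0, hn⟩⟩
  have : Nontrivial (Euc n) := inferInstance
  rw [sarea, Measure.toSphere_real_apply_univ]
  have h1 : 0 < Module.finrank ℝ (Euc n) := by rw [finrank_euclideanSpace_fin]; exact hn
  have h2 : 0 < (volume : Measure (Euc n)).real (ball 0 1) :=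
    ENNReal.toReal_pos (measure_ball_pos _ _ one_pos).ne' measure_ball_lt_top.ne
  positivity

lemma Adm.abs_le_of_integral_eq_zero (hn : 3 ≤ n) {u : Euc n → ℝ} (hu : Adm u) {ε : ℝ}
    (hε : ∀ θ : Sph n, ‖gradient u (θ : Euc n)‖ ≤ ε) (h0 : ∫ θ : Sph n, u θ ∂(sphMeas n) = 0)
    (θ : Sph n) : |u θ| ≤ 8 * ε := by
  have hs := sarea_pos (n := n) (by omega)
  have h1 : u θ * sarea n = ∫ θ' : Sph n, (u θ - u θ') ∂(sphMeas n) := by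
    rw [integral_sub (integrable_const _) (sph_integrable hu.continuous_sph), h0, integral_const,
      smul_eq_mul, sarea]
    ring
  have h2 : |u θ * sarea n| ≤ 8 * ε * sarea n := by
    rw [h1]
    have := norm_integral_le_of_norm_le_const (μ := sphMeas n) (C := 8 * ε)
      (f := fun θ' : Sph n => u θ - u θ') (Eventually.of_forall fun θ' => hu.abs_sub_le hn hε θ θ')
    simpa [sarea] using this
  rw [abs_mul, abs_of_pos hs] at h2
  exact le_of_mul_le_mul_right h2 hs

end CoreExpansion

section CoreIntegral

open Filter Topology

variable {n : ℕ}

/-- A continuous function on the sphere together with the value of its integral. -/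
def SphInt (f : Sph n → ℝ) (I : ℝ) : Prop := Continuous f ∧ ∫ θ, f θ ∂(sphMeas n) = I

lemma SphInt.add {f g : Sph n → ℝ} {I J : ℝ} (hf : SphInt f I) (hg : SphInt g J) :
    SphInt (fun θ => f θ + g θ) (I + J) :=
  ⟨hf.1.add hg.1, by rw [integral_add (sph_integrable hf.1) (sph_integrable hg.1), hf.2, hg.2]⟩

lemma SphInt.const_mul {f : Sph n → ℝ} {I : ℝ} (c : ℝ) (hf : SphInt f I) :
    SphInt (fun θ => c * f θ) (c * I) :=
  ⟨hf.1.const_mul c, by rw [integral_const_mul, hf.2]⟩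

lemma sphInt_const (c : ℝ) : SphInt (fun _ : Sph n => c) (c * sarea n) :=
  ⟨continuous_const, by rw [integral_const, smul_eq_mul, sarea, mul_comm]⟩

lemma integral_Qfun (hn : 0 < n) {u : Euc n → ℝ} (hu : Adm u) {B : Euc n →L[ℝ] Euc n}
    (hB : SymTr0 B) (h0 : ∫ θ : Sph n, u θ ∂(sphMeas n) = 0) :
    SphInt (fun θ : Sph n => Qfun n (u θ) θ (gradient u (θ : Euc n)) B)
      ((n - 1) * sarea n + (n - 3) / 2 * dirichlet u u
        + (n - 1) * (n - 2) ^ 2 / 2 * sip u u - n * (n - 1) * sip u (fun x => ⟪B x, x⟫)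
        - (n ^ 2 - n) / 4 * sip (fun x => ⟪B x, x⟫) (fun x => ⟪B x, x⟫)) := by
  have cB : Continuous fun θ : Sph n => B (θ : Euc n) := B.continuous.comp continuous_subtype_val
  have cb : Continuous fun θ : Sph n => ⟪B (θ : Euc n), (θ : Euc n)⟫ :=
    cB.inner continuous_subtype_val
  have cu := hu.continuous_sph
  have cg := hu.continuous_grad
  have i1 : SphInt (fun θ : Sph n => ⟪B (θ : Euc n), (θ : Euc n)⟫) 0 := ⟨cb, hB.integral_quad hn⟩
  have i2 : SphInt (fun θ : Sph n => ‖gradient u (θ : Euc n)‖ ^ 2) (dirichlet u u) :=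
    ⟨cg.norm.pow 2, by simp only [dirichlet, real_inner_self_eq_norm_sq]⟩
  have i3 : SphInt (fun θ : Sph n => ⟪gradient u (θ : Euc n), B (θ : Euc n)⟫)
      (n * sip u (fun x => ⟪B x, x⟫)) := ⟨cg.inner cB, hB.integral_grad_quad hn hu⟩
  have i4 : SphInt (fun θ : Sph n => ‖B (θ : Euc n)‖ ^ 2)
      ((n + 2) / 2 * sip (fun x => ⟪B x, x⟫) (fun x => ⟪B x, x⟫)) :=
    ⟨cB.norm.pow 2, by rw [hB.integral_norm_sq hn]; simp only [sip, sq]⟩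
  have i5 : SphInt (fun θ : Sph n => ⟪B (θ : Euc n), (θ : Euc n)⟫ ^ 2)
      (sip (fun x => ⟪B x, x⟫) (fun x => ⟪B x, x⟫)) := ⟨cb.pow 2, by simp only [sip, sq]⟩
  have i6 : SphInt (fun θ : Sph n => u (θ : Euc n)) 0 := ⟨cu, h0⟩
  have i7 : SphInt (fun θ : Sph n => u (θ : Euc n) ^ 2) (sip u u) :=
    ⟨cu.pow 2, by simp only [sip, sq]⟩
  have i8 : SphInt (fun θ : Sph n => u (θ : Euc n) * ⟪B (θ : Euc n), (θ : Euc n)⟫)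
      (sip u (fun x => ⟪B x, x⟫)) := ⟨cu.mul cb, rfl⟩
  have key := ((((((((sphInt_const (n := n) ((n : ℝ) - 1)).add (i1.const_mul (-n))).add
    (i2.const_mul ((n - 3) / 2))).add (i3.const_mul (-1))).add
    (i4.const_mul (-((n + 3) / 2)))).add (i5.const_mul ((3 * n + 3) / 2))).add
    (i6.const_mul ((n - 1) * (n - 2)))).add (i7.const_mul ((n - 1) * (n - 2) ^ 2 / 2))).add
    (i8.const_mul (-(n * (n - 2))))
  convert key using 1
  · ext θ; rw [Qfun]; ring
  · ring

lemma exp_sub_abs_le {x : ℝ} (hx : |x| ≤ 1) : |Real.exp x - 1 - x| ≤ x ^ 2 :=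
  Real.abs_exp_sub_one_sub_id_le hx

lemma exp_le_cubic {x : ℝ} (hx : |x| ≤ 1) : Real.exp x ≤ 1 + x + x ^ 2 / 2 + |x| * x ^ 2 := by
  have h := Real.exp_bound hx (n := 3) (by norm_num)
  simp only [Finset.sum_range_succ, Finset.sum_range_zero, Nat.factorial] at h
  norm_num at h
  have h2 := (abs_le.1 h).2
  have h3 : |x| ^ 3 = |x| * x ^ 2 := by rw [← sq_abs]; ring
  rw [h3] at h2
  have h4 : 0 ≤ |x| * x ^ 2 := by positivity
  nlinarith

/-- The first spherical mode is controlled by the barycenter condition. -/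
lemma first_mode_le (hn : 3 ≤ n) {u : Euc n → ℝ} (hu : Adm u) {M : ℝ}
    (hM : ∀ θ : Sph n, |u θ| ≤ M) (hM1 : (n + 1) * M ≤ 1)
    (hbar : ∀ v : Euc n, ∫ θ : Sph n, Real.exp ((n + 1) * u θ) * ⟪v, (θ : Euc n)⟫ ∂(sphMeas n) = 0)
    {w : Euc n} (hw : ∀ v : Euc n, sip u (fun x => ⟪v, x⟫) = sarea n / n * ⟪w, v⟫) :
    sarea n / n * ‖w‖ ^ 2 ≤ n * (n + 1) ^ 2 * M ^ 2 * sip u u := by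
  have hs := sarea_pos (n := n) (by omega)
  have hn0 : (0 : ℝ) < n := by exact_mod_cast (show 0 < n by omega)
  have cu := hu.continuous_sph
  have cw : Continuous fun θ : Sph n => ⟪w, (θ : Euc n)⟫ :=
    continuous_const.inner continuous_subtype_val
  have ce : Continuous fun θ : Sph n => Real.exp ((n + 1) * u θ) :=
    Real.continuous_exp.comp (continuous_const.mul cu)
  have hW := hw w
  rw [real_inner_self_eq_norm_sq] at hW
  have e1 : (n + 1) * sip u (fun x => ⟪w, x⟫) =
      ∫ θ : Sph n, (-(Real.exp ((n + 1) * u θ) - 1 - (n + 1) * u θ)) * ⟪w, (θ : Euc n)⟫ ∂(sphMeas n) := by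
    have j1 : SphInt (fun θ : Sph n => ⟪w, (θ : Euc n)⟫) 0 := ⟨cw, integral_sph_linear (by omega) w⟩
    have j2 : SphInt (fun θ : Sph n => u θ * ⟪w, (θ : Euc n)⟫) (sip u (fun x => ⟪w, x⟫)) :=
      ⟨cu.mul cw, rfl⟩
    have j3 : SphInt (fun θ : Sph n => Real.exp ((n + 1) * u θ) * ⟪w, (θ : Euc n)⟫) 0 :=
      ⟨ce.mul cw, hbar w⟩
    have key := ((j1.add (j2.const_mul ((n : ℝ) + 1))).add (j3.const_mul (-1))).2
    calc _ = 0 + (n + 1) * sip u (fun x => ⟪w, x⟫) + -1 * 0 := by ring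
      _ = _ := by
        rw [← key]
        refine integral_congr_ae (Eventually.of_forall fun θ => ?_)
        simp only
        ring
  have hU : sip u u ≤ M ^ 2 * sarea n := by
    have := (SphInt.const_mul (n := n) (M ^ 2) (sphInt_const 1))
    simp only [mul_one, one_mul] at this
    rw [← this.2, sip]
    refine integral_mono (sph_integrable (cu.mul cu)) (sph_integrable this.1) fun θ => ?_
    show u θ * u θ ≤ M ^ 2
    rw [← sq, ← sq_abs]
    exact pow_le_pow_left₀ (abs_nonneg _) (hM θ) 2
  have hU0 := sip_self_nonneg u
  have e2 : (n + 1) * sip u (fun x => ⟪w, x⟫) ≤ (n + 1) ^ 2 * ‖w‖ * sip u u := by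
    rw [e1, sip, ← integral_const_mul]
    refine integral_mono (sph_integrable
      (((ce.sub continuous_const).sub (continuous_const.mul cu)).neg.mul cw))
      ((sph_integrable (cu.mul cu)).const_mul _) fun θ => ?_
    show (-(Real.exp ((n + 1) * u θ) - 1 - (n + 1) * u θ)) * ⟪w, (θ : Euc n)⟫ ≤
      (n + 1) ^ 2 * ‖w‖ * (u θ * u θ)
    have hx : |(n + 1) * u θ| ≤ 1 := by
      rw [abs_mul, abs_of_pos (show (0 : ℝ) < n + 1 by positivity)]
      exact (mul_le_mul_of_nonneg_left (hM θ) (by positivity)).trans hM1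
    calc _ ≤ |(-(Real.exp ((n + 1) * u θ) - 1 - (n + 1) * u θ)) * ⟪w, (θ : Euc n)⟫| := le_abs_self _
      _ = |Real.exp ((n + 1) * u θ) - 1 - (n + 1) * u θ| * |⟪w, (θ : Euc n)⟫| := by
        rw [abs_mul, abs_neg]
      _ ≤ ((n + 1) * u θ) ^ 2 * (‖w‖ * 1) := by
        gcongr
        · exact exp_sub_abs_le hx
        · exact (abs_real_inner_le_norm _ _).trans (by rw [sph_norm])
      _ = _ := by ring
  rw [hW] at e2
  obtain ⟨a, ha⟩ : ∃ a, a = sarea n / n := ⟨_, rfl⟩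
  have ha0 : 0 < a := by rw [ha]; positivity
  have hsa : sarea n = n * a := by rw [ha]; field_simp
  rw [← ha] at e2 ⊢
  rw [hsa] at hU
  have e3 : a * ‖w‖ ^ 2 ≤ (n + 1) * ‖w‖ * sip u u := by nlinarith
  have e4 : ‖w‖ ≤ (n + 1) * (n * M ^ 2) := by
    rcases (norm_nonneg w).eq_or_lt with h | h
    · rw [← h]; positivity
    · have : a * ‖w‖ ≤ (n + 1) * sip u u := by nlinarith
      have : a * ‖w‖ ≤ a * ((n + 1) * (n * M ^ 2)) := by nlinarith
      exact le_of_mul_le_mul_left this ha0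
  calc a * ‖w‖ ^ 2 ≤ (n + 1) * ‖w‖ * sip u u := e3
    _ ≤ (n + 1) * ((n + 1) * (n * M ^ 2)) * sip u u := by gcongr
    _ = _ := by ring

lemma integral_exp_le (hn : 3 ≤ n) {u : Euc n → ℝ} (hu : Adm u) {M : ℝ}
    (hM : ∀ θ : Sph n, |u θ| ≤ M) (hM1 : n * M ≤ 1)
    (h0 : ∫ θ : Sph n, u θ ∂(sphMeas n) = 0) :
    ∫ θ : Sph n, Real.exp (n * u θ) ∂(sphMeas n) ≤
      sarea n + n ^ 2 / 2 * sip u u + n ^ 3 * M * sip u u := by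
  have hn0 : (0 : ℝ) < n := by exact_mod_cast (show 0 < n by omega)
  have cu := hu.continuous_sph
  have i6 : SphInt (fun θ : Sph n => u (θ : Euc n)) 0 := ⟨cu, h0⟩
  have i7 : SphInt (fun θ : Sph n => u (θ : Euc n) ^ 2) (sip u u) :=
    ⟨cu.pow 2, by simp only [sip, sq]⟩
  have key := ((sphInt_const (n := n) 1).add (i6.const_mul n)).add
    (i7.const_mul (n ^ 2 / 2 + n ^ 3 * M))
  have : sarea n + n ^ 2 / 2 * sip u u + n ^ 3 * M * sip u u =
      1 * sarea n + n * 0 + (n ^ 2 / 2 + n ^ 3 * M) * sip u u := by ring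
  rw [this, ← key.2]
  refine integral_mono (sph_integrable (Real.continuous_exp.comp (continuous_const.mul cu)))
    (sph_integrable key.1) fun θ => ?_
  have hx : |n * u θ| ≤ n * M := by
    rw [abs_mul, abs_of_pos hn0]
    exact mul_le_mul_of_nonneg_left (hM θ) hn0.le
  refine (exp_le_cubic (hx.trans hM1)).trans ?_
  have h1 : |n * u θ| * (n * u θ) ^ 2 ≤ (n * M) * (n * u θ) ^ 2 := by gcongr
  nlinarith

end CoreIntegral

section Core

open Filter Topology

variable {n : ℕ}

lemma one_add_pow_le (m : ℕ) {z : ℝ} (h0 : 0 ≤ z) (h1 : z ≤ 1) :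
    (1 + z) ^ m ≤ 1 + m * z + 4 ^ m * z ^ 2 := by
  induction m with
  | zero => simp; positivity
  | succ m ih =>
    have hm : (m : ℝ) ≤ 4 ^ m := by
      have : m < 4 ^ m := Nat.lt_pow_self (by norm_num)
      exact_mod_cast this.le
    have h4 : (0 : ℝ) < 4 ^ m := by positivity
    have hz : 0 ≤ z ^ 2 := sq_nonneg z
    calc (1 + z) ^ (m + 1) = (1 + z) ^ m * (1 + z) := pow_succ _ _
      _ ≤ (1 + m * z + 4 ^ m * z ^ 2) * (1 + z) := by gcongr
      _ = 1 + (m + 1) * z + (m + 4 ^ m) * z ^ 2 + 4 ^ m * (z ^ 2 * z) := by ring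
      _ ≤ 1 + (m + 1) * z + (4 ^ m + 4 ^ m) * z ^ 2 + 4 ^ m * (z ^ 2 * 1) := by gcongr
      _ ≤ 1 + (m + 1 : ℕ) * z + 4 ^ (m + 1) * z ^ 2 := by
        push_cast
        rw [pow_succ (4 : ℝ) m]
        nlinarith [mul_nonneg h4.le hz]

lemma continuous_Jfun {u : Euc n → ℝ} (hu : Adm u) {B : Euc n →L[ℝ] Euc n}
    (hB2 : ‖B‖ ≤ 1 / 2) :
    Continuous fun θ : Sph n => Jfun n (u θ) θ (gradient u (θ : Euc n)) B := by
  have cB : Continuous fun θ : Sph n => B (θ : Euc n) := B.continuous.comp continuous_subtype_val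
  have ca : Continuous fun θ : Sph n => (θ : Euc n) + B (θ : Euc n) := continuous_subtype_val.add cB
  have cm : Continuous fun θ : Sph n => (θ : Euc n) - gradient u (θ : Euc n) :=
    continuous_subtype_val.sub hu.continuous_grad
  have ha : ∀ θ : Sph n, ‖(θ : Euc n) + B (θ : Euc n)‖ ≠ 0 := fun θ => by
    have h1 : ‖B (θ : Euc n)‖ ≤ 1 / 2 := by
      have := B.le_of_opNorm_le hB2 (θ : Euc n)
      rwa [sph_norm, mul_one] at this
    have h2 : ‖(θ : Euc n)‖ ≤ ‖(θ : Euc n) + B (θ : Euc n)‖ + ‖B (θ : Euc n)‖ := by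
      have := norm_sub_le ((θ : Euc n) + B (θ : Euc n)) (B (θ : Euc n))
      rwa [add_sub_cancel_right] at this
    rw [sph_norm] at h2
    linarith
  have hm : ∀ θ : Sph n, ‖(θ : Euc n) - gradient u (θ : Euc n)‖ ≠ 0 := fun θ h => by
    have h1 := hu.inner_self_gradient (sph_ne_zero θ)
    rw [norm_eq_zero, sub_eq_zero] at h
    rw [← h, real_inner_self_eq_norm_sq, sph_norm] at h1
    norm_num at h1
  have cBa := B.continuous.comp ca
  have cBm := B.continuous.comp cm
  unfold Jfun
  refine (Real.continuous_exp.comp (continuous_const.mul hu.continuous_sph)).mul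
    ((cm.norm.mul (ca.norm.inv₀ ha)).mul (((continuous_const.sub
      (((ca.add cBa).inner ca).div (ca.norm.pow 2) fun θ => pow_ne_zero _ (ha θ))).sub
      (((cm.add cBm).inner cm).div (cm.norm.pow 2) fun θ => pow_ne_zero _ (hm θ))).add
      (((ca.inner cm).mul ((ca.add cBa).inner cm)).div ((ca.norm.pow 2).mul (cm.norm.pow 2))
        fun θ => mul_ne_zero (pow_ne_zero _ (ha θ)) (pow_ne_zero _ (hm θ)))))

lemma mode_arith_bounds {N U W b D : ℝ} (hN4 : 4 ≤ N) (hR : 0 ≤ U - W - b)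
    (hD : 3 * (N + 1) * (U - W - b) ≤ D - (N - 1) * W - 2 * N * b) (hb0 : 0 ≤ b) (hW0 : 0 ≤ W) :
    (N - 1) * U ≤ D ∧ 0 ≤ U ∧ 0 ≤ D ∧ U ≤ D ∧ 2 * N * b ≤ D := by
  obtain ⟨R, hR'⟩ : ∃ R, R = U - W - b := ⟨_, rfl⟩
  rw [← hR'] at hR hD
  have hU : U = R + W + b := by linarith
  have e1 : 0 ≤ (N - 4) * R := mul_nonneg (by linarith) hR
  have e2 : 0 ≤ (N - 4) * b := mul_nonneg (by linarith) hb0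
  have e3 : 0 ≤ (N - 4) * W := mul_nonneg (by linarith) hW0
  have hU0 : 0 ≤ U := by linarith
  have h1 : (N - 1) * U ≤ D := by rw [hU]; linarith
  have h2 : 0 ≤ (N - 4) * U := mul_nonneg (by linarith) hU0
  refine ⟨h1, hU0, ?_, ?_, ?_⟩ <;> linarith

lemma quadratic_form_gap {N U W b D δ : ℝ} (hN4 : 4 ≤ N)
    (hD : 3 * (N + 1) * (U - W - b) ≤ D - (N - 1) * W - 2 * N * b) (hb0 : 0 ≤ b) (hW0 : 0 ≤ W)
    (hδ : δ * (6 * (N + 1)) = N ^ 2 - 13) :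
    (N - 1) * (N - 2) * (U - W) + δ * D ≤ (N - 3) / 2 * D + N * (N - 1) * b := by
  have h0 : 0 ≤ (N - 1) * W := mul_nonneg (by linarith) hW0
  have h6 : 0 ≤ D - (3 * (N + 1) * (U - W - b) + 2 * N * b) := by linarith
  have h8 : 0 ≤ (N - 1) * (N - 2) := mul_nonneg (by linarith) (by linarith)
  have h9 := mul_nonneg h8 h6
  have h10 : 0 ≤ (N - 1) * N * b :=
    mul_nonneg (mul_nonneg (by linarith) (by linarith)) hb0
  have h11 : 0 ≤ (N - 1) * b := mul_nonneg (by linarith) hb0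
  have e2 : 0 ≤ (N - 4) * ((N - 1) * b) := mul_nonneg (by linarith) h11
  have e3 : 0 ≤ (N - 4) * ((N - 1) * N * b) := mul_nonneg (by linarith) h10
  refine le_of_mul_le_mul_left ?_ (show 0 < 6 * (N + 1) by linarith)
  have : 6 * (N + 1) * ((N - 1) * (N - 2) * (U - W) + δ * D) =
    6 * (N + 1) * ((N - 1) * (N - 2) * (U - W)) + (δ * (6 * (N + 1))) * D := by ring
  rw [this, hδ]
  linarith

lemma one_add_pow_scaled_le {n : ℕ} {N U D ε s c' y z : ℝ} (hn : 4 ≤ n) (hN : N = n)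
    (hN4 : 4 ≤ N) (hs : 0 < s) (hD0 : 0 ≤ D)
    (hyU : y * s = (N / 2 + N ^ 2 * (8 * ε)) * U) (hz : z = y + c' * (D / s)) (hz0 : 0 ≤ z)
    (hzd : z ≤ (N ^ 2 + 1) * (D / s)) (hzε : z ≤ ε) (hε1 : ε ≤ 1) :
    (N - 1) * s * (1 + z) ^ (n - 2) ≤ (N - 1) * s +
        (N - 1) * (N - 2) * ((N / 2 + N ^ 2 * (8 * ε)) * U + c' * D) +
        (N - 1) * 4 ^ (n - 2) * (N ^ 2 + 1) ^ 2 * ε * D := by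
  have hp := one_add_pow_le (n - 2) hz0 (hzε.trans hε1)
  have hcast : ((n - 2 : ℕ) : ℝ) = N - 2 := by
    rw [hN]; push_cast [show 2 ≤ n by omega]; ring
  rw [hcast] at hp
  have hε0 : 0 ≤ ε := hz0.trans hzε
  have hDd : D = (D / s) * s := by field_simp
  have hd0 : 0 ≤ D / s := by positivity
  have hz2 : z ^ 2 ≤ (N ^ 2 + 1) ^ 2 * ε * (D / s) := by
    calc z ^ 2 = z * z := sq z
      _ ≤ ε * ((N ^ 2 + 1) * (D / s)) := by gcongr
      _ = (N ^ 2 + 1) * ε * (D / s) := by ring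
      _ ≤ (N ^ 2 + 1) ^ 2 * ε * (D / s) := by
        gcongr
        exact le_self_pow₀ (by nlinarith) (by norm_num)
  have hN1 : 0 ≤ N - 1 := by linarith
  calc (N - 1) * s * (1 + z) ^ (n - 2)
      ≤ (N - 1) * s * (1 + (N - 2) * z + 4 ^ (n - 2) * ((N ^ 2 + 1) ^ 2 * ε * (D / s))) := by
        gcongr
        exact hp.trans (by gcongr)
    _ = (N - 1) * s + (N - 1) * (N - 2) * (y * s + c' * ((D / s) * s)) +
        (N - 1) * 4 ^ (n - 2) * (N ^ 2 + 1) ^ 2 * ε * ((D / s) * s) := by rw [hz]; ring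
    _ = _ := by rw [hyU, ← hDd]

lemma core_arith {n : ℕ} {N U W b D δ ε s T E c' J y z : ℝ} (hn : 4 ≤ n) (hN : N = n)
    (hN4 : 4 ≤ N) (hs : 0 < s) (hε0 : 0 ≤ ε) (hε1 : ε ≤ 1)
    (hD0 : 0 ≤ D) (hU0 : 0 ≤ U) (hUD : U ≤ D)
    (hT : T = (N - 1) * (N - 2) * (64 * N * (N + 1) ^ 2) +
      8 * ((N - 1) * (N - 2)) * N ^ 2 + (N - 1) * 4 ^ (n - 2) * (N ^ 2 + 1) ^ 2 + E)
    (hTε : T * ε ≤ δ / 2) (hc' : (N - 1) * (N - 2) * c' ≤ δ / 2)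
    (hW : W ≤ N * (N + 1) ^ 2 * (8 * ε) ^ 2 * U)
    (hmain : (N - 1) * (N - 2) * (U - W) + δ * D ≤ (N - 3) / 2 * D + N * (N - 1) * b)
    (hyU : y * s = (N / 2 + N ^ 2 * (8 * ε)) * U) (hz : z = y + c' * (D / s)) (hz0 : 0 ≤ z)
    (hzd : z ≤ (N ^ 2 + 1) * (D / s)) (hzε : z ≤ ε)
    (hJ : (N - 1) * s + (N - 3) / 2 * D + (N - 1) * (N - 2) ^ 2 / 2 * U + N * (N - 1) * b
      - E * ε * D ≤ J) :
    (N - 1) * s * (1 + z) ^ (n - 2) ≤ J := by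
  have hN1 : 0 ≤ N - 1 := by linarith
  have hN2 : 0 ≤ N - 2 := by linarith
  have hz3 := one_add_pow_scaled_le hn hN hN4 hs hD0 hyU hz hz0 hzd hzε hε1
  have hWε : W ≤ 64 * N * (N + 1) ^ 2 * ε * D := by
    have h5 : N * (N + 1) ^ 2 * (8 * ε) ^ 2 * U = 64 * N * (N + 1) ^ 2 * ε * (ε * U) := by ring
    rw [h5] at hW
    refine hW.trans ?_
    have h6 : ε * U ≤ 1 * D := mul_le_mul hε1 hUD hU0 zero_le_one
    rw [one_mul] at h6
    gcongr
  have hTD : T * ε * D ≤ δ / 2 * D := by gcongr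
  have hcD : (N - 1) * (N - 2) * c' * D ≤ δ / 2 * D := by gcongr
  have hWW : (N - 1) * (N - 2) * W ≤ (N - 1) * (N - 2) * (64 * N * (N + 1) ^ 2 * ε * D) := by
    gcongr
  have hUU : 8 * ((N - 1) * (N - 2)) * N ^ 2 * ε * U ≤ 8 * ((N - 1) * (N - 2)) * N ^ 2 * ε * D := by
    gcongr
  rw [hT] at hTD
  refine hz3.trans (le_trans ?_ hJ)
  linarith

lemma cubic_le_of_sum_le {C t x y z : ℝ} (hC : 0 ≤ C) (hx : 0 ≤ x) (hy : 0 ≤ y) (hz : 0 ≤ z)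
    (h : x + y + z ≤ t) : C * (x + y + z) ^ 3 ≤ 3 * C * t * (x ^ 2 + y ^ 2 + z ^ 2) :=
  calc C * (x + y + z) ^ 3 = C * (x + y + z) * (x + y + z) ^ 2 := by ring
    _ ≤ C * t * (3 * (x ^ 2 + y ^ 2 + z ^ 2)) := by
      have : (x + y + z) ^ 2 ≤ 3 * (x ^ 2 + y ^ 2 + z ^ 2) := by
        nlinarith only [sq_nonneg (x - y), sq_nonneg (y - z), sq_nonneg (x - z)]
      have : 0 ≤ t := by linarith
      gcongr
    _ = _ := by ring

set_option maxHeartbeats 1000000 in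
theorem core_normalized (hn : 4 ≤ n) : ∃ ε₀ c : ℝ, 0 < ε₀ ∧ 0 < c ∧ ∀ u : Euc n → ℝ, Adm u →
    (∀ θ : Sph n, ‖gradient u (θ : Euc n)‖ ≤ ε₀) →
    ∫ θ : Sph n, u θ ∂(sphMeas n) = 0 →
    (∀ v : Euc n, ∫ θ : Sph n, Real.exp ((n + 1) * u θ) * ⟪v, (θ : Euc n)⟫ ∂(sphMeas n) = 0) →
    ∃ (B : Euc n →L[ℝ] Euc n) (y : ℝ), SymTr0 B ∧ ‖B‖ ≤ 1 / 2 ∧ 0 ≤ y ∧ y ≤ 1 ∧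
      (n - 1) * sarea n * (1 + (y + c * dirichlet u u)) ^ (n - 2) ≤
        ∫ θ : Sph n, Jfun n (u θ) θ (gradient u (θ : Euc n)) B ∂(sphMeas n) ∧
      ∫ θ : Sph n, Real.exp (n * u θ) ∂(sphMeas n) ≤ sarea n * (1 + n * y) := by
  obtain ⟨C, r₀, hC, hr₀, hJ⟩ := exists_Jfun_bound n
  have hs := sarea_pos (n := n) (by omega)
  obtain ⟨N, hN⟩ : ∃ N : ℝ, N = n := ⟨_, rfl⟩
  have hN4 : 4 ≤ N := by rw [hN]; exact_mod_cast hn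
  obtain ⟨δ, hδ⟩ : ∃ δ : ℝ, δ = (N ^ 2 - 13) / (6 * (N + 1)) := ⟨_, rfl⟩
  have hδ0 : 0 < δ := by rw [hδ]; apply div_pos <;> nlinarith
  obtain ⟨E, hE⟩ : ∃ E, E = 3 * C * (12 * N + 33) * (N + 4) := ⟨_, rfl⟩
  have hE0 : 0 < E := by rw [hE]; positivity
  obtain ⟨T, hT⟩ : ∃ T, T = (N - 1) * (N - 2) * (64 * N * (N + 1) ^ 2) +
    8 * ((N - 1) * (N - 2)) * N ^ 2 + (N - 1) * 4 ^ (n - 2) * (N ^ 2 + 1) ^ 2 + E := ⟨_, rfl⟩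
  have hN1 : 0 < N - 1 := by linarith
  have hN2 : 0 < N - 2 := by linarith
  have hT0 : 0 < T := by rw [hT]; positivity
  obtain ⟨c', hc', hc'0, hc'1⟩ : ∃ c' : ℝ, (N - 1) * (N - 2) * c' ≤ δ / 2 ∧ 0 < c' ∧ c' ≤ 1 := by
    refine ⟨min 1 (δ / (2 * ((N - 1) * (N - 2)))), ?_, by positivity, min_le_left _ _⟩
    calc (N - 1) * (N - 2) * min 1 (δ / (2 * ((N - 1) * (N - 2))))
        ≤ (N - 1) * (N - 2) * (δ / (2 * ((N - 1) * (N - 2)))) := by gcongr; exact min_le_right _ _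
      _ = δ / 2 := by field_simp
  obtain ⟨ε, hε0, hε1, hε2, hε3, hε4⟩ : ∃ ε : ℝ, 0 < ε ∧ 24 * (N + 2) * ε ≤ 1 ∧
      (12 * N + 33) * ε < r₀ ∧ T * ε ≤ δ / 2 ∧ (N ^ 2 + 1) * ε ≤ 1 := by
    refine ⟨min (min (1 / (24 * (N + 2))) (r₀ / (2 * (12 * N + 33))))
      (min (δ / (2 * T)) (1 / (N ^ 2 + 1))), by positivity, ?_, ?_, ?_, ?_⟩
    · rw [← le_div_iff₀' (by positivity)]
      exact (min_le_left _ _).trans (min_le_left _ _)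
    · rw [← lt_div_iff₀' (by positivity)]
      refine ((min_le_left _ _).trans (min_le_right _ _)).trans_lt ?_
      rw [div_lt_div_iff_of_pos_left hr₀ (by positivity) (by positivity)]
      linarith
    · calc T * _ ≤ T * (δ / (2 * T)) := by
            gcongr; exact (min_le_right _ _).trans (min_le_left _ _)
        _ = δ / 2 := by field_simp
    · rw [← le_div_iff₀' (by positivity)]
      exact (min_le_right _ _).trans (min_le_right _ _)
  have hεle : ε ≤ 1 := by nlinarith only [hN4, hε1, hε0]
  refine ⟨ε, c' / sarea n, hε0, by positivity, fun u hu hg h0 hbar => ?_⟩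
  have hM : ∀ θ : Sph n, |u θ| ≤ 8 * ε := hu.abs_le_of_integral_eq_zero (by omega) hg h0
  obtain ⟨c, w, B, hB, hm0, hw, hb, hR, hD⟩ := exists_mode_decomp (by omega) hu
  have hc : c = 0 := by
    rw [h0] at hm0
    exact (mul_eq_zero.1 hm0.symm).resolve_right hs.ne'
  have hW := first_mode_le (by omega) hu hM (by rw [← hN]; nlinarith only [hN4, hε1, hε0]) hbar hw
  have hV := integral_exp_le (by omega) hu hM (by rw [← hN]; nlinarith only [hN4, hε1, hε0]) h0
  have hW0 : 0 ≤ sarea n / n * ‖w‖ ^ 2 := by positivity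
  have hb0 := sip_self_nonneg (fun x => ⟪B x, x⟫)
  have hBn := fun x => hB.norm_sq_le (by omega) x
  have hB' : SymTr0 ((-2 : ℝ) • B) := by
    refine ⟨fun x y => ?_, ?_⟩
    · simp [inner_smul_left, inner_smul_right, hB.1 x y]
    · have h2 := hB.2
      rw [ContinuousLinearMap.toLinearMap_smul, map_smul, h2, smul_zero]
  have hQ := integral_Qfun (by omega) hu hB' h0
  have q1 : sip u (fun x => ⟪((-2 : ℝ) • B) x, x⟫) = -2 * sip u (fun x => ⟪B x, x⟫) := by
    rw [← sip_const_mul_right]; simp [inner_smul_left]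
  have q2 : sip (fun x => ⟪((-2 : ℝ) • B) x, x⟫) (fun x => ⟪((-2 : ℝ) • B) x, x⟫) =
      4 * sip (fun x => ⟪B x, x⟫) (fun x => ⟪B x, x⟫) := by
    have : (fun x : Euc n => ⟪((-2 : ℝ) • B) x, x⟫) = fun x => -2 * ⟪B x, x⟫ := by
      ext x; simp [inner_smul_left]
    rw [this, sip_const_mul_left, sip_const_mul_right]; ring
  rw [q1, q2, hb] at hQ
  have hU : sip u u ≤ (8 * ε) ^ 2 * sarea n := by
    have := (SphInt.const_mul (n := n) ((8 * ε) ^ 2) (sphInt_const 1))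
    simp only [mul_one, one_mul] at this
    rw [← this.2, sip]
    refine integral_mono (sph_integrable (hu.continuous_sph.mul hu.continuous_sph))
      (sph_integrable this.1) fun θ => ?_
    show u θ * u θ ≤ (8 * ε) ^ 2
    rw [← sq, ← sq_abs]
    exact pow_le_pow_left₀ (abs_nonneg _) (hM θ) 2
  have hDle : dirichlet u u ≤ ε ^ 2 * sarea n := by
    have := (SphInt.const_mul (n := n) (ε ^ 2) (sphInt_const 1))
    simp only [mul_one, one_mul] at this
    rw [← this.2, dirichlet]
    refine integral_mono (sph_integrable (hu.continuous_grad.inner hu.continuous_grad))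
      (sph_integrable this.1) fun θ => ?_
    show ⟪gradient u (θ : Euc n), gradient u (θ : Euc n)⟫ ≤ ε ^ 2
    rw [real_inner_self_eq_norm_sq]
    exact pow_le_pow_left₀ (norm_nonneg _) (hg θ) 2
  rw [hc] at hR hD
  obtain ⟨b, hbdef⟩ : ∃ b, b = sip (fun x => ⟪B x, x⟫) (fun x => ⟪B x, x⟫) := ⟨_, rfl⟩
  obtain ⟨U, hUdef⟩ : ∃ U, U = sip u u := ⟨_, rfl⟩
  obtain ⟨D, hDdef⟩ : ∃ D, D = dirichlet u u := ⟨_, rfl⟩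
  obtain ⟨W, hWdef⟩ : ∃ W, W = sarea n / n * ‖w‖ ^ 2 := ⟨_, rfl⟩
  have hR' : 0 ≤ U - W - b := by rw [hUdef, hWdef, hbdef]; linarith
  have hD' : 3 * (N + 1) * (U - W - b) ≤ D - (N - 1) * W - 2 * N * b := by
    rw [hUdef, hWdef, hbdef, hDdef, hN]; linarith
  simp only [← hbdef] at hBn
  rw [← hbdef] at hb0 hQ
  rw [← hWdef, ← hUdef, ← hN] at hW
  rw [← hWdef] at hW0
  rw [← hUdef, ← hN] at hV
  rw [← hUdef] at hU
  rw [← hDdef] at hDle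
  rw [← hDdef, ← hUdef, ← hN] at hQ
  obtain ⟨hUD, hU0, hD0, hUD1, hbD⟩ := mode_arith_bounds hN4 hR' hD' hb0 hW0
  have hBx : ∀ x, ‖B x‖ ^ 2 * sarea n ≤ N * (N + 2) / 2 * b * ‖x‖ ^ 2 := fun x => by
    rw [hN]; exact hBn x
  have hB2n : ‖(-2 : ℝ) • B‖ ^ 2 * sarea n ≤ 2 * N * (N + 2) * b := by
    have : ‖B‖ ≤ √(N * (N + 2) / 2 * b / sarea n) := by
      refine ContinuousLinearMap.opNorm_le_bound _ (by positivity) fun x => ?_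
      rw [← Real.sqrt_sq (norm_nonneg x), ← Real.sqrt_mul (by positivity),
        Real.le_sqrt (norm_nonneg _) (by positivity)]
      rw [div_mul_eq_mul_div, le_div_iff₀ hs]
      exact hBx x
    rw [norm_smul, mul_pow]
    have h2 : ‖B‖ ^ 2 ≤ N * (N + 2) / 2 * b / sarea n := by
      refine (pow_le_pow_left₀ (norm_nonneg _) this 2).trans ?_
      rw [Real.sq_sqrt (by positivity)]
    rw [le_div_iff₀ hs] at h2
    norm_num
    linarith
  have hBε : ‖(-2 : ℝ) • B‖ ≤ 12 * (N + 2) * ε := by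
    refine le_of_sq_le_sq ?_ (by positivity)
    refine le_of_mul_le_mul_right (hB2n.trans ?_) hs
    calc 2 * N * (N + 2) * b ≤ 2 * N * (N + 2) * ((8 * ε) ^ 2 * sarea n) := by
          gcongr; linarith
      _ = (128 * (N * (N + 2))) * (ε ^ 2 * sarea n) := by ring
      _ ≤ (144 * ((N + 2) * (N + 2))) * (ε ^ 2 * sarea n) := by gcongr <;> linarith
      _ = _ := by ring
  obtain ⟨B', hB'def⟩ : ∃ B', B' = (-2 : ℝ) • B := ⟨_, rfl⟩
  rw [← hB'def] at hBε hB2n hB' hQ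
  have hB'2 : ‖B'‖ ≤ 1 / 2 := by linarith
  have hpt : ∀ θ : Sph n, Qfun n (u θ) θ (gradient u (θ : Euc n)) B' +
      (-(3 * C * (12 * N + 33) * ε)) * (u θ * u θ + ⟪gradient u (θ : Euc n), gradient u (θ : Euc n)⟫
        + ‖B'‖ ^ 2) ≤ Jfun n (u θ) θ (gradient u (θ : Euc n)) B' := by
    intro θ
    have hsum : |u θ| + ‖gradient u (θ : Euc n)‖ + ‖B'‖ ≤ (12 * N + 33) * ε := by
      have := hM θ
      have := hg θ
      linarith
    have h := hJ (u θ) θ (gradient u (θ : Euc n)) B' (sph_norm θ)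
      (hu.inner_self_gradient (sph_ne_zero θ)) hB'.1 (hsum.trans_lt hε2)
    have h1 : C * (|u θ| + ‖gradient u (θ : Euc n)‖ + ‖B'‖) ^ 3 ≤ 3 * C * (12 * N + 33) * ε *
        (u θ * u θ + ⟪gradient u (θ : Euc n), gradient u (θ : Euc n)⟫ + ‖B'‖ ^ 2) := by
      rw [real_inner_self_eq_norm_sq, ← sq, ← sq_abs (u θ)]
      have := cubic_le_of_sum_le hC.le (abs_nonneg (u θ)) (norm_nonneg (gradient u (θ : Euc n)))
        (norm_nonneg B') hsum
      rw [← mul_assoc (3 * C)] at this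
      exact this
    have h2 := (abs_le.1 h).1
    linarith only [h1, h2]
  have e1 : SphInt (fun θ : Sph n => u (θ : Euc n) * u θ) U :=
    ⟨hu.continuous_sph.mul hu.continuous_sph, hUdef.symm⟩
  have e2 : SphInt (fun θ : Sph n => ⟪gradient u (θ : Euc n), gradient u (θ : Euc n)⟫) D :=
    ⟨hu.continuous_grad.inner hu.continuous_grad, hDdef.symm⟩
  have e3 := hQ.add (((e1.add e2).add (sphInt_const (‖B'‖ ^ 2))).const_mul
    (-(3 * C * (12 * N + 33) * ε)))
  have hJint := integral_mono (sph_integrable e3.1) (sph_integrable (continuous_Jfun hu hB'2)) hpt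
  rw [e3.2] at hJint
  have herr : 3 * C * (12 * N + 33) * ε * (U + D + ‖B'‖ ^ 2 * sarea n) ≤ E * ε * D := by
    rw [hE]
    have h3 : (N + 2) * (2 * N * b) ≤ (N + 2) * D := by gcongr
    have : U + D + ‖B'‖ ^ 2 * sarea n ≤ (N + 4) * D := by linarith only [h3, hB2n, hUD1]
    calc _ ≤ 3 * C * (12 * N + 33) * ε * ((N + 4) * D) := by gcongr
      _ = _ := by ring
  obtain ⟨y, hy⟩ : ∃ y, y = (N / 2 + N ^ 2 * (8 * ε)) * U / sarea n := ⟨_, rfl⟩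
  have hy0 : 0 ≤ y := by rw [hy]; positivity
  have hεN : 8 * ε ≤ 1 / 2 := by nlinarith only [hN4, hε1, hε0]
  have hyD : y ≤ N ^ 2 * (D / sarea n) := by
    rw [hy, mul_div_assoc]
    have h1 : N / 2 ≤ N ^ 2 * (1 / 2) := by nlinarith only [hN4]
    have h2 : N ^ 2 * (8 * ε) ≤ N ^ 2 * (1 / 2) := by gcongr
    gcongr
    linarith only [h1, h2]
  obtain ⟨d, hd⟩ : ∃ d, d = D / sarea n := ⟨_, rfl⟩
  have hd0 : 0 ≤ d := by rw [hd]; positivity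
  have hdε : d ≤ ε ^ 2 := by rw [hd, div_le_iff₀ hs]; exact hDle
  have hDd : D = d * sarea n := by rw [hd]; field_simp
  rw [← hd] at hyD
  obtain ⟨z, hz⟩ : ∃ z, z = y + c' * d := ⟨_, rfl⟩
  have hcd : c' * d ≤ 1 * d := by gcongr
  have hzd : z ≤ (N ^ 2 + 1) * d := by rw [hz]; linarith only [hcd, hyD]
  have hz0 : 0 ≤ z := by rw [hz]; positivity
  have hd1 : (N ^ 2 + 1) * d ≤ ε := by
    calc (N ^ 2 + 1) * d ≤ (N ^ 2 + 1) * ε ^ 2 := by gcongr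
      _ = ((N ^ 2 + 1) * ε) * ε := by ring
      _ ≤ 1 * ε := by gcongr
      _ = ε := one_mul _
  have hzε : z ≤ ε := hzd.trans hd1
  have hyz : y ≤ z := by
    rw [hz]
    exact le_add_of_nonneg_right (by positivity)
  refine ⟨B', y, hB', hB'2, hy0, hyz.trans (hzε.trans hεle), ?_, ?_⟩
  · have hzz : y + c' / sarea n * dirichlet u u = z := by
      rw [hz, hd, hDdef]; ring
    rw [hzz, ← hN]
    have hyU : y * sarea n = (N / 2 + N ^ 2 * (8 * ε)) * U := by rw [hy]; field_simp
    rw [hd] at hz hzd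
    exact core_arith hn hN hN4 hs hε0.le hεle hD0 hU0 hUD1 hT hε3 hc' hW
      (quadratic_form_gap hN4 hD' hb0 hW0 (by rw [hδ]; field_simp)) hyU hz hz0 hzd hzε
      (by linarith only [herr, hJint])
  · rw [← hN]
    have hyU : y * sarea n = (N / 2 + N ^ 2 * (8 * ε)) * U := by rw [hy]; field_simp
    refine hV.trans (le_of_eq ?_)
    linear_combination (-N) * hyU

end Core

section CoreInequality

variable {n : ℕ}

lemma quotient_stability_arith {n : ℕ} (hn : 4 ≤ n) {s y d I V : ℝ} (hs : 0 < s) (hy0 : 0 ≤ y)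
    (hy1 : y ≤ 1) (hd : 0 ≤ d) (hI : (n - 1) * s * (1 + (y + d)) ^ (n - 2) ≤ I) (hV0 : 0 < V)
    (hV : V ≤ s * (1 + n * y)) :
    ((n - 1) * s) ^ (((n : ℝ) - 2)⁻¹) / (s / n) ^ ((n : ℝ)⁻¹) * (d / 2) ≤
      I ^ (((n : ℝ) - 2)⁻¹) / (V / n) ^ ((n : ℝ)⁻¹)
        - ((n - 1) * s) ^ (((n : ℝ) - 2)⁻¹) / (s / n) ^ ((n : ℝ)⁻¹) := by
  have hn4 : (4 : ℝ) ≤ n := by exact_mod_cast hn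
  have hN2 : (0 : ℝ) < n - 2 := by linarith
  have hN1 : (0 : ℝ) < n - 1 := by linarith
  have hn0 : (0 : ℝ) < n := by linarith
  have h2 : ((n - 2 : ℕ) : ℝ) = n - 2 := by push_cast [show 2 ≤ n by omega]; ring
  have hz : 0 ≤ 1 + (y + d) := by positivity
  have h1 : ((n - 1) * s) ^ (((n : ℝ) - 2)⁻¹) * (1 + (y + d)) ≤ I ^ (((n : ℝ) - 2)⁻¹) := by
    refine le_trans (le_of_eq ?_) (Real.rpow_le_rpow (by positivity) hI (by positivity))
    rw [Real.mul_rpow (mul_pos hN1 hs).le (pow_nonneg hz _), ← h2,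
      Real.pow_rpow_inv_natCast hz (show n - 2 ≠ 0 by omega)]
  have h3 : (V / n) ^ ((n : ℝ)⁻¹) ≤ (s / n) ^ ((n : ℝ)⁻¹) * (1 + y) := by
    have h4 : V / n ≤ s / n * (1 + y) ^ n := by
      rw [div_mul_eq_mul_div]
      gcongr
      refine hV.trans ?_
      gcongr
      exact one_add_mul_le_pow (by linarith) n
    refine (Real.rpow_le_rpow (by positivity) h4 (by positivity)).trans (le_of_eq ?_)
    rw [Real.mul_rpow (by positivity) (by positivity),
      Real.pow_rpow_inv_natCast (by positivity) (by omega)]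
  have hP : 0 < ((n - 1) * s) ^ (((n : ℝ) - 2)⁻¹) := Real.rpow_pos_of_pos (by positivity) _
  have hR : 0 < (s / n) ^ ((n : ℝ)⁻¹) := Real.rpow_pos_of_pos (by positivity) _
  have hVp : 0 < (V / n) ^ ((n : ℝ)⁻¹) := Real.rpow_pos_of_pos (by positivity) _
  obtain ⟨P, hPd⟩ : ∃ P, P = ((n - 1) * s) ^ (((n : ℝ) - 2)⁻¹) := ⟨_, rfl⟩
  obtain ⟨R, hRd⟩ : ∃ R, R = (s / n) ^ ((n : ℝ)⁻¹) := ⟨_, rfl⟩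
  rw [← hPd] at h1 hP ⊢
  rw [← hRd] at h3 hR ⊢
  have h5 : P * (1 + (y + d)) / (R * (1 + y)) ≤ I ^ (((n : ℝ) - 2)⁻¹) / (V / n) ^ ((n : ℝ)⁻¹) := by
    have := le_trans (by positivity) h1
    gcongr
  have h6 : P / R * (d / 2) + P / R ≤ P * (1 + (y + d)) / (R * (1 + y)) := by
    have : P * (1 + (y + d)) / (R * (1 + y)) = P / R * (d / (1 + y)) + P / R := by
      field_simp
      ring
    rw [this]
    gcongr
    linarith
  linarith

lemma Jfun_sub_const (n : ℕ) (u k : ℝ) (θ p : Euc n) (B : Euc n →L[ℝ] Euc n) :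
    Jfun n (u - k) θ p B = Real.exp (-((n - 2) * k)) * Jfun n u θ p B := by
  have : Real.exp ((n - 2) * (u - k)) = Real.exp (-((n - 2) * k)) * Real.exp ((n - 2) * u) := by
    rw [← Real.exp_add]; ring_nf
  simp only [Jfun, this, mul_assoc]

lemma exp_mul_rpow_inv {a k I : ℝ} (ha : 0 < a) (hI : 0 ≤ I) :
    (Real.exp (-(a * k)) * I) ^ a⁻¹ = Real.exp (-k) * I ^ a⁻¹ := by
  rw [Real.mul_rpow (Real.exp_pos _).le hI, ← Real.exp_mul]
  congr 2
  field_simp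

theorem core_inequality (hn : 4 ≤ n) : ∃ ε₀ c : ℝ, 0 < ε₀ ∧ 0 < c ∧ ∀ u : Euc n → ℝ, Adm u →
    (∀ θ : Sph n, ‖gradient u (θ : Euc n)‖ ≤ ε₀) →
    (∀ v : Euc n, ∫ θ : Sph n, Real.exp ((n + 1) * u θ) * ⟪v, (θ : Euc n)⟫ ∂(sphMeas n) = 0) →
    ∃ B : Euc n →L[ℝ] Euc n, SymTr0 B ∧ ‖B‖ ≤ 1 / 2 ∧
      0 ≤ ∫ θ : Sph n, Jfun n (u θ) θ (gradient u (θ : Euc n)) B ∂(sphMeas n) ∧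
      c * dirichlet u u ≤
        (∫ θ : Sph n, Jfun n (u θ) θ (gradient u (θ : Euc n)) B ∂(sphMeas n)) ^ (((n : ℝ) - 2)⁻¹)
            / ((∫ θ : Sph n, Real.exp (n * u θ) ∂(sphMeas n)) / n) ^ ((n : ℝ)⁻¹)
          - (((n : ℝ) - 1) * sarea n) ^ (((n : ℝ) - 2)⁻¹) / (sarea n / n) ^ ((n : ℝ)⁻¹) := by
  obtain ⟨ε₀, c, hε₀, hc, h⟩ := core_normalized hn
  have hs := sarea_pos (n := n) (by omega)
  have hn4 : (4 : ℝ) ≤ n := by exact_mod_cast hn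
  have hN2 : (0 : ℝ) < n - 2 := by linarith
  have hN1 : (0 : ℝ) < n - 1 := by linarith
  have hn0 : (0 : ℝ) < n := by linarith
  have hG : 0 < ((n - 1) * sarea n) ^ (((n : ℝ) - 2)⁻¹) / (sarea n / n) ^ ((n : ℝ)⁻¹) := by
    have := Real.rpow_pos_of_pos (mul_pos hN1 hs) (((n : ℝ) - 2)⁻¹)
    have := Real.rpow_pos_of_pos (div_pos hs hn0) ((n : ℝ)⁻¹)
    positivity
  refine ⟨ε₀, _, hε₀, mul_pos hG (half_pos hc), fun u hu hg hbar => ?_⟩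
  obtain ⟨k, hk⟩ : ∃ k, k = (∫ θ : Sph n, u θ ∂(sphMeas n)) / sarea n := ⟨_, rfl⟩
  have hgr : gradient (fun x => u x - k) = gradient u := by
    funext x
    simp only [gradient, fderiv_sub_const]
  have hdir : dirichlet (fun x => u x - k) (fun x => u x - k) = dirichlet u u := by
    simp only [dirichlet, hgr]
  obtain ⟨B, y, hB, hB2, hy0, hy1, hI, hV⟩ := h (fun x => u x - k) (hu.sub_const k)
    (by rw [hgr]; exact hg) (by
      have e1 : SphInt (fun θ : Sph n => u (θ : Euc n)) (∫ θ : Sph n, u θ ∂(sphMeas n)) :=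
        ⟨hu.continuous_sph, rfl⟩
      have e2 := (e1.add (sphInt_const (n := n) (-k))).2
      simp only [← sub_eq_add_neg] at e2
      rw [e2, hk]
      field_simp
      ring) (fun v => by
      have e : ∀ θ : Sph n, Real.exp ((n + 1) * (u θ - k)) * ⟪v, (θ : Euc n)⟫ =
          Real.exp (-((n + 1) * k)) * (Real.exp ((n + 1) * u θ) * ⟪v, (θ : Euc n)⟫) := fun θ => by
        rw [← mul_assoc, ← Real.exp_add]; ring_nf
      simp only [e, integral_const_mul, hbar v, mul_zero])
  rw [hdir] at hI
  have hD : 0 ≤ dirichlet u u := integral_nonneg fun θ => real_inner_self_nonneg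
  simp only [hgr, Jfun_sub_const, integral_const_mul] at hI
  have e : ∀ θ : Sph n, Real.exp (n * (u θ - k)) = Real.exp (-(n * k)) * Real.exp (n * u θ) :=
    fun θ => by rw [← Real.exp_add]; ring_nf
  simp only [e, integral_const_mul] at hV
  have hI0 : 0 ≤ ∫ θ : Sph n, Jfun n (u θ) θ (gradient u (θ : Euc n)) B ∂(sphMeas n) := by
    refine nonneg_of_mul_nonneg_right (le_trans (by positivity) hI) (Real.exp_pos _)
  have hV0 : 0 < ∫ θ : Sph n, Real.exp (n * u θ) ∂(sphMeas n) := by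
    have cu : Continuous fun θ : Sph n => Real.exp (n * u θ) :=
      Real.continuous_exp.comp (continuous_const.mul hu.continuous_sph)
    have : NeZero (sphMeas n) := ⟨fun h0 => by
      rw [sarea, h0] at hs; simp at hs⟩
    exact integral_exp_pos (sph_integrable cu)
  refine ⟨B, hB, hB2, hI0, ?_⟩
  have := quotient_stability_arith hn hs hy0 hy1 (mul_nonneg hc.le hD) hI (by positivity) hV
  rw [mul_div_assoc (Real.exp _), exp_mul_rpow_inv hN2 hI0, exp_mul_rpow_inv hn0 (by positivity),
    mul_div_mul_left _ _ (Real.exp_pos _).ne'] at this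
  refine le_trans (le_of_eq ?_) this
  ring

end CoreInequality

section LogGaugeBasics

open Filter Topology

variable {n : ℕ} {L : Euc n → ℝ}

/-- The logarithm of a positively homogeneous gauge of class `C²` off the origin. -/
structure LogGauge (L : Euc n → ℝ) : Prop where
  hom : ∀ s : ℝ, 0 < s → ∀ x : Euc n, x ≠ 0 → L (s • x) = L x + Real.log s
  smooth : ∀ x, x ≠ 0 → ContDiffAt ℝ 2 L x

/-- The normalized gradient of a function. -/
def unitGrad (L : Euc n → ℝ) (x : Euc n) : Euc n := ‖gradient L x‖⁻¹ • gradient L x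

/-- The logarithm of the radial function of the star body `{L < 0}`. -/
def logRadius (L : Euc n → ℝ) (x : Euc n) : ℝ := Real.log ‖x‖ - L x

lemma contDiffAt_gradient {f : Euc n → ℝ} {x : Euc n} {k : WithTop ℕ∞}
    (h : ContDiffAt ℝ (k + 1) f x) : ContDiffAt ℝ k (gradient f) x :=
  (InnerProductSpace.toDual ℝ (Euc n)).symm.contDiff.contDiffAt.comp x (h.fderiv_right le_rfl)

namespace LogGauge

lemma differentiableAt (hL : LogGauge L) {x : Euc n} (hx : x ≠ 0) : DifferentiableAt ℝ L x :=
  (hL.smooth x hx).differentiableAt (by norm_num)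

lemma contDiffAt_gradient (hL : LogGauge L) {x : Euc n} (hx : x ≠ 0) :
    ContDiffAt ℝ 1 (gradient L) x :=
  _root_.contDiffAt_gradient ((hL.smooth x hx).of_le (by norm_num))

lemma fderiv_self (hL : LogGauge L) {x : Euc n} (hx : x ≠ 0) : fderiv ℝ L x x = 1 := by
  have h1 : HasDerivAt (fun s : ℝ => L (s • x)) (fderiv ℝ L x x) 1 := by
    have h2 : HasDerivAt (fun s : ℝ => s • x) x 1 := by
      simpa using (hasDerivAt_id (1 : ℝ)).smul_const x
    have h3 : HasFDerivAt L (fderiv ℝ L x) ((1 : ℝ) • x) := by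
      rw [one_smul]; exact (hL.differentiableAt hx).hasFDerivAt
    exact h3.comp_hasDerivAt (1 : ℝ) h2
  have h2 : HasDerivAt (fun s : ℝ => L x + Real.log s) 1 1 := by
    simpa using (Real.hasDerivAt_log one_ne_zero).const_add (L x)
  refine (h1.congr_of_eventuallyEq ?_).unique h2
  filter_upwards [lt_mem_nhds (one_pos (α := ℝ))] with s hs
  rw [hL.hom s hs x hx]

lemma inner_gradient_self (hL : LogGauge L) {x : Euc n} (hx : x ≠ 0) :
    ⟪gradient L x, x⟫ = 1 := by
  rw [inner_gradient_left, hL.fderiv_self hx]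

lemma gradient_ne_zero (hL : LogGauge L) {x : Euc n} (hx : x ≠ 0) : gradient L x ≠ 0 := fun h => by
  have := hL.inner_gradient_self hx
  simp [h] at this

lemma gradient_smul (hL : LogGauge L) {s : ℝ} (hs : 0 < s) {x : Euc n} (hx : x ≠ 0) :
    gradient L (s • x) = s⁻¹ • gradient L x := by
  have hsx : s • x ≠ 0 := smul_ne_zero hs.ne' hx
  have h1 : HasFDerivAt (fun y : Euc n => L (s • y)) (s • fderiv ℝ L (s • x)) x := by
    have h2 : HasFDerivAt (fun y : Euc n => s • y) (s • ContinuousLinearMap.id ℝ (Euc n)) x :=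
      (hasFDerivAt_id x).const_smul s
    refine ((hL.differentiableAt hsx).hasFDerivAt.comp x h2).congr_fderiv ?_
    ext w; simp
  have h2 : HasFDerivAt (fun y : Euc n => L y + Real.log s) (fderiv ℝ L x) x :=
    (hL.differentiableAt hx).hasFDerivAt.add_const _
  have h3 : s • fderiv ℝ L (s • x) = fderiv ℝ L x := by
    refine (h1.congr_of_eventuallyEq ?_).unique h2
    filter_upwards [isOpen_ne.mem_nhds hx] with y hy
    rw [hL.hom s hs y hy]
  simp only [gradient]
  rw [← h3, map_smul, smul_smul, inv_mul_cancel₀ hs.ne', one_smul]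

lemma norm_gradient_pos (hL : LogGauge L) {x : Euc n} (hx : x ≠ 0) : 0 < ‖gradient L x‖ :=
  norm_pos_iff.2 (hL.gradient_ne_zero hx)

lemma norm_unitGrad (hL : LogGauge L) {x : Euc n} (hx : x ≠ 0) : ‖unitGrad L x‖ = 1 := by
  rw [unitGrad, norm_smul, norm_inv, norm_norm, inv_mul_cancel₀ (hL.norm_gradient_pos hx).ne']

lemma unitGrad_smul (hL : LogGauge L) {s : ℝ} (hs : 0 < s) {x : Euc n} (hx : x ≠ 0) :
    unitGrad L (s • x) = unitGrad L x := by
  simp only [unitGrad, hL.gradient_smul hs hx, norm_smul, norm_inv, Real.norm_of_nonneg hs.le,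
    mul_inv, inv_inv, smul_smul]
  congr 1
  field_simp

lemma contDiffAt_norm_gradient (hL : LogGauge L) {x : Euc n} (hx : x ≠ 0) :
    ContDiffAt ℝ 1 (fun x => ‖gradient L x‖) x :=
  (hL.contDiffAt_gradient hx).norm ℝ (hL.gradient_ne_zero hx)

lemma contDiffAt_unitGrad (hL : LogGauge L) {x : Euc n} (hx : x ≠ 0) :
    ContDiffAt ℝ 1 (unitGrad L) x :=
  ((hL.contDiffAt_norm_gradient hx).inv (hL.norm_gradient_pos hx).ne').smul
    (hL.contDiffAt_gradient hx)

lemma divg_unitGrad_smul (hL : LogGauge L) {s : ℝ} (hs : 0 < s) {x : Euc n} (hx : x ≠ 0) :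
    divg (unitGrad L) (s • x) = s⁻¹ * divg (unitGrad L) x := by
  have hsx : s • x ≠ 0 := smul_ne_zero hs.ne' hx
  have h1 : HasFDerivAt (fun y : Euc n => unitGrad L (s • y))
      (s • fderiv ℝ (unitGrad L) (s • x)) x := by
    have h2 : HasFDerivAt (fun y : Euc n => s • y) (s • ContinuousLinearMap.id ℝ (Euc n)) x :=
      (hasFDerivAt_id x).const_smul s
    refine (((hL.contDiffAt_unitGrad hsx).differentiableAt
      (by norm_num)).hasFDerivAt.comp x h2).congr_fderiv ?_
    ext w; simp
  have h3 : s • fderiv ℝ (unitGrad L) (s • x) = fderiv ℝ (unitGrad L) x := by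
    refine (h1.congr_of_eventuallyEq ?_).unique
      ((hL.contDiffAt_unitGrad hx).differentiableAt (by norm_num)).hasFDerivAt
    filter_upwards [isOpen_ne.mem_nhds hx] with y hy
    rw [hL.unitGrad_smul hs hy]
  rw [divg, divg, ← h3, ContinuousLinearMap.toLinearMap_smul, map_smul, smul_eq_mul, ← mul_assoc,
    inv_mul_cancel₀ hs.ne', one_mul]

lemma adm_logRadius (hL : LogGauge L) : Adm (logRadius L) := by
  refine ⟨fun s hs x hx => ?_, fun x hx => ?_⟩
  · rw [logRadius, logRadius, hL.hom s hs x hx, norm_smul, Real.norm_of_nonneg hs.le,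
      Real.log_mul hs.ne' (norm_ne_zero_iff.2 hx)]
    simp only [zpow_zero, one_mul]
    ring
  · exact ((contDiffAt_norm ℝ hx).log (norm_ne_zero_iff.2 hx)).sub
      ((hL.smooth x hx).of_le (by norm_num))

lemma logRadius_sph (θ : Sph n) : logRadius L (θ : Euc n) = -L θ := by
  rw [logRadius, sph_norm, Real.log_one, zero_sub]

lemma gradient_logRadius (hL : LogGauge L) (θ : Sph n) :
    gradient (logRadius L) (θ : Euc n) = (θ : Euc n) - gradient L (θ : Euc n) := by
  have hx := sph_ne_zero θ
  have hL' := (hL.differentiableAt hx).hasFDerivAt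
  have h1 : HasFDerivAt (fun y : Euc n => Real.log ‖y‖) (innerSL ℝ (θ : Euc n)) (θ : Euc n) := by
    have h2 := (hasStrictFDerivAt_norm_sq (θ : Euc n)).hasFDerivAt.log
      (pow_ne_zero 2 (norm_ne_zero_iff.2 hx))
    have h3 := h2.const_smul (1 / 2 : ℝ)
    refine (h3.congr_fderiv ?_).congr_of_eventuallyEq (Eventually.of_forall fun y => ?_)
    · ext w; simp
    · simp [Real.log_pow]
  refine ext_inner_right ℝ fun w => ?_
  rw [inner_gradient_left, inner_sub_left, inner_gradient_left]
  have h2 : HasFDerivAt (logRadius L) (innerSL ℝ (θ : Euc n) - fderiv ℝ L (θ : Euc n)) (θ : Euc n) :=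
    h1.sub hL'
  rw [h2.fderiv]
  simp

lemma gradient_sph (hL : LogGauge L) (θ : Sph n) :
    gradient L (θ : Euc n) = (θ : Euc n) - gradient (logRadius L) (θ : Euc n) := by
  rw [hL.gradient_logRadius]; abel

lemma fderiv_inner_unitGrad (hL : LogGauge L) {x : Euc n} (hx : x ≠ 0) (w : Euc n) :
    ⟪fderiv ℝ (unitGrad L) x w, unitGrad L x⟫ = 0 := by
  have hd := ((hL.contDiffAt_unitGrad hx).differentiableAt (by norm_num)).hasFDerivAt
  have h1 := hd.inner ℝ hd
  have h2 : HasFDerivAt (fun y => ⟪unitGrad L y, unitGrad L y⟫) (0 : Euc n →L[ℝ] ℝ) x := by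
    refine (hasFDerivAt_const (1 : ℝ) x).congr_of_eventuallyEq ?_
    filter_upwards [isOpen_ne.mem_nhds hx] with y hy
    rw [real_inner_self_eq_norm_sq, hL.norm_unitGrad hy, one_pow]
  have h3 := congrArg (fun T : Euc n →L[ℝ] ℝ => T w) (h1.unique h2)
  simp [real_inner_comm] at h3
  rw [real_inner_comm]
  exact h3

end LogGauge

end LogGaugeBasics

section DivergenceIdentity

open Filter Topology

variable {n : ℕ}

lemma divg_eq_of_hasFDerivAt {X : Euc n → Euc n} {X' : Euc n →L[ℝ] Euc n} {x : Euc n}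
    (h : HasFDerivAt X X' x) : divg X x = LinearMap.trace ℝ (Euc n) X'.toLinearMap := by
  rw [divg, h.fderiv]

lemma trace_smulRight' (f : Euc n →L[ℝ] ℝ) (v : Euc n) :
    LinearMap.trace ℝ (Euc n) (f.smulRight v).toLinearMap = f v :=
  LinearMap.trace_smulRight f.toLinearMap v

lemma divg_smul {f : Euc n → ℝ} {X : Euc n → Euc n} {x : Euc n} (hf : DifferentiableAt ℝ f x)
    (hX : DifferentiableAt ℝ X x) :
    divg (fun y => f y • X y) x = f x * divg X x + fderiv ℝ f x (X x) := by
  rw [divg_eq_of_hasFDerivAt (hf.hasFDerivAt.fun_smul hX.hasFDerivAt),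
    ContinuousLinearMap.toLinearMap_add, map_add, ContinuousLinearMap.toLinearMap_smul, map_smul,
    trace_smulRight', smul_eq_mul, divg]

lemma divg_sub {X Y : Euc n → Euc n} {x : Euc n} (hX : DifferentiableAt ℝ X x)
    (hY : DifferentiableAt ℝ Y x) : divg (fun y => X y - Y y) x = divg X x - divg Y x := by
  rw [divg_eq_of_hasFDerivAt (hX.hasFDerivAt.fun_sub hY.hasFDerivAt), divg, divg,
    ContinuousLinearMap.toLinearMap_sub, map_sub]

lemma hasFDerivAt_norm' {x : Euc n} (hx : x ≠ 0) :
    HasFDerivAt (fun y : Euc n => ‖y‖) (‖x‖⁻¹ • innerSL ℝ x) x := by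
  have h := (hasStrictFDerivAt_norm_sq x).hasFDerivAt.sqrt
    (pow_ne_zero 2 (norm_ne_zero_iff.2 hx))
  have h0 := norm_ne_zero_iff.2 hx
  refine (h.congr_fderiv ?_).congr_of_eventuallyEq (Eventually.of_forall fun y => ?_)
  · ext w
    simp
    field_simp
  · simp

lemma continuous_divg_sph {X : Euc n → Euc n} (h : ∀ x, x ≠ 0 → ContDiffAt ℝ 1 X x) :
    Continuous fun θ : Sph n => divg X (θ : Euc n) := by
  rw [continuous_iff_continuousAt]
  intro θ
  have h1 : ContinuousAt (fderiv ℝ X) (θ : Euc n) :=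
    ((h _ (sph_ne_zero θ)).fderiv_right (m := 0) (by norm_num)).continuousAt
  have h2 : ContinuousAt (fun θ : Sph n => fderiv ℝ X (θ : Euc n)) θ :=
    ContinuousAt.comp (f := fun θ : Sph n => (θ : Euc n)) h1 continuous_subtype_val.continuousAt
  have h3 : Continuous fun T : Euc n →L[ℝ] Euc n => LinearMap.trace ℝ (Euc n) T.toLinearMap :=
    LinearMap.continuous_of_finiteDimensional
      ((LinearMap.trace ℝ (Euc n)).comp (ContinuousLinearMap.coeLM ℝ))
  exact ContinuousAt.comp (f := fun θ : Sph n => fderiv ℝ X (θ : Euc n)) h3.continuousAt h2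

/-- The unit vector field `x ↦ A x / ‖A x‖`. -/
def linUnit (A : Euc n →L[ℝ] Euc n) (x : Euc n) : Euc n := ‖A x‖⁻¹ • A x

lemma hasFDerivAt_norm_inv_lin (A : Euc n →L[ℝ] Euc n) {x : Euc n} (hx : A x ≠ 0) :
    HasFDerivAt (fun y => ‖A y‖⁻¹) (-(‖A x‖ ^ 3)⁻¹ • (innerSL ℝ (A x)).comp A) x := by
  have h0 := norm_ne_zero_iff.2 hx
  have h1 : HasFDerivAt (fun y => ‖A y‖⁻¹) _ x :=
    (hasDerivAt_inv h0).comp_hasFDerivAt x ((hasFDerivAt_norm' hx).comp x A.hasFDerivAt)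
  refine h1.congr_fderiv ?_
  ext w
  simp
  field_simp

lemma hasFDerivAt_linUnit (A : Euc n →L[ℝ] Euc n) {x : Euc n} (hx : A x ≠ 0) :
    HasFDerivAt (linUnit A) (‖A x‖⁻¹ • A +
      (-(‖A x‖ ^ 3)⁻¹ • (innerSL ℝ (A x)).comp A).smulRight (A x)) x :=
  (hasFDerivAt_norm_inv_lin A hx).fun_smul A.hasFDerivAt

lemma divg_linUnit (A : Euc n →L[ℝ] Euc n) {x : Euc n} (hx : A x ≠ 0) :
    divg (linUnit A) x = ‖A x‖⁻¹ * LinearMap.trace ℝ (Euc n) A.toLinearMap -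
      (‖A x‖ ^ 3)⁻¹ * ⟪A (A x), A x⟫ := by
  rw [divg_eq_of_hasFDerivAt (hasFDerivAt_linUnit A hx), ContinuousLinearMap.toLinearMap_add,
    map_add, ContinuousLinearMap.toLinearMap_smul, map_smul, trace_smulRight']
  simp [real_inner_comm]
  ring

lemma contDiffAt_linUnit (A : Euc n →L[ℝ] Euc n) {x : Euc n} (hx : A x ≠ 0) :
    ContDiffAt ℝ 1 (linUnit A) x :=
  ((A.contDiff.contDiffAt.norm ℝ hx).inv (norm_ne_zero_iff.2 hx)).smul A.contDiff.contDiffAt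

namespace LogGauge

variable {L : Euc n → ℝ}

lemma inner_fderiv_gradient_comm (hL : LogGauge L) {x : Euc n} (hx : x ≠ 0) (v w : Euc n) :
    ⟪fderiv ℝ (gradient L) x v, w⟫ = ⟪fderiv ℝ (gradient L) x w, v⟫ := by
  have hs : IsSymmSndFDerivAt ℝ L x :=
    (hL.smooth x hx).isSymmSndFDerivAt (by simp)
  have hd : DifferentiableAt ℝ (fderiv ℝ L) x :=
    ((hL.smooth x hx).fderiv_right (m := 1) (by norm_num)).differentiableAt (by norm_num)
  have h1 : ∀ v w, ⟪fderiv ℝ (gradient L) x v, w⟫ = fderiv ℝ (fderiv ℝ L) x v w := by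
    intro v w
    have h2 : HasFDerivAt (gradient L)
        ((InnerProductSpace.toDual ℝ (Euc n)).symm.toContinuousLinearEquiv.toContinuousLinearMap.comp
          (fderiv ℝ (fderiv ℝ L) x)) x :=
      ((InnerProductSpace.toDual ℝ (Euc n)).symm.toContinuousLinearEquiv.hasFDerivAt).comp x
        hd.hasFDerivAt
    rw [h2.fderiv]
    simp
  rw [h1, h1]
  exact hs v w

lemma norm_mul_unitGrad (hL : LogGauge L) {x : Euc n} (hx : x ≠ 0) :
    ‖gradient L x‖ • unitGrad L x = gradient L x := by
  rw [unitGrad, smul_smul, mul_inv_cancel₀ (hL.norm_gradient_pos hx).ne', one_smul]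

lemma fderiv_norm_gradient (hL : LogGauge L) {x : Euc n} (hx : x ≠ 0) (w : Euc n) :
    fderiv ℝ (fun y => ‖gradient L y‖) x w = ⟪fderiv ℝ (gradient L) x w, unitGrad L x⟫ := by
  have h := (hasFDerivAt_norm' (hL.gradient_ne_zero hx)).comp x
    ((hL.contDiffAt_gradient hx).differentiableAt (by norm_num)).hasFDerivAt
  have h' : HasFDerivAt (fun y => ‖gradient L y‖) _ x := h
  rw [h'.fderiv, unitGrad, inner_smul_right]
  simp

/-- The vector field whose divergence compares the mean curvature with its calibration. -/
def calib (L : Euc n → ℝ) (A : Euc n →L[ℝ] Euc n) (x : Euc n) : Euc n :=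
  Real.exp (-((n - 2) * L x)) •
    (⟪linUnit A x, gradient L x⟫ • unitGrad L x - ‖gradient L x‖ • linUnit A x)

lemma contDiffAt_calib (hL : LogGauge L) {A : Euc n →L[ℝ] Euc n} {x : Euc n} (hx : x ≠ 0)
    (hA : A x ≠ 0) : ContDiffAt ℝ 1 (calib L A) x := by
  have h1 : ContDiffAt ℝ 1 L x := (hL.smooth x hx).of_le (by norm_num)
  have h2 := hL.contDiffAt_gradient hx
  exact ((contDiffAt_const.mul h1).neg.exp).smul
    ((((contDiffAt_linUnit A hA).inner ℝ h2).smul (hL.contDiffAt_unitGrad hx)).sub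
      ((hL.contDiffAt_norm_gradient hx).smul (contDiffAt_linUnit A hA)))

lemma divg_calib (hL : LogGauge L) {A : Euc n →L[ℝ] Euc n} {x : Euc n} (hx : x ≠ 0)
    (hA : A x ≠ 0) :
    divg (calib L A) x = Real.exp (-((n - 2) * L x)) *
      (⟪linUnit A x, gradient L x⟫ * divg (unitGrad L) x +
        ‖gradient L x‖ * ⟪fderiv ℝ (linUnit A) x (unitGrad L x), unitGrad L x⟫ -
        ‖gradient L x‖ * divg (linUnit A) x) := by
  have dL := hL.differentiableAt hx
  have dM := (hL.contDiffAt_gradient hx).differentiableAt (by norm_num)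
  have dN := (hL.contDiffAt_unitGrad hx).differentiableAt (by norm_num)
  have dh := (hL.contDiffAt_norm_gradient hx).differentiableAt (by norm_num)
  have dY := (contDiffAt_linUnit A hA).differentiableAt (by norm_num)
  have dg : DifferentiableAt ℝ (fun y => ⟪linUnit A y, gradient L y⟫) x := dY.inner ℝ dM
  have de : HasFDerivAt (fun y => Real.exp (-((n - 2 : ℝ) * L y)))
      (Real.exp (-((n - 2 : ℝ) * L x)) • -((n - 2 : ℝ) • fderiv ℝ L x)) x :=
    ((dL.hasFDerivAt.const_mul (n - 2 : ℝ)).neg).exp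
  have dV : DifferentiableAt ℝ (fun y => ⟪linUnit A y, gradient L y⟫ • unitGrad L y -
      ‖gradient L y‖ • linUnit A y) x := (dg.fun_smul dN).fun_sub (dh.fun_smul dY)
  have hg : ∀ w, fderiv ℝ (fun y => ⟪linUnit A y, gradient L y⟫) x w =
      ⟪linUnit A x, fderiv ℝ (gradient L) x w⟫ + ⟪fderiv ℝ (linUnit A) x w, gradient L x⟫ :=
    fun w => fderiv_inner_apply ℝ dY dM w
  have hzero : fderiv ℝ L x (⟪linUnit A x, gradient L x⟫ • unitGrad L x -
      ‖gradient L x‖ • linUnit A x) = 0 := by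
    rw [← inner_gradient_left, inner_sub_right, inner_smul_right, inner_smul_right]
    nth_rewrite 2 [← hL.norm_mul_unitGrad hx]
    rw [inner_smul_left, real_inner_self_eq_norm_sq, hL.norm_unitGrad hx,
      real_inner_comm (gradient L x)]
    simp [mul_comm]
  unfold calib
  rw [divg_smul de.differentiableAt dV, divg_sub (dg.fun_smul dN) (dh.fun_smul dY), divg_smul dg dN,
    divg_smul dh dY, de.fderiv, hg, hL.fderiv_norm_gradient hx]
  simp only [_root_.smul_apply, _root_.neg_apply, hzero]
  have e1 : ⟪fderiv ℝ (linUnit A) x (unitGrad L x), gradient L x⟫ =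
      ‖gradient L x‖ * ⟪fderiv ℝ (linUnit A) x (unitGrad L x), unitGrad L x⟫ := by
    rw [← inner_smul_right, hL.norm_mul_unitGrad hx]
  have e2 : ⟪linUnit A x, fderiv ℝ (gradient L) x (unitGrad L x)⟫ =
      ⟪fderiv ℝ (gradient L) x (linUnit A x), unitGrad L x⟫ := by
    rw [real_inner_comm, hL.inner_fderiv_gradient_comm hx]
  rw [e1, e2]
  simp
  ring

lemma calib_smul (hL : LogGauge L) {A : Euc n →L[ℝ] Euc n} {s : ℝ} (hs : 0 < s)
    {x : Euc n} (hx : x ≠ 0) : calib L A (s • x) = s ^ (-((n : ℤ) - 1)) • calib L A x := by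
  have hY : linUnit A (s • x) = linUnit A x := by
    simp only [linUnit, map_smul, norm_smul, Real.norm_of_nonneg hs.le, mul_inv, smul_smul]
    congr 1
    field_simp
  have he : Real.exp (-((n - 2) * (L x + Real.log s))) * s⁻¹ =
      s ^ (-((n : ℤ) - 1)) * Real.exp (-((n - 2) * L x)) := by
    have h1 : s ^ (-((n : ℤ) - 1)) = Real.exp (-((n - 1) * Real.log s)) := by
      rw [← Real.rpow_intCast, Real.rpow_def_of_pos hs]
      push_cast
      ring_nf
    have h2 : s⁻¹ = Real.exp (- Real.log s) := by rw [Real.exp_neg, Real.exp_log hs]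
    rw [h1, h2, ← Real.exp_add, ← Real.exp_add]
    ring_nf
  simp only [calib, hY, hL.hom s hs x hx, hL.gradient_smul hs hx, hL.unitGrad_smul hs hx,
    inner_smul_right, norm_smul, norm_inv, Real.norm_of_nonneg hs.le]
  rw [smul_smul, ← he, mul_smul _ s⁻¹, smul_sub s⁻¹, smul_smul, smul_smul]

lemma Jfun_le (hL : LogGauge L) {B : Euc n →L[ℝ] Euc n} (hB : SymTr0 B) (hB2 : ‖B‖ ≤ 1 / 2)
    (θ : Sph n) (hp : ‖gradient (logRadius L) (θ : Euc n)‖ ≤ 1 / 4) :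
    Jfun n (logRadius L θ) θ (gradient (logRadius L) (θ : Euc n)) B +
      divg (calib L (ContinuousLinearMap.id ℝ (Euc n) + B)) (θ : Euc n) ≤
    Real.exp ((n - 2) * logRadius L θ) *
      (‖gradient L (θ : Euc n)‖ * max (divg (unitGrad L) (θ : Euc n)) 0) := by
  obtain ⟨A, hA⟩ : ∃ A, A = ContinuousLinearMap.id ℝ (Euc n) + B := ⟨_, rfl⟩
  have hAx : ∀ x, A x = x + B x := fun x => by rw [hA]; simp
  have hx := sph_ne_zero θ
  have hBθ : ‖B (θ : Euc n)‖ ≤ 1 / 2 := by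
    simpa [sph_norm] using B.le_of_opNorm_le hB2 (θ : Euc n)
  have hAθ : A (θ : Euc n) ≠ 0 := fun h => by
    rw [hAx] at h
    have h2 := sph_norm θ
    rw [eq_neg_of_add_eq_zero_left h, norm_neg] at h2
    linarith
  have hM := hL.gradient_sph θ
  have hAsym : ⟪A (A (θ : Euc n)), gradient L (θ : Euc n)⟫ =
      ⟪A (gradient L (θ : Euc n)), A (θ : Euc n)⟫ := by
    have h1 : ∀ x y, ⟪A x, y⟫ = ⟪x, A y⟫ := fun x y => by
      rw [hAx, hAx, inner_add_left, inner_add_right, hB.1]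
    rw [h1, real_inner_comm]
  have htr : LinearMap.trace ℝ (Euc n) A.toLinearMap = n := by
    rw [hA, ContinuousLinearMap.toLinearMap_add, map_add, hB.2]
    simp
  have hpos : 0 ≤ ⟪A (θ : Euc n), gradient L (θ : Euc n)⟫ := by
    rw [hAx, hM, inner_add_left, inner_sub_right, inner_sub_right, real_inner_self_eq_norm_sq,
      sph_norm]
    have h1 := abs_le.1 (abs_real_inner_le_norm (θ : Euc n) (gradient (logRadius L) (θ : Euc n)))
    have h2 := abs_le.1 (abs_real_inner_le_norm (B (θ : Euc n)) (θ : Euc n))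
    have h3 := abs_le.1 (abs_real_inner_le_norm (B (θ : Euc n))
      (gradient (logRadius L) (θ : Euc n)))
    have h4 : ‖B (θ : Euc n)‖ * ‖gradient (logRadius L) (θ : Euc n)‖ ≤ 1 / 2 * (1 / 4) := by gcongr
    rw [sph_norm] at h1 h2
    linarith
  have hle : ⟪linUnit A (θ : Euc n), gradient L (θ : Euc n)⟫ ≤ ‖gradient L (θ : Euc n)‖ := by
    refine (real_inner_le_norm _ _).trans (le_of_eq ?_)
    rw [linUnit, norm_smul, norm_inv, norm_norm, inv_mul_cancel₀ (norm_ne_zero_iff.2 hAθ), one_mul]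
  have hnn : 0 ≤ ⟪linUnit A (θ : Euc n), gradient L (θ : Euc n)⟫ := by
    rw [linUnit, inner_smul_left]
    exact mul_nonneg (inv_nonneg.2 (norm_nonneg _)) hpos
  have hmain : ⟪linUnit A (θ : Euc n), gradient L (θ : Euc n)⟫ * divg (unitGrad L) (θ : Euc n) ≤
      ‖gradient L (θ : Euc n)‖ * max (divg (unitGrad L) (θ : Euc n)) 0 :=
    (mul_le_mul_of_nonneg_left (le_max_left _ _) hnn).trans
      (mul_le_mul_of_nonneg_right hle (le_max_right _ _))
  refine le_trans (le_of_eq ?_) (mul_le_mul_of_nonneg_left hmain (Real.exp_pos _).le)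
  rw [← hA, hL.divg_calib hx hAθ, divg_linUnit A hAθ, htr, (hasFDerivAt_linUnit A hAθ).fderiv,
    Jfun, ← hAx, ← hAx, ← hM, ← hAx, logRadius_sph, hAsym]
  have hM0 := (hL.norm_gradient_pos hx).ne'
  have hA0 := norm_ne_zero_iff.2 hAθ
  simp only [unitGrad, _root_.add_apply, _root_.smul_apply, map_smul,
    ContinuousLinearMap.smulRight_apply, ContinuousLinearMap.comp_apply, innerSL_apply_apply,
    inner_add_left, inner_smul_left, inner_smul_right, conj_trivial, smul_eq_mul]
  rw [real_inner_comm (A (gradient L (θ : Euc n))) (A (θ : Euc n)), mul_neg]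
  field_simp
  ring

/-- The total positive part of the mean curvature dominates the integral of `Jfun`. -/
theorem integral_Jfun_le (hL : LogGauge L) (hn : 4 ≤ n) {B : Euc n →L[ℝ] Euc n} (hB : SymTr0 B)
    (hB2 : ‖B‖ ≤ 1 / 2) (hp : ∀ θ : Sph n, ‖gradient (logRadius L) (θ : Euc n)‖ ≤ 1 / 4) :
    ∫ θ : Sph n, Jfun n (logRadius L θ) θ (gradient (logRadius L) (θ : Euc n)) B ∂(sphMeas n) ≤
    ∫ θ : Sph n, Real.exp ((n - 2) * logRadius L θ) *
      (‖gradient L (θ : Euc n)‖ * max (divg (unitGrad L) (θ : Euc n)) 0) ∂(sphMeas n) := by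
  obtain ⟨A, hA⟩ : ∃ A, A = ContinuousLinearMap.id ℝ (Euc n) + B := ⟨_, rfl⟩
  have hAx : ∀ x, x ≠ 0 → A x ≠ 0 := fun x hx h => by
    have h1 : x + B x = 0 := by simpa [hA] using h
    have h2 : ‖B x‖ ≤ 1 / 2 * ‖x‖ := B.le_of_opNorm_le hB2 x
    rw [← norm_neg, ← eq_neg_of_add_eq_zero_left h1] at h2
    linarith [norm_pos_iff.2 hx]
  have hadm := hL.adm_logRadius
  have hcd : ∀ x, x ≠ 0 → ContDiffAt ℝ 1 (calib L A) x := fun x hx =>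
    hL.contDiffAt_calib hx (hAx x hx)
  have hz := integral_sphere_divg (n := n) (by omega)
    (fun s hs x hx => hL.calib_smul (A := A) hs hx) hcd
  have hz' : ∫ θ : Sph n, divg (calib L A) θ ∂(sphMeas n) = 0 := by
    rw [hz]; push_cast; ring
  have c1 : Continuous fun θ : Sph n => divg (calib L A) (θ : Euc n) := continuous_divg_sph hcd
  have c2 : Continuous fun θ : Sph n => divg (unitGrad L) (θ : Euc n) :=
    continuous_divg_sph fun x hx => hL.contDiffAt_unitGrad hx
  have c3 := continuous_Jfun hadm hB2
  have c4 : Continuous fun θ : Sph n => ‖gradient L (θ : Euc n)‖ :=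
    (continuous_gradient_sph fun x hx => (hL.smooth x hx).of_le (by norm_num)).norm
  have h := integral_mono ((sph_integrable c3).add (sph_integrable c1))
    (sph_integrable ((Real.continuous_exp.comp (continuous_const.mul hadm.continuous_sph)).mul
      (c4.mul (c2.max continuous_const))))
    (fun θ => by
      have := hL.Jfun_le hB hB2 θ (hp θ)
      rw [← hA] at this
      exact this)
  rw [integral_add' (sph_integrable c3) (sph_integrable c1), hz', add_zero] at h
  exact h

end LogGauge

end DivergenceIdentity

section StarShaped

open Filter Topology

/-- A function all of whose zeros past `a` are crossed upwards stays positive once positive. -/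
lemma pos_of_upcrossing {φ φ' : ℝ → ℝ} {a b : ℝ} (hd : ∀ t, HasDerivAt φ (φ' t) t)
    (hz : ∀ t, a < t → φ t = 0 → 0 < φ' t) (ha : 0 < φ a) (hab : a ≤ b) : 0 < φ b := by
  by_contra hb
  have hc : Continuous φ := continuous_iff_continuousAt.2 fun t => (hd t).continuousAt
  obtain ⟨S, hS⟩ : ∃ S, S = Icc a b ∩ {t | φ t ≤ 0} := ⟨_, rfl⟩
  have hSc : IsCompact S := by
    rw [hS]; exact isCompact_Icc.inter_right (isClosed_le hc continuous_const)
  have hSn : S.Nonempty := ⟨b, by rw [hS]; exact ⟨⟨hab, le_rfl⟩, not_lt.1 hb⟩⟩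
  obtain ⟨t, htS, htmin⟩ := hSc.exists_isLeast hSn
  have ht' := htS
  rw [hS] at ht'
  obtain ⟨⟨hat, htb⟩, ht0⟩ := ht'
  have ht0 : φ t ≤ 0 := ht0
  have hat' : a < t := lt_of_le_of_ne hat fun h => by rw [← h] at ht0; linarith
  have hbefore : ∀ s, a ≤ s → s < t → 0 < φ s := fun s has hst => by
    by_contra h
    have : s ∈ S := by rw [hS]; exact ⟨⟨has, by linarith⟩, not_lt.1 h⟩
    linarith [htmin this]
  have hge : 0 ≤ φ t := by
    have h1 : Tendsto φ (𝓝[<] t) (𝓝 (φ t)) := hc.continuousAt.mono_left nhdsWithin_le_nhds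
    refine ge_of_tendsto h1 ?_
    filter_upwards [Ioo_mem_nhdsLT hat'] with s hs
    exact (hbefore s hs.1.le hs.2).le
  have heq : φ t = 0 := le_antisymm ht0 hge
  have hpos := hz t hat' heq
  have h2 := (hd t).tendsto_slope
  have h3 : ∀ᶠ s in 𝓝[≠] t, 0 < slope φ t s := h2.eventually (lt_mem_nhds hpos)
  have h4 : ∀ᶠ s in 𝓝[<] t, 0 < slope φ t s := h3.filter_mono (nhdsWithin_mono t fun s hs => ne_of_lt hs)
  obtain ⟨s, hs1, hs2⟩ := (h4.and (Ioo_mem_nhdsLT hat')).exists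
  rw [slope_def_field, heq, sub_zero] at hs1
  have h5 := hbefore s hs2.1.le hs2.2
  have h6 : s - t < 0 := by linarith [hs2.2]
  have := div_neg_of_pos_of_neg h5 h6
  linarith

lemma pos_of_upcrossing' {φ φ' : ℝ → ℝ} {a b : ℝ} (hd : ∀ t, HasDerivAt φ (φ' t) t)
    (hz : ∀ t, 0 < t → φ t = 0 → 0 < φ' t) (ha0 : 0 < a) (ha : 0 ≤ φ a) (hab : a < b) :
    0 < φ b := by
  rcases ha.lt_or_eq with h | h
  · exact pos_of_upcrossing hd (fun t ht => hz t (ha0.trans ht)) h hab.le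
  · have h2 := (hd a).tendsto_slope
    have h3 : ∀ᶠ s in 𝓝[≠] a, 0 < slope φ a s := h2.eventually (lt_mem_nhds (hz a ha0 h.symm))
    have h4 : ∀ᶠ s in 𝓝[>] a, 0 < slope φ a s :=
      h3.filter_mono (nhdsWithin_mono a fun s hs => ne_of_gt hs)
    obtain ⟨s, hs1, hs2⟩ := (h4.and (Ioo_mem_nhdsGT hab)).exists
    rw [slope_def_field, ← h, sub_zero] at hs1
    have h5 : 0 < s - a := by linarith [hs2.1]
    have h6 : 0 < φ s := by
      have := mul_pos hs1 h5
      rwa [div_mul_cancel₀ _ h5.ne'] at this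
    exact pos_of_upcrossing hd (fun t ht => hz t (ha0.trans (hs2.1.trans ht))) h6 hs2.2.le

variable {n : ℕ}

/-- Defining function of a domain whose boundary normal is close to the radial direction. -/
structure NearRadial (G : Euc n → ℝ) (ε : ℝ) : Prop where
  smooth : ContDiff ℝ (⊤ : ℕ∞) G
  bounded : Bornology.IsBounded {x | G x ≤ 0}
  nonempty : ∃ x, G x < 0
  regular : ∀ x, G x = 0 → gradient G x ≠ 0
  near : ∀ x, G x = 0 → ‖unitGrad G x - ‖x‖⁻¹ • x‖ ≤ ε

namespace NearRadial

variable {G : Euc n → ℝ} {ε : ℝ}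

lemma norm_unitGrad (hG : NearRadial G ε) {x : Euc n} (hx : G x = 0) : ‖unitGrad G x‖ = 1 := by
  rw [unitGrad, norm_smul, norm_inv, norm_norm,
    inv_mul_cancel₀ (norm_ne_zero_iff.2 (hG.regular x hx))]

lemma ne_zero (hG : NearRadial G ε) (hε : ε < 1) {x : Euc n} (hx : G x = 0) : x ≠ 0 := by
  rintro rfl
  have h := hG.near 0 hx
  rw [smul_zero, sub_zero, hG.norm_unitGrad hx] at h
  linarith

lemma inner_pos (hG : NearRadial G ε) (hε : ε < 1) {x : Euc n} (hx : G x = 0) :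
    0 < ⟪gradient G x, x⟫ := by
  have hx0 := norm_pos_iff.2 (hG.ne_zero hε hx)
  have hg0 := norm_pos_iff.2 (hG.regular x hx)
  have h := hG.near x hx
  have h1 := norm_sub_sq_real (unitGrad G x) (‖x‖⁻¹ • x)
  have h2 : ‖‖x‖⁻¹ • x‖ = 1 := by rw [norm_smul, norm_inv, norm_norm, inv_mul_cancel₀ hx0.ne']
  rw [hG.norm_unitGrad hx, h2] at h1
  have h3 : 0 < ⟪unitGrad G x, ‖x‖⁻¹ • x⟫ := by
    have := norm_nonneg (unitGrad G x - ‖x‖⁻¹ • x)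
    nlinarith only [h1, h, hε, this]
  rw [unitGrad, inner_smul_left, inner_smul_right, conj_trivial] at h3
  have h4 := pos_of_mul_pos_right h3 (inv_pos.2 hg0).le
  exact pos_of_mul_pos_right h4 (inv_pos.2 hx0).le

lemma hasDerivAt_ray (hG : NearRadial G ε) (x : Euc n) (t : ℝ) :
    HasDerivAt (fun t : ℝ => G (t • x)) (⟪gradient G (t • x), x⟫) t := by
  have h2 : HasDerivAt (fun s : ℝ => s • x) x t := by
    simpa using (hasDerivAt_id t).smul_const x
  rw [inner_gradient_left]
  exact ((hG.smooth.differentiable (by simp)) (t • x)).hasFDerivAt.comp_hasDerivAt t h2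

lemma ray_deriv_pos (hG : NearRadial G ε) (hε : ε < 1) (x : Euc n) (t : ℝ) (ht : 0 < t)
    (h : G (t • x) = 0) : 0 < ⟪gradient G (t • x), x⟫ := by
  have := hG.inner_pos hε h
  rw [inner_smul_right] at this
  exact pos_of_mul_pos_right this ht.le

lemma exists_far (hG : NearRadial G ε) {x : Euc n} (hx : x ≠ 0) (T : ℝ) :
    ∃ t : ℝ, T < t ∧ 0 < t ∧ 0 < G (t • x) := by
  obtain ⟨R, hR⟩ := hG.bounded.exists_norm_le
  obtain ⟨t, ht⟩ : ∃ t, t = max (max T 0) (R / ‖x‖) + 1 := ⟨_, rfl⟩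
  have h1 : T ≤ max (max T 0) (R / ‖x‖) := (le_max_left _ _).trans (le_max_left _ _)
  have h2 : 0 ≤ max (max T 0) (R / ‖x‖) := (le_max_right _ _).trans (le_max_left _ _)
  have h3 : R / ‖x‖ ≤ max (max T 0) (R / ‖x‖) := le_max_right _ _
  have hx0 := norm_pos_iff.2 hx
  refine ⟨t, by linarith, by linarith, ?_⟩
  by_contra h
  have h4 := hR _ (not_lt.1 h)
  rw [norm_smul, Real.norm_of_nonneg (by linarith)] at h4
  have h5 : R / ‖x‖ < t := by linarith
  rw [div_lt_iff₀ hx0] at h5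
  linarith

lemma zero_neg (hG : NearRadial G ε) (hε : ε < 1) : G 0 < 0 := by
  rcases lt_trichotomy (G 0) 0 with h | h | h
  · exact h
  · exact absurd rfl (hG.ne_zero hε h)
  · obtain ⟨x, hx⟩ := hG.nonempty
    have h1 := pos_of_upcrossing (a := 0) (b := 1) (hG.hasDerivAt_ray x)
      (fun t ht => hG.ray_deriv_pos hε x t ht) (by simpa using h) zero_le_one
    simp only [one_smul] at h1
    linarith

lemma exists_zero (hG : NearRadial G ε) (hε : ε < 1) {x : Euc n} (hx : x ≠ 0) :
    ∃ t : ℝ, 0 < t ∧ G (t • x) = 0 := by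
  obtain ⟨T, -, hT0, hT⟩ := hG.exists_far hx 0
  have hc : Continuous fun t : ℝ => G (t • x) :=
    hG.smooth.continuous.comp (continuous_id.smul continuous_const)
  have h0 : G ((0 : ℝ) • x) < 0 := by rw [zero_smul]; exact hG.zero_neg hε
  obtain ⟨t, ht, hz⟩ := intermediate_value_Icc hT0.le hc.continuousOn ⟨h0.le, hT.le⟩
  refine ⟨t, lt_of_le_of_ne ht.1 ?_, hz⟩
  rintro rfl
  exact absurd hz h0.ne

lemma pos_of_lt (hG : NearRadial G ε) (hε : ε < 1) {x : Euc n} {s t : ℝ} (hs : 0 < s)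
    (h : 0 ≤ G (s • x)) (hst : s < t) : 0 < G (t • x) :=
  pos_of_upcrossing' (hG.hasDerivAt_ray x) (fun t ht => hG.ray_deriv_pos hε x t ht) hs h hst

open Classical in
/-- The logarithm of the gauge of the domain `{G < 0}`. -/
def _root_.logGauge (G : Euc n → ℝ) (x : Euc n) : ℝ :=
  if h : ∃ t : ℝ, 0 < t ∧ G (t • x) = 0 then -Real.log h.choose else 0

lemma logGauge_spec (hG : NearRadial G ε) (hε : ε < 1) {x : Euc n} (hx : x ≠ 0) :
    G (Real.exp (-logGauge G x) • x) = 0 := by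
  have h := hG.exists_zero hε hx
  rw [logGauge, dif_pos h, neg_neg, Real.exp_log h.choose_spec.1]
  exact h.choose_spec.2

lemma logGauge_eq (hG : NearRadial G ε) (hε : ε < 1) {x : Euc n} (hx : x ≠ 0) {t : ℝ} (ht : 0 < t)
    (h : G (t • x) = 0) : logGauge G x = -Real.log t := by
  have h1 := hG.logGauge_spec hε hx
  have hp := Real.exp_pos (-logGauge G x)
  have heq : Real.exp (-logGauge G x) = t := by
    rcases lt_trichotomy (Real.exp (-logGauge G x)) t with hlt | heq | hlt
    · exact absurd h (hG.pos_of_lt hε hp h1.ge hlt).ne'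
    · exact heq
    · exact absurd h1 (hG.pos_of_lt hε ht h.ge hlt).ne'
  rw [← heq, Real.log_exp, neg_neg]

lemma logGauge_eq_zero_iff (hG : NearRadial G ε) (hε : ε < 1) {x : Euc n} (hx : x ≠ 0) :
    logGauge G x = 0 ↔ G x = 0 := by
  refine ⟨fun h => ?_, fun h => ?_⟩
  · have := hG.logGauge_spec hε hx
    rwa [h, neg_zero, Real.exp_zero, one_smul] at this
  · rw [hG.logGauge_eq hε hx one_pos (by rwa [one_smul]), Real.log_one, neg_zero]

lemma logGauge_neg_iff (hG : NearRadial G ε) (hε : ε < 1) {x : Euc n} (hx : x ≠ 0) :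
    logGauge G x < 0 ↔ G x < 0 := by
  have h1 := hG.logGauge_spec hε hx
  have hp := Real.exp_pos (-logGauge G x)
  refine ⟨fun h => ?_, fun h => ?_⟩
  · by_contra hc
    have := hG.pos_of_lt hε one_pos (x := x) (by rw [one_smul]; exact not_lt.1 hc)
      (Real.one_lt_exp_iff.2 (neg_pos.2 h))
    exact absurd h1 this.ne'
  · by_contra hc
    rcases (not_lt.1 hc).lt_or_eq with h2 | h2
    · have := hG.pos_of_lt hε hp h1.ge (t := 1) (by rw [Real.exp_lt_one_iff]; linarith)
      rw [one_smul] at this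
      linarith
    · rw [(hG.logGauge_eq_zero_iff hε hx).1 h2.symm] at h
      exact lt_irrefl _ h

lemma contDiffAt_logGauge (hG : NearRadial G ε) (hε : ε < 1) {x : Euc n} (hx : x ≠ 0) :
    ContDiffAt ℝ 2 (logGauge G) x := by
  obtain ⟨t₀, ht₀⟩ : ∃ t₀, t₀ = Real.exp (-logGauge G x) := ⟨_, rfl⟩
  have h0 : 0 < t₀ := by rw [ht₀]; exact Real.exp_pos _
  have hz : G (t₀ • x) = 0 := by rw [ht₀]; exact hG.logGauge_spec hε hx
  have cdf : ContDiffAt ℝ 2 (fun p : Euc n × ℝ => G (p.2 • p.1)) (x, t₀) :=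
    ((hG.smooth.of_le (WithTop.coe_le_coe.2 (le_top : (2 : ℕ∞) ≤ ⊤))).comp
      (contDiff_snd.smul contDiff_fst)).contDiffAt
  have hder : (fderiv ℝ (fun p : Euc n × ℝ => G (p.2 • p.1)) (x, t₀) ∘L .inr ℝ (Euc n) ℝ) 1 ≠ 0 := by
    have h1 := (cdf.differentiableAt (by norm_num)).hasFDerivAt
    have h2 : HasDerivAt (fun t : ℝ => ((x, t) : Euc n × ℝ)) (0, 1) t₀ :=
      (hasDerivAt_const t₀ x).prodMk (hasDerivAt_id t₀)
    have h3 := (h1.comp_hasDerivAt t₀ h2).unique (hG.hasDerivAt_ray x t₀)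
    have h4 := hG.ray_deriv_pos hε x t₀ h0 hz
    rw [ContinuousLinearMap.comp_apply, ContinuousLinearMap.inr_apply, h3]
    exact h4.ne'
  have if₂ : (fderiv ℝ (fun p : Euc n × ℝ => G (p.2 • p.1)) (x, t₀) ∘L
      .inr ℝ (Euc n) ℝ).IsInvertible := by
    refine ⟨ContinuousLinearEquiv.unitsEquivAut ℝ (Units.mk0 _ hder), ?_⟩
    ext
    simp
  have hψ := cdf.contDiffAt_implicitFunction (by norm_num) if₂
  have hψ0 := cdf.implicitFunction_apply_self (by norm_num) if₂
  have hψz := cdf.eventually_apply_implicitFunction (by norm_num) if₂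
  generalize cdf.implicitFunction (by norm_num) if₂ = ψ at hψ hψ0 hψz
  have hψx : ContDiffAt ℝ 2 ψ x := hψ
  have hψ0 : ψ x = t₀ := hψ0
  have hψz : ∀ᶠ y in 𝓝 x, G (ψ y • y) = G (t₀ • x) := hψz
  have hev : logGauge G =ᶠ[𝓝 x] fun y => -Real.log (ψ y) := by
    have hpos : ∀ᶠ y in 𝓝 x, 0 < ψ y :=
      hψx.continuousAt.eventually (lt_mem_nhds (by rw [hψ0]; exact h0))
    filter_upwards [hψz, hpos, isOpen_ne.mem_nhds hx] with y h1 h2 h3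
    exact hG.logGauge_eq hε h3 h2 (h1.trans hz)
  exact (hψx.log (by rw [hψ0]; exact h0.ne')).neg.congr_of_eventuallyEq hev

/-- The gauge of a domain with nearly radial normal. -/
theorem logGauge (hG : NearRadial G ε) (hε : ε < 1) : LogGauge (logGauge G) := by
  refine ⟨fun s hs x hx => ?_, fun x hx => hG.contDiffAt_logGauge hε hx⟩
  have h1 := hG.logGauge_spec hε hx
  have hp := Real.exp_pos (-_root_.logGauge G x)
  rw [hG.logGauge_eq hε (smul_ne_zero hs.ne' hx) (t := Real.exp (-_root_.logGauge G x) / s)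
    (div_pos hp hs) (by rw [smul_smul, div_mul_cancel₀ _ hs.ne']; exact h1),
    Real.log_div hp.ne' hs.ne', Real.log_exp]
  ring

end NearRadial

end StarShaped

section NormalCurvature

open Filter Topology

variable {n : ℕ}

namespace LogGauge

variable {L : Euc n → ℝ}

lemma norm_gradient_sq (hL : LogGauge L) (θ : Sph n) :
    ‖gradient L (θ : Euc n)‖ ^ 2 = 1 + ‖gradient (logRadius L) (θ : Euc n)‖ ^ 2 := by
  rw [hL.gradient_sph, norm_sub_sq_real, sph_norm, real_inner_comm,
    hL.adm_logRadius.inner_self_gradient (sph_ne_zero θ)]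
  ring

lemma one_le_norm_gradient (hL : LogGauge L) (θ : Sph n) : 1 ≤ ‖gradient L (θ : Euc n)‖ := by
  have := hL.norm_gradient_sq θ
  nlinarith only [this, sq_nonneg ‖gradient (logRadius L) (θ : Euc n)‖,
    norm_nonneg (gradient L (θ : Euc n))]

lemma norm_unitGrad_sub_sq (hL : LogGauge L) (θ : Sph n) :
    ‖unitGrad L (θ : Euc n) - (θ : Euc n)‖ ^ 2 = 2 - 2 * ‖gradient L (θ : Euc n)‖⁻¹ := by
  rw [norm_sub_sq_real, hL.norm_unitGrad (sph_ne_zero θ), sph_norm, unitGrad, inner_smul_left,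
    hL.inner_gradient_self (sph_ne_zero θ)]
  simp
  ring

lemma norm_unitGrad_sub_sq_le (hL : LogGauge L) (θ : Sph n) :
    ‖unitGrad L (θ : Euc n) - (θ : Euc n)‖ ^ 2 ≤ ‖gradient (logRadius L) (θ : Euc n)‖ ^ 2 := by
  rw [hL.norm_unitGrad_sub_sq]
  have h1 := hL.norm_gradient_sq θ
  have h2 := hL.one_le_norm_gradient θ
  generalize ‖gradient L (θ : Euc n)‖ = m at *
  have h3 : m * m⁻¹ = 1 := mul_inv_cancel₀ (by linarith)
  have h4 : 0 < m⁻¹ := inv_pos.2 (by linarith)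
  nlinarith [sq_nonneg (m - 1)]

lemma norm_gradient_logRadius_le (hL : LogGauge L) (θ : Sph n) {ε : ℝ} (hε : ε ≤ 1 / 2)
    (h : ‖unitGrad L (θ : Euc n) - (θ : Euc n)‖ ≤ ε) :
    ‖gradient (logRadius L) (θ : Euc n)‖ ≤ 2 * ε := by
  have hε0 : 0 ≤ ε := (norm_nonneg _).trans h
  have h0 : ‖unitGrad L (θ : Euc n) - (θ : Euc n)‖ ^ 2 ≤ ε ^ 2 := by gcongr
  rw [hL.norm_unitGrad_sub_sq] at h0
  have h1 := hL.norm_gradient_sq θ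
  have h2 := hL.one_le_norm_gradient θ
  refine le_of_sq_le_sq ?_ (by positivity)
  generalize ‖gradient L (θ : Euc n)‖ = m at *
  have h3 : m * m⁻¹ = 1 := mul_inv_cancel₀ (by linarith)
  have h4 : 0 < m⁻¹ := inv_pos.2 (by linarith)
  obtain ⟨t, ht⟩ : ∃ t, t = ε ^ 2 := ⟨_, rfl⟩
  have ht0 : 0 ≤ t := by rw [ht]; positivity
  have ht1 : t ≤ 1 / 4 := by rw [ht]; nlinarith
  have h5 : m * (1 - t / 2) ≤ 1 := by
    calc m * (1 - t / 2) ≤ m * m⁻¹ := by gcongr; linarith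
      _ = 1 := h3
  have h6 : (m * (1 - t / 2)) ^ 2 ≤ 1 := by
    have : 0 ≤ m * (1 - t / 2) := mul_nonneg (by linarith) (by linarith)
    exact pow_le_one₀ this h5
  have h7 : 1 ≤ (1 - t / 2) ^ 2 * (1 + 4 * t) := by nlinarith [mul_nonneg ht0 ht0, mul_nonneg ht0 (mul_nonneg ht0 ht0)]
  have h8 : m ^ 2 ≤ 1 + 4 * t := by
    have h9 : m ^ 2 * 1 ≤ m ^ 2 * ((1 - t / 2) ^ 2 * (1 + 4 * t)) := by gcongr
    have h10 : (m * (1 - t / 2)) ^ 2 * (1 + 4 * t) ≤ 1 * (1 + 4 * t) := by gcongr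
    nlinarith only [h9, h10]
  rw [mul_pow, ← ht]
  linarith

end LogGauge

lemma hasFDerivAt_toBoundary {L : Euc n → ℝ} (hL : LogGauge L) {x : Euc n} (hx : x ≠ 0)
    (h0 : L x = 0) : HasFDerivAt (fun y => Real.exp (-L y) • y)
      (ContinuousLinearMap.id ℝ (Euc n) - (fderiv ℝ L x).smulRight x) x := by
  have h := (hL.differentiableAt hx).hasFDerivAt.fun_neg.exp.fun_smul (hasFDerivAt_id x)
  refine h.congr_fderiv ?_
  ext1 w
  simp [h0, sub_eq_add_neg]

lemma fderiv_apply_of_vanishing {V : Type*} [NormedAddCommGroup V] [NormedSpace ℝ V]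
    {L : Euc n → ℝ} (hL : LogGauge L) {f : Euc n → V}
    (hf0 : ∀ y, y ≠ 0 → f (Real.exp (-L y) • y) = 0) {x : Euc n} (hx : x ≠ 0) (h0 : L x = 0)
    (hf : DifferentiableAt ℝ f x) (w : Euc n) :
    fderiv ℝ f x w = fderiv ℝ L x w • fderiv ℝ f x x := by
  have h1 : HasFDerivAt f (fderiv ℝ f x) (Real.exp (-L x) • x) := by
    rw [h0, neg_zero, Real.exp_zero, one_smul]; exact hf.hasFDerivAt
  have h2 := HasFDerivAt.comp (f := fun y => Real.exp (-L y) • y) x h1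
    (hasFDerivAt_toBoundary hL hx h0)
  have h3 : HasFDerivAt (f ∘ fun y => Real.exp (-L y) • y) (0 : Euc n →L[ℝ] V) x := by
    refine (hasFDerivAt_const (0 : V) x).congr_of_eventuallyEq ?_
    filter_upwards [isOpen_ne.mem_nhds hx] with y hy
    exact hf0 y hy
  have h4 := congrArg (fun T : Euc n →L[ℝ] V => T w) (h2.unique h3)
  simp only [ContinuousLinearMap.comp_apply, _root_.sub_apply, ContinuousLinearMap.id_apply,
    ContinuousLinearMap.smulRight_apply, map_sub, map_smul, _root_.zero_apply, sub_eq_zero] at h4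
  exact h4

lemma contDiffAt_unitGrad_of_ne {G : Euc n → ℝ} (hs : ContDiff ℝ (⊤ : ℕ∞) G) {x : Euc n}
    (hx : gradient G x ≠ 0) : ContDiffAt ℝ 1 (unitGrad G) x := by
  have h1 : ContDiffAt ℝ 1 (gradient G) x :=
    contDiffAt_gradient (hs.contDiffAt.of_le (by
      rw [one_add_one_eq_two]; exact WithTop.coe_le_coe.2 (le_top : (2 : ℕ∞) ≤ ⊤)))
  exact ((h1.norm ℝ hx).inv (norm_ne_zero_iff.2 hx)).smul h1

lemma inner_fderiv_unitGrad {G : Euc n → ℝ} (hs : ContDiff ℝ (⊤ : ℕ∞) G) {x : Euc n}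
    (hx : gradient G x ≠ 0) (w : Euc n) : ⟪unitGrad G x, fderiv ℝ (unitGrad G) x w⟫ = 0 := by
  have hd := ((contDiffAt_unitGrad_of_ne hs hx).differentiableAt (by norm_num)).hasFDerivAt
  have h1 := hd.inner ℝ hd
  have hc : ContinuousAt (gradient G) x :=
    (contDiffAt_gradient (k := 0) (hs.contDiffAt.of_le (by
      rw [zero_add]; exact WithTop.coe_le_coe.2 (le_top : (1 : ℕ∞) ≤ ⊤)))).continuousAt
  have h2 : HasFDerivAt (fun y => ⟪unitGrad G y, unitGrad G y⟫) (0 : Euc n →L[ℝ] ℝ) x := by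
    refine (hasFDerivAt_const (1 : ℝ) x).congr_of_eventuallyEq ?_
    filter_upwards [hc.eventually (isOpen_ne.mem_nhds hx)] with y hy
    rw [real_inner_self_eq_norm_sq, unitGrad, norm_smul, norm_inv, norm_norm,
      inv_mul_cancel₀ (norm_ne_zero_iff.2 hy), one_pow]
  have h3 := congrArg (fun T : Euc n →L[ℝ] ℝ => T w) (h1.unique h2)
  simp [real_inner_comm] at h3
  exact h3

namespace NearRadial

variable {G : Euc n → ℝ} {ε : ℝ}

lemma unitGrad_eq (hG : NearRadial G ε) (hε : ε < 1) {x : Euc n} (h0 : G x = 0) :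
    unitGrad G x = unitGrad (_root_.logGauge G) x := by
  have hx := hG.ne_zero hε h0
  have hL := hG.logGauge hε
  have hL0 := (hG.logGauge_eq_zero_iff hε hx).2 h0
  have h1 := fderiv_apply_of_vanishing hL (fun y hy => hG.logGauge_spec hε hy) hx hL0
    (hG.smooth.differentiable (by simp) x)
  have hpos := hG.inner_pos hε h0
  have h2 : gradient G x = ⟪gradient G x, x⟫ • gradient (_root_.logGauge G) x := by
    refine ext_inner_right ℝ fun w => ?_
    rw [inner_smul_left, inner_gradient_left, inner_gradient_left, inner_gradient_left, h1 w,
      conj_trivial, smul_eq_mul, mul_comm]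
  generalize ⟪gradient G x, x⟫ = a at h2 hpos
  rw [unitGrad, unitGrad, h2, norm_smul, Real.norm_of_nonneg hpos.le, smul_smul, mul_inv]
  congr 1
  field_simp

lemma divg_unitGrad_eq (hG : NearRadial G ε) (hε : ε < 1) {x : Euc n} (h0 : G x = 0) :
    divg (unitGrad G) x = divg (unitGrad (_root_.logGauge G)) x := by
  have hx := hG.ne_zero hε h0
  have hL := hG.logGauge hε
  have hL0 := (hG.logGauge_eq_zero_iff hε hx).2 h0
  have hreg := hG.regular x h0
  have hd1 := (contDiffAt_unitGrad_of_ne hG.smooth hreg).differentiableAt (by norm_num)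
  have hd2 := (hL.contDiffAt_unitGrad hx).differentiableAt (by norm_num)
  have h1 := fderiv_apply_of_vanishing hL
    (f := fun y => unitGrad G y - unitGrad (_root_.logGauge G) y) (fun y hy => by
      rw [hG.unitGrad_eq hε (hG.logGauge_spec hε hy), sub_self]) hx hL0 (hd1.fun_sub hd2)
  obtain ⟨T, hT⟩ : ∃ T, T = fderiv ℝ (fun y => unitGrad G y - unitGrad (_root_.logGauge G) y) x :=
    ⟨_, rfl⟩
  have h2 : T = (fderiv ℝ (_root_.logGauge G) x).smulRight (T x) := by
    ext1 w
    rw [hT, h1 w]; rfl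
  have h3 : ⟪unitGrad (_root_.logGauge G) x, T x⟫ = 0 := by
    rw [hT, fderiv_fun_sub hd1 hd2, _root_.sub_apply, inner_sub_right,
      ← hG.unitGrad_eq hε h0, inner_fderiv_unitGrad hG.smooth hreg, hG.unitGrad_eq hε h0,
      real_inner_comm, hL.fderiv_inner_unitGrad hx, sub_zero]
  have h4 : LinearMap.trace ℝ (Euc n) T.toLinearMap = 0 := by
    rw [h2, trace_smulRight', ← inner_gradient_left, ← hL.norm_mul_unitGrad hx, inner_smul_left, h3,
      mul_zero]
  have h5 := divg_sub hd1 hd2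
  rw [divg, ← hT, h4] at h5
  linarith

lemma norm_gradient_logRadius_le (hG : NearRadial G ε) (hε : ε ≤ 1 / 2) (θ : Sph n) :
    ‖gradient (logRadius (_root_.logGauge G)) (θ : Euc n)‖ ≤ 2 * ε := by
  have hε1 : ε < 1 := by linarith
  have hL := hG.logGauge hε1
  have hx := sph_ne_zero θ
  refine hL.norm_gradient_logRadius_le θ hε ?_
  have h1 := hG.logGauge_spec hε1 hx
  have hp := Real.exp_pos (-_root_.logGauge G (θ : Euc n))
  have h2 := hG.near _ h1
  rwa [hG.unitGrad_eq hε1 h1, hL.unitGrad_smul hp hx, norm_smul, sph_norm,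
    Real.norm_of_nonneg hp.le, mul_one, smul_smul, inv_mul_cancel₀ hp.ne', one_smul] at h2

end NearRadial

namespace SmoothBody

variable (K : SmoothBody n)

lemma gradient_translate (c x : Euc n) :
    gradient (fun y => K.F (c + y)) x = gradient K.F (c + x) := by
  simp only [gradient, fderiv_comp_add_left]

lemma normal_eq_unitGrad (c x : Euc n) :
    K.normal (c + x) = unitGrad (fun y => K.F (c + y)) x := by
  rw [normal, unitGrad, gradient_translate]

lemma meanCurv_eq_divg (c x : Euc n) :
    K.meanCurv (c + x) = divg (unitGrad fun y => K.F (c + y)) x := by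
  have h : (unitGrad fun y => K.F (c + y)) = fun y => K.normal (c + y) :=
    funext fun y => (K.normal_eq_unitGrad c y).symm
  rw [h, meanCurv, divg, divg, fderiv_comp_add_left]

lemma nearRadial {c : Euc n} {ε : ℝ}
    (h : ∀ x ∈ K.bdry, ‖K.normal x - ‖x - c‖⁻¹ • (x - c)‖ ≤ ε) :
    NearRadial (fun y => K.F (c + y)) ε := by
  refine ⟨K.smooth.comp (contDiff_const.add contDiff_id), ?_, ?_, fun x hx => ?_, fun x hx => ?_⟩
  · obtain ⟨R, hR⟩ := K.bounded.exists_norm_le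
    refine (isBounded_iff_forall_norm_le).2 ⟨R + ‖c‖, fun x hx => ?_⟩
    have h1 := hR (c + x) hx
    calc ‖x‖ = ‖(c + x) - c‖ := by rw [add_sub_cancel_left]
      _ ≤ ‖c + x‖ + ‖c‖ := norm_sub_le _ _
      _ ≤ R + ‖c‖ := by linarith
  · obtain ⟨x, hx⟩ := K.connected.nonempty
    exact ⟨x - c, by simpa using hx⟩
  · rw [gradient_translate]
    exact K.regular _ hx
  · have := h (c + x) hx
    rwa [normal_eq_unitGrad, add_sub_cancel_left] at this

end SmoothBody

end NormalCurvature

section FlatArea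

open Filter Topology
open scoped Pointwise

variable {n : ℕ}

/-- The open truncated cone over `A`, between the origin and the hyperplane `⟪x, ν⟫ = 1`. -/
def flatCone (ν : Euc n) (A : Set (Sph n)) : Set (Sph n × Ioi (0 : ℝ)) :=
  {z | z.1 ∈ A ∧ (z.2 : ℝ) < ⟪(z.1 : Euc n), ν⟫⁻¹}

lemma measurable_inner_inv (ν : Euc n) : Measurable fun θ : Sph n => ⟪(θ : Euc n), ν⟫⁻¹ :=
  (continuous_subtype_val.inner continuous_const).measurable.inv

lemma measurableSet_flatCone (ν : Euc n) {A : Set (Sph n)} (hA : MeasurableSet A) :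
    MeasurableSet (flatCone ν A) :=
  (measurable_fst hA).inter (measurableSet_lt (measurable_subtype_coe.comp measurable_snd)
    ((measurable_inner_inv ν).comp measurable_fst))

/-- The subset of the ambient space corresponding to a set of polar coordinates. -/
def polarImage (C : Set (Sph n × Ioi (0 : ℝ))) : Set (Euc n) :=
  Subtype.val '' (homeomorphUnitSphereProd (Euc n) ⁻¹' C)

lemma mem_polarImage {C : Set (Sph n × Ioi (0 : ℝ))} {x : Euc n} :
    x ∈ polarImage C ↔ ∃ z ∈ C, x = (z.2 : ℝ) • (z.1 : Euc n) := by
  constructor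
  · rintro ⟨y, hy, rfl⟩
    refine ⟨_, hy, ?_⟩
    have hx : ‖(y : Euc n)‖ ≠ 0 := norm_ne_zero_iff.2 y.2
    simp [smul_smul, hx]
  · rintro ⟨z, hz, rfl⟩
    refine ⟨(homeomorphUnitSphereProd (Euc n)).symm z, by simpa using hz, ?_⟩
    simp

lemma measurableSet_polarImage {C : Set (Sph n × Ioi (0 : ℝ))} (hC : MeasurableSet C) :
    MeasurableSet (polarImage C) :=
  (MeasurableEmbedding.subtype_coe (measurableSet_singleton _).compl).measurableSet_image.2
    ((homeomorphUnitSphereProd (Euc n)).measurable hC)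

lemma volume_polarImage {C : Set (Sph n × Ioi (0 : ℝ))} (hC : MeasurableSet C) :
    volume (polarImage C) = ((sphMeas n).prod (.volumeIoiPow (n - 1))) C := by
  rw [← (measurePreserving_polar n).measure_preimage hC.nullMeasurableSet,
    (MeasurableEmbedding.subtype_coe (measurableSet_singleton _).compl).comap_apply]
  rfl

lemma volume_flatCone (hn : 0 < n) (ν : Euc n) {A : Set (Sph n)} (hA : MeasurableSet A)
    (hpos : ∀ θ ∈ A, 0 < ⟪(θ : Euc n), ν⟫) :
    volume (polarImage (flatCone ν A)) =
      ENNReal.ofReal (n : ℝ)⁻¹ * ∫⁻ θ in A, ENNReal.ofReal (⟪(θ : Euc n), ν⟫⁻¹ ^ n) ∂(sphMeas n) := by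
  have hC := measurableSet_flatCone ν hA
  rw [volume_polarImage hC, Measure.prod_apply hC, ← lintegral_const_mul _
    ((measurable_inner_inv ν).pow_const n).ennreal_ofReal, ← lintegral_indicator hA]
  refine lintegral_congr fun θ => ?_
  by_cases hθ : θ ∈ A
  · rw [indicator_of_mem hθ]
    have h1 : Prod.mk θ ⁻¹' flatCone ν A = Iio ⟨⟪(θ : Euc n), ν⟫⁻¹, inv_pos.2 (hpos θ hθ)⟩ := by
      ext s
      simp [flatCone, hθ, ← Subtype.coe_lt_coe]
    rw [h1, Measure.volumeIoiPow_apply_Iio, ← ENNReal.ofReal_mul (by positivity)]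
    obtain ⟨k, rfl⟩ : ∃ k, n = k + 1 := ⟨n - 1, by omega⟩
    congr 1
    simp only [Nat.add_sub_cancel]
    push_cast
    ring
  · rw [indicator_of_notMem hθ]
    have h1 : Prod.mk θ ⁻¹' flatCone ν A = ∅ := by
      ext s
      simp [flatCone, hθ]
    rw [h1, measure_empty]

lemma mem_mk'_iff {ν x : Euc n} (hν : ‖ν‖ = 1) (s : ℝ) :
    x ∈ AffineSubspace.mk' (s • ν +ᵥ (0 : Euc n)) (ℝ ∙ ν)ᗮ ↔ ⟪x, ν⟫ = s := by
  rw [AffineSubspace.mem_mk', Submodule.mem_orthogonal_singleton_iff_inner_left]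
  simp only [vadd_eq_add, add_zero, vsub_eq_sub, inner_sub_left, inner_smul_left,
    real_inner_self_eq_norm_sq, hν]
  simp [sub_eq_zero]

/-- The `(n-1)`-dimensional area of a central projection to a hyperplane. -/
theorem flat_area (hn : 2 ≤ n) {ν : Euc n} (hν : ‖ν‖ = 1) {A : Set (Sph n)} (hA : MeasurableSet A)
    (hpos : ∀ θ ∈ A, 0 < ⟪(θ : Euc n), ν⟫) :
    Measure.euclideanHausdorffMeasure (n - 1)
      ((fun θ : Sph n => ⟪(θ : Euc n), ν⟫⁻¹ • (θ : Euc n)) '' A) =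
    ∫⁻ θ in A, ENNReal.ofReal (⟪(θ : Euc n), ν⟫⁻¹ ^ n) ∂(sphMeas n) := by
  have hC := measurableSet_flatCone ν hA
  have hν0 : ν ≠ 0 := by rintro rfl; simp at hν
  obtain ⟨D, hD⟩ : ∃ D, D = (fun θ : Sph n => ⟪(θ : Euc n), ν⟫⁻¹ • (θ : Euc n)) '' A := ⟨_, rfl⟩
  rw [← hD]
  have h := EuclideanGeometry.euclideanHausdorffMeasure_eq_lintegral (0 : Euc n) hν0
    (measurableSet_polarImage hC)
  rw [InnerProductSpace.euclideanHausdorffMeasure_eq_volume, volume_flatCone (by omega) ν hA hpos,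
    finrank_euclideanSpace, Fintype.card_fin, ← ofReal_norm, hν, ENNReal.ofReal_one, one_mul] at h
  have hslice : ∀ s : ℝ, Measure.euclideanHausdorffMeasure (n - 1)
      (polarImage (flatCone ν A) ∩ (AffineSubspace.mk' (s • ν +ᵥ (0 : Euc n)) (ℝ ∙ ν)ᗮ : Set (Euc n))) =
      (Ioo (0 : ℝ) 1).indicator (fun s => ENNReal.ofReal (s ^ (n - 1)) *
        Measure.euclideanHausdorffMeasure (n - 1) D) s := by
    intro s
    by_cases hs : s ∈ Ioo (0 : ℝ) 1
    · rw [indicator_of_mem hs]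
      have h1 : polarImage (flatCone ν A) ∩
          (AffineSubspace.mk' (s • ν +ᵥ (0 : Euc n)) (ℝ ∙ ν)ᗮ : Set (Euc n)) = s • D := by
        ext x
        rw [mem_inter_iff, mem_polarImage, SetLike.mem_coe, mem_mk'_iff hν, mem_smul_set, hD]
        constructor
        · rintro ⟨⟨z, ⟨hzA, hz⟩, rfl⟩, hx⟩
          refine ⟨_, ⟨z.1, hzA, rfl⟩, ?_⟩
          rw [inner_smul_left, conj_trivial] at hx
          have := hpos _ hzA
          rw [← hx, smul_smul]
          congr 1
          field_simp
        · rintro ⟨_, ⟨θ, hθ, rfl⟩, rfl⟩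
          have hp := hpos _ hθ
          refine ⟨⟨(θ, ⟨s * ⟪(θ : Euc n), ν⟫⁻¹, mul_pos hs.1 (inv_pos.2 hp)⟩), ⟨hθ, ?_⟩, ?_⟩, ?_⟩
          · show s * ⟪(θ : Euc n), ν⟫⁻¹ < ⟪(θ : Euc n), ν⟫⁻¹
            have := inv_pos.2 hp
            nlinarith [hs.2]
          · simp only [smul_smul]
          · simp only [inner_smul_left, conj_trivial]
            field_simp
      rw [h1, Measure.euclideanHausdorffMeasure_smul₀ _ hs.1.ne']
      rw [ENNReal.smul_def, smul_eq_mul]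
      congr 1
      rw [ENNReal.ofReal, ENNReal.coe_inj, Real.toNNReal_pow hs.1.le, Real.toNNReal_eq_nnnorm_of_nonneg hs.1.le]
    · rw [indicator_of_notMem hs]
      have h1 : polarImage (flatCone ν A) ∩
          (AffineSubspace.mk' (s • ν +ᵥ (0 : Euc n)) (ℝ ∙ ν)ᗮ : Set (Euc n)) = ∅ := by
        rw [eq_empty_iff_forall_notMem]
        intro x
        rw [mem_inter_iff, mem_polarImage, SetLike.mem_coe, mem_mk'_iff hν]
        rintro ⟨⟨z, ⟨hzA, hz⟩, rfl⟩, hx⟩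
        rw [inner_smul_left, conj_trivial] at hx
        have hp := hpos _ hzA
        refine hs ⟨?_, ?_⟩
        · rw [← hx]; exact mul_pos z.2.2 hp
        · rw [← hx]
          calc (z.2 : ℝ) * ⟪(z.1 : Euc n), ν⟫ < ⟪(z.1 : Euc n), ν⟫⁻¹ * ⟪(z.1 : Euc n), ν⟫ := by gcongr
            _ = 1 := inv_mul_cancel₀ hp.ne'
      rw [h1, measure_empty]
  rw [lintegral_congr hslice, lintegral_indicator measurableSet_Ioo, lintegral_mul_const _
    (by fun_prop)] at h
  have hpow : ∫⁻ s in Ioo (0 : ℝ) 1, ENNReal.ofReal (s ^ (n - 1)) = ENNReal.ofReal (n : ℝ)⁻¹ := by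
    rw [← ofReal_integral_eq_lintegral_ofReal, ← integral_Ioc_eq_integral_Ioo,
      ← intervalIntegral.integral_of_le zero_le_one, integral_pow]
    · obtain ⟨k, rfl⟩ : ∃ k, n = k + 1 := ⟨n - 1, by omega⟩
      simp
    · exact ((continuous_pow (n - 1)).integrableOn_Icc).mono_set Ioo_subset_Icc_self
    · filter_upwards [ae_restrict_mem measurableSet_Ioo] with s hs
      exact pow_nonneg hs.1.le _
  rw [hpow] at h
  have hn0 : ENNReal.ofReal (n : ℝ)⁻¹ ≠ 0 := by
    rw [Ne, ENNReal.ofReal_eq_zero, not_le]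
    exact inv_pos.2 (by exact_mod_cast (by omega : 0 < n))
  exact ((ENNReal.mul_right_inj hn0 ENNReal.ofReal_ne_top).1 h).symm

end FlatArea

section AreaFormula

open Filter Topology
open scoped Pointwise NNReal

variable {n : ℕ}

/-- A local comparison between measures is a global comparison. -/
lemma measure_le_of_locally_le {X : Type*} [TopologicalSpace X] [SecondCountableTopology X]
    [MeasurableSpace X] [BorelSpace X] {μ ν : Measure X}
    (h : ∀ x, ∃ U ∈ 𝓝 x, ∀ A, MeasurableSet A → A ⊆ U → μ A ≤ ν A) : μ ≤ ν := by
  rcases isEmpty_or_nonempty X with hX | hX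
  · exact Measure.le_iff.2 fun A _ => by simp [Set.eq_empty_of_isEmpty A]
  choose U hU hle using h
  obtain ⟨s, hs, hcov⟩ := TopologicalSpace.countable_cover_nhds
    (f := fun x => interior (U x)) fun x => interior_mem_nhds.2 (hU x)
  have hne : s.Nonempty := by
    rw [nonempty_iff_ne_empty]
    rintro rfl
    simp at hcov
    exact empty_ne_univ hcov
  obtain ⟨e, rfl⟩ := hs.exists_eq_range hne
  have hcov' : ⋃ k, disjointed (fun k => interior (U (e k))) k = univ := by
    rw [iUnion_disjointed, ← hcov, biUnion_range]
  have hm : ∀ k, MeasurableSet (disjointed (fun k => interior (U (e k))) k) :=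
    fun k => MeasurableSet.disjointed (fun k => isOpen_interior.measurableSet) k
  refine Measure.le_iff.2 fun A hA => ?_
  have hdec : ∀ ρ : Measure X, ρ A = ∑' k, ρ (disjointed (fun k => interior (U (e k))) k ∩ A) := by
    intro ρ
    rw [← measure_iUnion, ← iUnion_inter, hcov', univ_inter]
    · exact fun i j hij => ((disjoint_disjointed _) hij).mono inter_subset_left inter_subset_left
    · exact fun k => (hm k).inter hA
  rw [hdec μ, hdec ν]
  refine ENNReal.tsum_le_tsum fun k => hle (e k) _ ((hm k).inter hA) ?_
  exact inter_subset_left.trans ((disjointed_subset _ k).trans interior_subset)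

lemma lipschitzOnWith_area_image_le {X Y : Type*} [MetricSpace X] [MeasurableSpace X] [BorelSpace X]
    [MetricSpace Y] [MeasurableSpace Y] [BorelSpace Y] {C : ℝ≥0} {f : X → Y} {s : Set X}
    (h : LipschitzOnWith C f s) (m : ℕ) :
    (Measure.euclideanHausdorffMeasure m : Measure Y) (f '' s) ≤
      (C : ℝ≥0∞) ^ m * (Measure.euclideanHausdorffMeasure m : Measure X) s := by
  have h1 := h.hausdorffMeasure_image_le (d := m) (Nat.cast_nonneg m)
  rw [ENNReal.rpow_natCast] at h1
  simp only [Measure.euclideanHausdorffMeasure_def, Measure.smul_apply, ENNReal.smul_def,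
    smul_eq_mul]
  rw [mul_left_comm]
  gcongr

/-- The radial parametrization of the boundary of the star body `{L < 0}`. -/
def radialMap (L : Euc n → ℝ) (θ : Sph n) : Euc n := Real.exp (-L θ) • (θ : Euc n)

/-- The area density of the radial parametrization. -/
def areaDensity (L : Euc n → ℝ) (θ : Sph n) : ℝ :=
  Real.exp (-L θ) ^ (n - 1) * ‖gradient L (θ : Euc n)‖

namespace LogGauge

variable {L : Euc n → ℝ}

lemma radialMap_ne_zero (θ : Sph n) : radialMap L θ ≠ 0 :=
  smul_ne_zero (Real.exp_pos _).ne' (sph_ne_zero θ)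

lemma apply_radialMap (hL : LogGauge L) (θ : Sph n) : L (radialMap L θ) = 0 := by
  rw [radialMap, hL.hom _ (Real.exp_pos _) _ (sph_ne_zero θ), Real.log_exp]
  ring

lemma continuous_radialMap (hL : LogGauge L) : Continuous (radialMap L) :=
  (Real.continuous_exp.comp (continuous_sph fun x hx => (hL.smooth x hx).of_le (by norm_num)).neg).smul
    continuous_subtype_val

lemma norm_radialMap (θ : Sph n) : ‖radialMap L θ‖ = Real.exp (-L θ) := by
  rw [radialMap, norm_smul, sph_norm, mul_one, Real.norm_of_nonneg (Real.exp_pos _).le]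

lemma normalize_radialMap (θ : Sph n) : ‖radialMap L θ‖⁻¹ • radialMap L θ = (θ : Euc n) := by
  rw [norm_radialMap, radialMap, smul_smul, inv_mul_cancel₀ (Real.exp_pos _).ne', one_smul]

lemma injective_radialMap : Function.Injective (radialMap L) := fun θ θ' h => by
  apply Subtype.ext
  rw [← normalize_radialMap (L := L) θ, ← normalize_radialMap (L := L) θ', h]

lemma measurableEmbedding_radialMap (hL : LogGauge L) : MeasurableEmbedding (radialMap L) :=
  hL.continuous_radialMap.measurableEmbedding injective_radialMap

lemma range_radialMap (hL : LogGauge L) : range (radialMap L) = {x | x ≠ 0 ∧ L x = 0} := by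
  ext x
  constructor
  · rintro ⟨θ, rfl⟩
    exact ⟨radialMap_ne_zero θ, hL.apply_radialMap θ⟩
  · rintro ⟨hx, h0⟩
    have hp := norm_pos_iff.2 hx
    refine ⟨⟨‖x‖⁻¹ • x, by simp [norm_smul, hp.ne']⟩, ?_⟩
    rw [radialMap, hL.hom _ (inv_pos.2 hp) _ hx, h0, Real.log_inv, zero_add, neg_neg,
      Real.exp_log hp, smul_smul, mul_inv_cancel₀ hp.ne', one_smul]

lemma continuous_areaDensity (hL : LogGauge L) : Continuous (areaDensity L) := by
  have h : ∀ x, x ≠ 0 → ContDiffAt ℝ 1 L x := fun x hx => (hL.smooth x hx).of_le (by norm_num)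
  exact ((Real.continuous_exp.comp (continuous_sph h).neg).pow _).mul (continuous_gradient_sph h).norm

lemma areaDensity_pos (hL : LogGauge L) (θ : Sph n) : 0 < areaDensity L θ :=
  mul_pos (pow_pos (Real.exp_pos _) _) (hL.norm_gradient_pos (sph_ne_zero θ))

lemma inner_unitGrad_self (hL : LogGauge L) {x : Euc n} (hx : x ≠ 0) :
    ⟪x, unitGrad L x⟫ = ‖gradient L x‖⁻¹ := by
  rw [unitGrad, inner_smul_right, real_inner_comm, hL.inner_gradient_self hx, mul_one]

/-- The level set of a gauge is nearly isometric to its projection to a tangent hyperplane. -/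
lemma exists_nhds_projection (hL : LogGauge L) {x₀ : Euc n} (hx : x₀ ≠ 0) {η : ℝ≥0} (hη : 0 < η) :
    ∃ N ∈ 𝓝 x₀, ∀ x ∈ N, ∀ y ∈ N, L x = 0 → L y = 0 →
      ‖((⟪x₀, unitGrad L x₀⟫ * ⟪x, unitGrad L x₀⟫⁻¹) • x - (⟪x₀, unitGrad L x₀⟫ * ⟪y, unitGrad L x₀⟫⁻¹) • y) - (x - y)‖ ≤
        η * ‖x - y‖ := by
  have hg := hL.norm_gradient_pos hx
  have hin := hL.inner_unitGrad_self hx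
  have hpos : 0 < ⟪x₀, unitGrad L x₀⟫ := by rw [hin]; exact inv_pos.2 hg
  obtain ⟨R, hR⟩ : ∃ R : Euc n → Euc n, R = fun x =>
      (⟪x₀, unitGrad L x₀⟫ * ⟪x, unitGrad L x₀⟫⁻¹) • x - x + L x • x₀ := ⟨_, rfl⟩
  have hi : ContDiffAt ℝ 1 (fun x : Euc n => ⟪x, unitGrad L x₀⟫) x₀ :=
    contDiffAt_id.inner ℝ contDiffAt_const
  have hc : ContDiffAt ℝ 1 R x₀ := by
    rw [hR]
    exact (((contDiffAt_const.mul (hi.inv hpos.ne')).smul contDiffAt_id).sub contDiffAt_id).add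
      (((hL.smooth x₀ hx).of_le (by norm_num)).smul contDiffAt_const)
  have hd : HasFDerivAt R (0 : Euc n →L[ℝ] Euc n) x₀ := by
    have h1 : HasFDerivAt (fun x : Euc n => ⟪x, unitGrad L x₀⟫) (innerSL ℝ (unitGrad L x₀)) x₀ := by
      refine (innerSL ℝ (unitGrad L x₀)).hasFDerivAt.congr_of_eventuallyEq (.of_forall fun x => ?_)
      simp [real_inner_comm]
    have h2 := (((hasDerivAt_inv hpos.ne').comp_hasFDerivAt x₀ h1).const_mul
      ⟪x₀, unitGrad L x₀⟫).fun_smul (hasFDerivAt_id x₀)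
    have h3 := (h2.fun_sub (hasFDerivAt_id x₀)).fun_add
      ((hL.differentiableAt hx).hasFDerivAt.smul_const x₀)
    rw [hR]
    refine h3.congr_fderiv ?_
    ext1 w
    have h4 : fderiv ℝ L x₀ w = ⟪x₀, unitGrad L x₀⟫⁻¹ * ⟪unitGrad L x₀, w⟫ := by
      rw [← inner_gradient_left, hin, inv_inv, unitGrad, inner_smul_left, conj_trivial,
        mul_inv_cancel_left₀ hg.ne']
    simp [h4, mul_inv_cancel₀ hpos.ne', smul_smul]
    rw [← neg_smul, ← add_smul]
    convert zero_smul ℝ x₀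
    field_simp
    ring
  have hs : HasStrictFDerivAt R (0 : Euc n →L[ℝ] Euc n) x₀ := by
    rw [← hd.fderiv]
    exact hc.hasStrictFDerivAt (by norm_num)
  obtain ⟨N, hN, hlip⟩ := hs.exists_lipschitzOnWith_of_nnnorm_lt η (by simpa using hη)
  refine ⟨N, hN, fun x hxN y hyN hx0 hy0 => ?_⟩
  have := hlip.norm_sub_le hxN hyN
  rw [hR] at this
  simp only [hx0, hy0, zero_smul, add_zero] at this
  rwa [sub_sub_sub_comm] at this

/-- The area of the radial image is locally comparable to the integral of the density. -/
lemma exists_nhds_area (hL : LogGauge L) (hn : 2 ≤ n) (θ₀ : Sph n) {r : ℝ≥0} (hr : 1 < r) :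
    ∃ U ∈ 𝓝 θ₀, ∀ A, MeasurableSet A → A ⊆ U →
      Measure.euclideanHausdorffMeasure (n - 1) (radialMap L '' A) ≤
        (r : ℝ≥0∞) ^ n * ∫⁻ θ in A, ENNReal.ofReal (areaDensity L θ) ∂(sphMeas n) ∧
      ∫⁻ θ in A, ENNReal.ofReal (areaDensity L θ) ∂(sphMeas n) ≤
        (r : ℝ≥0∞) ^ n * Measure.euclideanHausdorffMeasure (n - 1) (radialMap L '' A) := by
  have hr0 : (0 : ℝ) < r := zero_lt_one.trans (by exact_mod_cast hr)
  have hr1 : (1 : ℝ) < r := by exact_mod_cast hr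
  have hx := radialMap_ne_zero (L := L) θ₀
  have hθ0 := sph_ne_zero θ₀
  obtain ⟨ν, hνd⟩ : ∃ ν, ν = unitGrad L (radialMap L θ₀) := ⟨_, rfl⟩
  have hν : ν = unitGrad L (θ₀ : Euc n) := by
    rw [hνd, radialMap, hL.unitGrad_smul (Real.exp_pos _) hθ0]
  have hν1 : ‖ν‖ = 1 := by rw [hν, hL.norm_unitGrad hθ0]
  obtain ⟨h, hh⟩ : ∃ h, h = ⟪radialMap L θ₀, ν⟫ := ⟨_, rfl⟩
  have hg := hL.norm_gradient_pos hθ0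
  have hin : ⟪(θ₀ : Euc n), ν⟫ = ‖gradient L (θ₀ : Euc n)‖⁻¹ := by
    rw [hν, hL.inner_unitGrad_self hθ0]
  have hin0 : 0 < ⟪(θ₀ : Euc n), ν⟫ := by rw [hin]; exact inv_pos.2 hg
  have hh' : h = Real.exp (-L θ₀) * ⟪(θ₀ : Euc n), ν⟫ := by
    rw [hh, radialMap, inner_smul_left, conj_trivial]
  have hh0 : 0 < h := by rw [hh']; exact mul_pos (Real.exp_pos _) hin0
  have hη : (0 : ℝ≥0) < 1 - r⁻¹ := tsub_pos_of_lt (inv_lt_one_of_one_lt₀ hr)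
  have hηr : ((1 - r⁻¹ : ℝ≥0) : ℝ) = 1 - (r : ℝ)⁻¹ := by
    rw [NNReal.coe_sub (inv_le_one_of_one_le₀ hr.le)]; simp
  obtain ⟨N, hN, hproj⟩ := hL.exists_nhds_projection hx hη
  rw [← hνd, ← hh, hηr] at hproj
  have hcin : Continuous fun θ : Sph n => ⟪(θ : Euc n), ν⟫ :=
    continuous_subtype_val.inner continuous_const
  have hcd : ContinuousAt (fun θ : Sph n => h ^ (n - 1) * ⟪(θ : Euc n), ν⟫⁻¹ ^ n) θ₀ :=
    continuousAt_const.mul ((hcin.continuousAt.inv₀ hin0.ne').pow n)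
  have hval : h ^ (n - 1) * ⟪(θ₀ : Euc n), ν⟫⁻¹ ^ n = areaDensity L θ₀ := by
    rw [hh', hin, areaDensity, mul_pow, inv_inv]
    obtain ⟨k, rfl⟩ : ∃ k, n = k + 1 := ⟨n - 1, by omega⟩
    rw [Nat.add_sub_cancel, pow_succ ‖gradient L (θ₀ : Euc (k + 1))‖, inv_pow]
    have := pow_pos hg k
    field_simp
  have hd0 := hL.areaDensity_pos θ₀
  have hev1 : ∀ᶠ θ : Sph n in 𝓝 θ₀, h ^ (n - 1) * ⟪(θ : Euc n), ν⟫⁻¹ ^ n < r * areaDensity L θ :=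
    hcd.eventually_lt (continuousAt_const.mul hL.continuous_areaDensity.continuousAt)
      (by rw [hval]; exact lt_mul_of_one_lt_left hd0 hr1)
  have hev2 : ∀ᶠ θ : Sph n in 𝓝 θ₀, areaDensity L θ < r * (h ^ (n - 1) * ⟪(θ : Euc n), ν⟫⁻¹ ^ n) :=
    hL.continuous_areaDensity.continuousAt.eventually_lt (continuousAt_const.mul hcd)
      (by rw [hval]; exact lt_mul_of_one_lt_left hd0 hr1)
  have hev3 : ∀ᶠ θ : Sph n in 𝓝 θ₀, 0 < ⟪(θ : Euc n), ν⟫ := hcin.continuousAt.eventually_const_lt hin0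
  have hev4 : ∀ᶠ θ : Sph n in 𝓝 θ₀, radialMap L θ ∈ N := hL.continuous_radialMap.continuousAt hN
  refine ⟨_, (hev1.and (hev2.and (hev3.and hev4))), fun A hA hAU => ?_⟩
  obtain ⟨P, hP⟩ : ∃ P : Euc n → Euc n, P = fun x => (h * ⟪x, ν⟫⁻¹) • x := ⟨_, rfl⟩
  obtain ⟨Q, hQ⟩ : ∃ Q : Euc n → Euc n, Q = fun x => Real.exp (-L x) • x := ⟨_, rfl⟩
  have hPg : ∀ θ : Sph n, P (radialMap L θ) = h • (⟪(θ : Euc n), ν⟫⁻¹ • (θ : Euc n)) := by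
    intro θ
    have := Real.exp_pos (-L θ)
    simp only [hP, radialMap, inner_smul_left, conj_trivial, smul_smul]
    congr 1
    rw [mul_inv]
    field_simp
  have hPimg : P '' (radialMap L '' A) =
      h • ((fun θ : Sph n => ⟪(θ : Euc n), ν⟫⁻¹ • (θ : Euc n)) '' A) := by
    rw [image_image, ← image_smul, image_image]
    exact image_congr fun θ _ => hPg θ
  have hQP : ∀ θ ∈ A, Q (P (radialMap L θ)) = radialMap L θ := by
    intro θ hθ
    have h1 := (hAU hθ).2.2.1
    have h2 : 0 < h * ⟪(θ : Euc n), ν⟫⁻¹ := mul_pos hh0 (inv_pos.2 h1)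
    rw [hPg, hQ, smul_smul]
    simp only
    rw [hL.hom _ h2 _ (sph_ne_zero θ), neg_add, Real.exp_add, Real.exp_neg (Real.log _),
      Real.exp_log h2, smul_smul, mul_assoc, inv_mul_cancel₀ h2.ne', mul_one, radialMap]
  have hQimg : Q '' (P '' (radialMap L '' A)) = radialMap L '' A := by
    rw [image_image, image_image]
    exact image_congr hQP
  have hclose : ∀ θ ∈ A, ∀ θ' ∈ A, ‖(P (radialMap L θ) - P (radialMap L θ')) -
      (radialMap L θ - radialMap L θ')‖ ≤ (1 - (r : ℝ)⁻¹) * ‖radialMap L θ - radialMap L θ'‖ := by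
    intro θ hθ θ' hθ'
    have := hproj _ (hAU hθ).2.2.2 _ (hAU hθ').2.2.2 (hL.apply_radialMap θ) (hL.apply_radialMap θ')
    rwa [hP]
  have hlipP : LipschitzOnWith r P (radialMap L '' A) := by
    refine LipschitzOnWith.of_dist_le_mul ?_
    rintro _ ⟨θ, hθ, rfl⟩ _ ⟨θ', hθ', rfl⟩
    rw [dist_eq_norm, dist_eq_norm]
    have h1 := hclose θ hθ θ' hθ'
    have h2 := norm_le_norm_add_norm_sub' (P (radialMap L θ) - P (radialMap L θ'))
      (radialMap L θ - radialMap L θ')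
    have h3 : 2 - (r : ℝ)⁻¹ ≤ r := by
      have : (r : ℝ) * (r : ℝ)⁻¹ = 1 := mul_inv_cancel₀ hr0.ne'
      have h4 : 0 < (r : ℝ)⁻¹ := inv_pos.2 hr0
      nlinarith only [this, h4, sq_nonneg ((r : ℝ) - 1), hr1]
    have h4 := norm_nonneg (radialMap L θ - radialMap L θ')
    nlinarith only [h1, h2, h3, h4]
  have hlipQ : LipschitzOnWith r Q (P '' (radialMap L '' A)) := by
    refine LipschitzOnWith.of_dist_le_mul ?_
    rintro _ ⟨_, ⟨θ, hθ, rfl⟩, rfl⟩ _ ⟨_, ⟨θ', hθ', rfl⟩, rfl⟩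
    rw [dist_eq_norm, dist_eq_norm, hQP θ hθ, hQP θ' hθ']
    have h1 := hclose θ hθ θ' hθ'
    have h2 := norm_sub_norm_le (radialMap L θ - radialMap L θ')
      (P (radialMap L θ) - P (radialMap L θ'))
    rw [norm_sub_rev] at h1
    have h3 : (r : ℝ)⁻¹ * ‖radialMap L θ - radialMap L θ'‖ ≤
        ‖P (radialMap L θ) - P (radialMap L θ')‖ := by linarith only [h1, h2]
    rwa [inv_mul_le_iff₀ hr0] at h3
  have hflat : Measure.euclideanHausdorffMeasure (n - 1) (P '' (radialMap L '' A)) =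
      ∫⁻ θ in A, ENNReal.ofReal (h ^ (n - 1) * ⟪(θ : Euc n), ν⟫⁻¹ ^ n) ∂(sphMeas n) := by
    rw [hPimg, Measure.euclideanHausdorffMeasure_smul₀ _ hh0.ne',
      flat_area hn hν1 hA fun θ hθ => (hAU hθ).2.2.1, ENNReal.smul_def, smul_eq_mul,
      ← lintegral_const_mul _ ((measurable_inner_inv ν).pow_const n).ennreal_ofReal]
    refine lintegral_congr fun θ => ?_
    rw [ENNReal.ofReal_mul (pow_nonneg hh0.le _)]
    congr 1
    rw [ENNReal.ofReal, Real.toNNReal_pow hh0.le,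
      Real.toNNReal_eq_nnnorm_of_nonneg hh0.le]
  have hmd : Measurable fun θ => ENNReal.ofReal (areaDensity L θ) :=
    hL.continuous_areaDensity.measurable.ennreal_ofReal
  have hk : (r : ℝ≥0∞) ^ n = (r : ℝ≥0∞) ^ (n - 1) * r := by
    rw [← pow_succ, Nat.sub_add_cancel (by omega)]
  rw [hk, mul_assoc, mul_assoc]
  constructor
  · calc _ = Measure.euclideanHausdorffMeasure (n - 1) (Q '' (P '' (radialMap L '' A))) := by
          rw [hQimg]
      _ ≤ _ := lipschitzOnWith_area_image_le hlipQ _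
      _ ≤ _ := by
          gcongr
          rw [hflat, ← lintegral_const_mul _ hmd]
          refine setLIntegral_mono' hA fun θ hθ => ?_
          rw [← ENNReal.ofReal_coe_nnreal, ← ENNReal.ofReal_mul hr0.le]
          exact ENNReal.ofReal_le_ofReal (hAU hθ).1.le
  · calc _ ≤ r * Measure.euclideanHausdorffMeasure (n - 1) (P '' (radialMap L '' A)) := by
          rw [hflat, ← lintegral_const_mul _
            (((measurable_inner_inv ν).pow_const n).const_mul _).ennreal_ofReal]
          refine setLIntegral_mono' hA fun θ hθ => ?_
          rw [← ENNReal.ofReal_coe_nnreal, ← ENNReal.ofReal_mul hr0.le]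
          exact ENNReal.ofReal_le_ofReal (hAU hθ).2.1.le
      _ ≤ r * (r ^ (n - 1) * Measure.euclideanHausdorffMeasure (n - 1) (radialMap L '' A)) := by
          gcongr
          exact lipschitzOnWith_area_image_le hlipP _
      _ = _ := mul_left_comm _ _ _

lemma le_of_forall_pow_mul_le {a b : ℝ≥0∞} {k : ℕ} (h : ∀ r : ℝ≥0, 1 < r → a ≤ (r : ℝ≥0∞) ^ k * b) :
    a ≤ b := by
  have h1 : Tendsto (fun r : ℝ≥0 => (r : ℝ≥0∞) ^ k * b) (𝓝[>] 1) (𝓝 (((1 : ℝ≥0) : ℝ≥0∞) ^ k * b)) := by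
    refine ENNReal.Tendsto.mul_const ?_ (Or.inl (by simp))
    exact (((ENNReal.continuous_pow k).comp ENNReal.continuous_coe).tendsto 1).mono_left
      nhdsWithin_le_nhds
  have h2 := ge_of_tendsto h1 (eventually_nhdsWithin_of_forall fun r hr => h r hr)
  simpa using h2

/-- The area formula for the radial parametrization of a star-shaped hypersurface. -/
theorem comap_radialMap (hL : LogGauge L) (hn : 2 ≤ n) :
    (Measure.euclideanHausdorffMeasure (n - 1)).comap (radialMap L) =
      (sphMeas n).withDensity fun θ => ENNReal.ofReal (areaDensity L θ) := by
  have hem := hL.measurableEmbedding_radialMap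
  refine le_antisymm ?_ ?_
  · refine Measure.le_iff.2 fun A hA => le_of_forall_pow_mul_le (k := n) fun r hr => ?_
    have h1 : (Measure.euclideanHausdorffMeasure (n - 1)).comap (radialMap L) ≤
        ((r : ℝ≥0∞) ^ n) • (sphMeas n).withDensity fun θ => ENNReal.ofReal (areaDensity L θ) := by
      refine measure_le_of_locally_le fun θ₀ => ?_
      obtain ⟨U, hU, h⟩ := hL.exists_nhds_area hn θ₀ hr
      refine ⟨U, hU, fun B hB hBU => ?_⟩
      rw [hem.comap_apply, Measure.smul_apply, withDensity_apply _ hB]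
      exact (h B hB hBU).1
    exact h1 A
  · refine Measure.le_iff.2 fun A hA => le_of_forall_pow_mul_le (k := n) fun r hr => ?_
    have h1 : ((sphMeas n).withDensity fun θ => ENNReal.ofReal (areaDensity L θ)) ≤
        ((r : ℝ≥0∞) ^ n) • (Measure.euclideanHausdorffMeasure (n - 1)).comap (radialMap L) := by
      refine measure_le_of_locally_le fun θ₀ => ?_
      obtain ⟨U, hU, h⟩ := hL.exists_nhds_area hn θ₀ hr
      refine ⟨U, hU, fun B hB hBU => ?_⟩
      rw [Measure.smul_apply, hem.comap_apply, withDensity_apply _ hB]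
      exact (h B hB hBU).2
    exact h1 A

/-- Integration over a star-shaped hypersurface, for the normalized Hausdorff measure. -/
theorem integral_level (hL : LogGauge L) (hn : 2 ≤ n) (f : Euc n → ℝ) :
    ∫ x in {x | x ≠ 0 ∧ L x = 0}, f x ∂(Measure.euclideanHausdorffMeasure (n - 1)) =
      ∫ θ, areaDensity L θ * f (radialMap L θ) ∂(sphMeas n) := by
  have hem := hL.measurableEmbedding_radialMap
  rw [← hL.range_radialMap, ← hem.map_comap, hem.integral_map, hL.comap_radialMap hn]
  rw [integral_withDensity_eq_integral_toReal_smul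
    hL.continuous_areaDensity.measurable.ennreal_ofReal (.of_forall fun _ => ENNReal.ofReal_lt_top)]
  refine integral_congr_ae (.of_forall fun θ => ?_)
  simp only [ENNReal.toReal_ofReal (hL.areaDensity_pos θ).le, smul_eq_mul]

end LogGauge

/-- The ratio between the Euclidean and the unnormalized Hausdorff measures. -/
def hausdorffRatio (m : ℕ) : ℝ≥0 :=
  (volume : Measure (EuclideanSpace ℝ (Fin m))).addHaarScalarFactor μH[m]

lemma hausdorffRatio_pos (m : ℕ) : 0 < hausdorffRatio m :=
  pos_iff_ne_zero.2 (Measure.addHaarScalarFactor_volume_hausdorffMeasure_ne_zero m)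

lemma hausdorffMeasure_eq (hn : 1 ≤ n) :
    (μH[(n : ℝ) - 1] : Measure (Euc n)) =
      (hausdorffRatio (n - 1))⁻¹ • Measure.euclideanHausdorffMeasure (n - 1) := by
  have h : (n : ℝ) - 1 = ((n - 1 : ℕ) : ℝ) := by push_cast [hn]; ring
  rw [Measure.euclideanHausdorffMeasure_def, ← hausdorffRatio, smul_smul,
    inv_mul_cancel₀ (hausdorffRatio_pos _).ne', one_smul, h]

/-- Integration over a star-shaped hypersurface. -/
theorem LogGauge.setIntegral_level {L : Euc n → ℝ} (hL : LogGauge L) (hn : 2 ≤ n) (f : Euc n → ℝ) :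
    ∫ x in {x | x ≠ 0 ∧ L x = 0}, f x ∂μH[(n : ℝ) - 1] =
      (hausdorffRatio (n - 1) : ℝ)⁻¹ *
        ∫ θ, areaDensity L θ * f (radialMap L θ) ∂(sphMeas n) := by
  rw [hausdorffMeasure_eq (by omega), Measure.restrict_smul, integral_smul_nnreal_measure,
    hL.integral_level hn, NNReal.smul_def, smul_eq_mul, NNReal.coe_inv]

end AreaFormula

section Recenter

variable {n : ℕ}

namespace NearRadial

variable {G : Euc n → ℝ} {ε : ℝ}

lemma isOpen_neg (hG : NearRadial G ε) : IsOpen {x | G x < 0} :=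
  isOpen_lt hG.smooth.continuous continuous_const

lemma integrableOn_neg {E : Type*} [NormedAddCommGroup E] (hG : NearRadial G ε) {f : Euc n → E} (hf : Continuous f) :
    IntegrableOn f {x | G x < 0} := by
  obtain ⟨R, hR⟩ := hG.bounded.subset_closedBall 0
  exact (hf.continuousOn.integrableOn_compact (isCompact_closedBall 0 R)).mono_set
    fun x hx => hR (show G x ≤ 0 from le_of_lt hx)

lemma smul_neg_iff (hG : NearRadial G ε) (hε : ε < 1) (θ : Sph n) {s : ℝ} (hs : 0 < s) :
    G (s • (θ : Euc n)) < 0 ↔ s < Real.exp (logRadius (_root_.logGauge G) θ) := by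
  have hx := sph_ne_zero θ
  rw [← hG.logGauge_neg_iff hε (smul_ne_zero hs.ne' hx), (hG.logGauge hε).hom s hs _ hx,
    LogGauge.logRadius_sph, ← Real.log_lt_iff_lt_exp hs]
  constructor <;> intro h <;> linarith

/-- Integrals of homogeneous functions over a star-shaped domain, in polar coordinates. -/
lemma integral_neg (hG : NearRadial G ε) (hε : ε < 1) (hn : 0 < n) {k : ℕ} {f : Euc n → ℝ}
    (hf : Continuous f) (hom : ∀ s : ℝ, 0 < s → ∀ x, f (s • x) = s ^ k * f x) :
    ∫ x in {x | G x < 0}, f x =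
      (∫ θ : Sph n, Real.exp ((n + k) * logRadius (_root_.logGauge G) θ) * f θ ∂(sphMeas n)) /
        (n + k) := by
  have hm := hG.isOpen_neg.measurableSet
  rw [← integral_indicator hm, integral_polar hn _ ((hG.integrableOn_neg hf).integrable_indicator hm),
    ← integral_div]
  refine integral_congr_ae (.of_forall fun θ => ?_)
  show ∫ s in Ioi (0 : ℝ), s ^ (n - 1) * {x | G x < 0}.indicator f (s • (θ : Euc n)) =
    Real.exp ((n + k) * logRadius (_root_.logGauge G) θ) * f θ / (n + k)
  have hr := Real.exp_pos (logRadius (_root_.logGauge G) (θ : Euc n))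
  obtain ⟨r, hrd⟩ : ∃ r, r = Real.exp (logRadius (_root_.logGauge G) (θ : Euc n)) := ⟨_, rfl⟩
  rw [← hrd] at hr
  have h1 : ∀ s ∈ Ioi (0 : ℝ), s ^ (n - 1) * {x | G x < 0}.indicator f (s • (θ : Euc n)) =
      (Iio r).indicator (fun s => s ^ (n - 1 + k) * f θ) s := by
    intro s hs
    by_cases h : s < r
    · rw [indicator_of_mem (show s • (θ : Euc n) ∈ {x | G x < 0} from
        (hG.smul_neg_iff hε θ hs).2 (hrd ▸ h)), indicator_of_mem (show s ∈ Iio r from h),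
        hom s hs, pow_add, mul_assoc]
    · rw [indicator_of_notMem (show s • (θ : Euc n) ∉ {x | G x < 0} from
        fun h' => h (hrd ▸ (hG.smul_neg_iff hε θ hs).1 h')), indicator_of_notMem (by simpa using h),
        mul_zero]
  rw [setIntegral_congr_fun measurableSet_Ioi h1, setIntegral_indicator measurableSet_Iio,
    Ioi_inter_Iio, ← integral_Ioc_eq_integral_Ioo, ← intervalIntegral.integral_of_le hr.le,
    intervalIntegral.integral_mul_const, integral_pow]
  have hc : n - 1 + k + 1 = n + k := by omega
  have hc' : ((n - 1 + k : ℕ) : ℝ) + 1 = n + k := by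
    rw [← Nat.cast_add_one, hc]; push_cast; rfl
  rw [hc, hc', zero_pow (by omega), sub_zero]
  have h2 : Real.exp ((n + k) * logRadius (_root_.logGauge G) θ) = r ^ (n + k) := by
    rw [hrd, ← Real.exp_nat_mul]; push_cast; rfl
  rw [h2]
  ring

lemma volume_neg (hG : NearRadial G ε) (hε : ε < 1) (hn : 0 < n) :
    (volume {x | G x < 0}).toReal =
      (∫ θ : Sph n, Real.exp (n * logRadius (_root_.logGauge G) θ) ∂(sphMeas n)) / n := by
  have h := hG.integral_neg hε hn (k := 0) (f := fun _ => 1) continuous_const (by simp)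
  simp only [Nat.cast_zero, add_zero, mul_one] at h
  rw [← h]
  simp [Measure.real]

lemma integral_inner_neg (hG : NearRadial G ε) (hε : ε < 1) (hn : 0 < n) (v : Euc n) :
    ∫ x in {x | G x < 0}, ⟪v, x⟫ =
      (∫ θ : Sph n, Real.exp ((n + 1) * logRadius (_root_.logGauge G) θ) * ⟪v, (θ : Euc n)⟫
        ∂(sphMeas n)) / (n + 1) := by
  have h := hG.integral_neg hε hn (k := 1) (f := fun x => ⟪v, x⟫)
    (continuous_const.inner continuous_id) (fun s _ x => by simp [inner_smul_right])
  simpa using h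

lemma volume_neg_pos (hG : NearRadial G ε) : 0 < (volume {x | G x < 0}).toReal := by
  refine ENNReal.toReal_pos (hG.isOpen_neg.measure_pos _ hG.nonempty).ne' ?_
  exact ((hG.bounded.subset fun x (hx : G x < 0) => le_of_lt hx).measure_lt_top).ne

/-- The barycenter of a domain close to a centered ball is close to the origin. -/
lemma norm_barycenter_le (hG : NearRadial G ε) (hn : 3 ≤ n) (hε : 16 * (n + 1) * ε ≤ 1) {b : Euc n}
    (hb : ∀ v, ∫ x in {x | G x < 0}, ⟪v, x⟫ = (volume {x | G x < 0}).toReal * ⟪v, b⟫)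
    {x : Euc n} (hx : G x = 0) : ‖b‖ ≤ 96 * n * ε * ‖x‖ := by
  have hn3 : (3 : ℝ) ≤ n := by exact_mod_cast hn
  have hε0 : 0 ≤ ε := (norm_nonneg _).trans (hG.near x hx)
  have hε2 : ε ≤ 1 / 2 := by nlinarith only [hε, hn3, hε0]
  have hε1 : ε < 1 := by linarith only [hε2]
  have hx0 := hG.ne_zero hε1 hx
  have hxp := norm_pos_iff.2 hx0
  obtain ⟨u, hu⟩ : ∃ u, u = logRadius (_root_.logGauge G) := ⟨_, rfl⟩
  have hadm : Adm u := hu ▸ (hG.logGauge hε1).adm_logRadius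
  have hgrad : ∀ θ : Sph n, ‖gradient u (θ : Euc n)‖ ≤ 2 * ε :=
    fun θ => hu ▸ hG.norm_gradient_logRadius_le hε2 θ
  obtain ⟨θ₀, hθ₀⟩ : ∃ θ₀ : Sph n, (θ₀ : Euc n) = ‖x‖⁻¹ • x :=
    ⟨⟨‖x‖⁻¹ • x, by simp [norm_smul, hxp.ne']⟩, rfl⟩
  obtain ⟨a, ha⟩ : ∃ a, a = Real.log ‖x‖ := ⟨_, rfl⟩
  have hua : u θ₀ = a := by
    rw [hθ₀, hadm.1 _ (inv_pos.2 hxp) x hx0, zpow_zero, one_mul, hu, logRadius,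
      (hG.logGauge_eq_zero_iff hε1 hx0).2 hx, sub_zero, ha]
  have hosc : ∀ θ : Sph n, |u θ - a| ≤ 16 * ε := fun θ => by
    have := hadm.abs_sub_le hn hgrad θ θ₀
    rw [hua] at this
    linarith only [this]
  have hs := sarea_pos (n := n) (by omega)
  have hcu : ∀ k : ℝ, Continuous fun θ : Sph n => Real.exp (k * u θ) :=
    fun k => Real.continuous_exp.comp (continuous_const.mul hadm.continuous_sph)
  have hcb : Continuous fun θ : Sph n => ⟪b, (θ : Euc n)⟫ :=
    continuous_const.inner continuous_subtype_val
  obtain ⟨V, hV⟩ : ∃ V, V = (volume {x | G x < 0}).toReal := ⟨_, rfl⟩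
  have hVlow : Real.exp (n * a) / 3 * sarea n ≤ n * V := by
    rw [hV, hG.volume_neg hε1 (by omega), ← hu, mul_div_cancel₀ _ (by linarith only [hn3])]
    have h1 : ∫ _θ : Sph n, Real.exp (n * a) / 3 ∂(sphMeas n) = Real.exp (n * a) / 3 * sarea n := by
      rw [integral_const, smul_eq_mul, sarea, mul_comm]
    rw [← h1]
    refine integral_mono (integrable_const _) (sph_integrable (hcu n)) fun θ => ?_
    have h2 := (abs_le.1 (hosc θ)).1
    have h3 : n * a - 1 ≤ n * u θ := by nlinarith only [h2, hn3, hε, hε0]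
    have h4 : Real.exp (n * a) / 3 ≤ Real.exp (n * a - 1) := by
      rw [Real.exp_sub]
      have := Real.exp_one_lt_d9
      gcongr
      linarith only [this]
    exact h4.trans (Real.exp_le_exp.2 h3)
  have hmom : V * ‖b‖ ^ 2 ≤ 32 * ε * Real.exp ((n + 1) * a) * ‖b‖ * sarea n := by
    have h1 := hb b
    rw [real_inner_self_eq_norm_sq, ← hV, hG.integral_inner_neg hε1 (by omega), ← hu] at h1
    have hn1 : (0 : ℝ) < n + 1 := by linarith only [hn3]
    rw [← h1, div_le_iff₀ hn1]
    have h2 : ∫ θ : Sph n, Real.exp ((n + 1) * u θ) * ⟪b, (θ : Euc n)⟫ ∂(sphMeas n) =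
        ∫ θ : Sph n, (Real.exp ((n + 1) * u θ) - Real.exp ((n + 1) * a)) * ⟪b, (θ : Euc n)⟫
          ∂(sphMeas n) := by
      simp only [sub_mul]
      have h7 : Integrable (fun θ : Sph n => Real.exp ((n + 1) * u θ) * ⟪b, (θ : Euc n)⟫)
          (sphMeas n) := sph_integrable ((hcu _).mul hcb)
      have h8 : Integrable (fun θ : Sph n => Real.exp ((n + 1) * a) * ⟪b, (θ : Euc n)⟫)
          (sphMeas n) := sph_integrable (continuous_const.mul hcb)
      rw [integral_sub h7 h8,
        integral_const_mul, integral_sph_linear (by omega), mul_zero, sub_zero]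
    rw [h2]
    refine (le_norm_self _).trans ((norm_integral_le_of_norm_le_const
      (C := Real.exp ((n + 1) * a) * (2 * ((n + 1) * (16 * ε))) * ‖b‖) (.of_forall fun θ => ?_)).trans
      (le_of_eq ?_))
    · rw [norm_mul]
      have h3 : ‖⟪b, (θ : Euc n)⟫‖ ≤ ‖b‖ := by
        simpa [sph_norm] using norm_inner_le_norm (𝕜 := ℝ) b (θ : Euc n)
      have h4 : |(n + 1) * (u θ - a)| ≤ (n + 1) * (16 * ε) := by
        rw [abs_mul, abs_of_pos hn1]
        exact mul_le_mul_of_nonneg_left (hosc θ) hn1.le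
      have h5 : ‖Real.exp ((n + 1) * u θ) - Real.exp ((n + 1) * a)‖ ≤
          Real.exp ((n + 1) * a) * (2 * ((n + 1) * (16 * ε))) := by
        have h6 : Real.exp ((n + 1) * u θ) - Real.exp ((n + 1) * a) =
            Real.exp ((n + 1) * a) * (Real.exp ((n + 1) * (u θ - a)) - 1) := by
          rw [mul_sub, mul_one, ← Real.exp_add]; ring_nf
        rw [h6, norm_mul, Real.norm_of_nonneg (Real.exp_pos _).le, Real.norm_eq_abs]
        gcongr
        refine (Real.abs_exp_sub_one_le ?_).trans ?_
        · refine h4.trans ?_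
          linarith only [hε]
        · linarith only [h4]
      exact mul_le_mul h5 h3 (norm_nonneg _) (by positivity)
    · rw [sarea]
      ring
  rcases (norm_nonneg b).eq_or_lt with h0 | h0
  · rw [← h0]
    positivity
  have h1 : V * ‖b‖ ≤ 32 * ε * Real.exp ((n + 1) * a) * sarea n := by
    refine le_of_mul_le_mul_right ?_ h0
    linarith only [hmom]
  have hexp : Real.exp ((n + 1) * a) = Real.exp (n * a) * ‖x‖ := by
    rw [add_mul, one_mul, Real.exp_add, ha, Real.exp_log hxp]
  have h2 : Real.exp (n * a) / 3 * sarea n * ‖b‖ ≤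
      Real.exp (n * a) / 3 * sarea n * (96 * n * ε * ‖x‖) := by
    calc _ ≤ n * V * ‖b‖ := by gcongr
      _ = n * (V * ‖b‖) := by ring
      _ ≤ n * (32 * ε * Real.exp ((n + 1) * a) * sarea n) := by gcongr
      _ = _ := by rw [hexp]; ring
  exact le_of_mul_le_mul_left h2 (by positivity)

end NearRadial

lemma norm_normalize_sub_le {E : Type*} [NormedAddCommGroup E] [NormedSpace ℝ E] {x b : E}
    (hx : x ≠ 0) : ‖‖x‖⁻¹ • x - ‖x - b‖⁻¹ • (x - b)‖ ≤ 2 * ‖b‖ / ‖x‖ := by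
  have hxp := norm_pos_iff.2 hx
  have h1 : ‖x‖⁻¹ • x - ‖x - b‖⁻¹ • (x - b) =
      ‖x‖⁻¹ • (b + (x - b) - (‖x‖ * ‖x - b‖⁻¹) • (x - b)) := by
    rw [smul_sub _ (b + (x - b)), smul_smul, inv_mul_cancel_left₀ hxp.ne', add_sub_cancel]
  have h2 : ‖(x - b) - (‖x‖ * ‖x - b‖⁻¹) • (x - b)‖ ≤ ‖b‖ := by
    rcases eq_or_ne (x - b) 0 with h | h
    · simp [h]
    have h3 : (x - b) - (‖x‖ * ‖x - b‖⁻¹) • (x - b) = ((‖x - b‖ - ‖x‖) * ‖x - b‖⁻¹) • (x - b) := by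
      rw [sub_mul, mul_inv_cancel₀ (norm_ne_zero_iff.2 h), sub_smul, one_smul]
    rw [h3, norm_smul, norm_mul, norm_inv, norm_norm, mul_assoc,
      inv_mul_cancel₀ (norm_ne_zero_iff.2 h), mul_one, Real.norm_eq_abs]
    simpa using abs_norm_sub_norm_le (x - b) x
  rw [h1, norm_smul, norm_inv, norm_norm, div_eq_inv_mul]
  gcongr
  calc _ = ‖b + ((x - b) - (‖x‖ * ‖x - b‖⁻¹) • (x - b))‖ := by rw [add_sub_assoc]
    _ ≤ ‖b‖ + ‖(x - b) - (‖x‖ * ‖x - b‖⁻¹) • (x - b)‖ := norm_add_le _ _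
    _ ≤ _ := by linarith

/-- A perturbation of a ball is, up to a larger constant, a perturbation of a ball centered at the
barycenter. -/
theorem SmoothBody.exists_center (K : SmoothBody n) (hn : 3 ≤ n) {ε : ℝ}
    (hε : 16 * (n + 1) * ε ≤ 1) (hK : K.IsPerturbedBall ε) :
    ∃ c : Euc n, (∀ x ∈ K.bdry, ‖K.normal x - ‖x - c‖⁻¹ • (x - c)‖ ≤ (1 + 192 * n) * ε) ∧
      ∀ v, ∫ x in {x | K.F (c + x) < 0}, ⟪v, x⟫ = 0 := by
  obtain ⟨c, hc⟩ := hK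
  have hG := K.nearRadial hc
  obtain ⟨V, hV⟩ : ∃ V, V = (volume {x | K.F (c + x) < 0}).toReal := ⟨_, rfl⟩
  have hVp : 0 < V := hV ▸ hG.volume_neg_pos
  obtain ⟨b, hbd⟩ : ∃ b, b = V⁻¹ • ∫ x in {x | K.F (c + x) < 0}, x := ⟨_, rfl⟩
  have hb : ∀ v, ∫ x in {x | K.F (c + x) < 0}, ⟪v, x⟫ = V * ⟪v, b⟫ := by
    intro v
    rw [hbd, inner_smul_right, mul_inv_cancel_left₀ hVp.ne']
    exact integral_inner (hG.integrableOn_neg continuous_id) v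
  refine ⟨c + b, fun x hx => ?_, fun v => ?_⟩
  · have hx' : K.F (c + (x - c)) = 0 := by rw [add_sub_cancel]; exact hx
    have hε0 : 0 ≤ ε := (norm_nonneg _).trans (hc x hx)
    have hε1 : ε < 1 := by
      have : (3 : ℝ) ≤ n := by exact_mod_cast hn
      nlinarith only [this, hε0, hε]
    have hne := hG.ne_zero hε1 hx'
    have h1 := hG.norm_barycenter_le hn hε (hV ▸ hb) hx'
    have h2 := norm_normalize_sub_le (b := b) hne
    have h3 : 2 * ‖b‖ / ‖x - c‖ ≤ 192 * n * ε := by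
      rw [div_le_iff₀ (norm_pos_iff.2 hne)]
      linarith only [h1]
    rw [← sub_sub]
    calc _ ≤ _ := norm_sub_le_norm_sub_add_norm_sub _ (‖x - c‖⁻¹ • (x - c)) _
      _ ≤ _ := by linarith only [h2, h3, hc x hx]
  · have h1 : ∫ x in {x | K.F (c + b + x) < 0}, ⟪v, x⟫ =
        ∫ x in {x | K.F (c + x) < 0}, ⟪v, x - b⟫ := by
      have h2 := (measurePreserving_add_left volume b).setIntegral_preimage_emb
        (measurableEmbedding_addLeft b) (fun x => ⟪v, x - b⟫) {x | K.F (c + x) < 0}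
      rw [← h2]
      simp [add_assoc]
    rw [h1]
    simp only [inner_sub_right]
    rw [integral_sub (hG.integrableOn_neg (continuous_const.inner continuous_id))
      (hG.integrableOn_neg continuous_const), hb, setIntegral_const, smul_eq_mul, Measure.real, ← hV,
      sub_self]

end Recenter

section Assembly

open Filter Topology

variable {n : ℕ}

namespace LogGauge

variable {L : Euc n → ℝ}

lemma logNorm : LogGauge (fun x : Euc n => Real.log ‖x‖) where
  hom s hs x hx := by
    rw [norm_smul, Real.norm_of_nonneg hs.le, Real.log_mul hs.ne' (norm_ne_zero_iff.2 hx), add_comm]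
  smooth x hx := (contDiffAt_norm ℝ hx).log (norm_ne_zero_iff.2 hx)

lemma areaDensity_logNorm (θ : Sph n) : areaDensity (fun x : Euc n => Real.log ‖x‖) θ = 1 := by
  have h1 : logRadius (fun x : Euc n => Real.log ‖x‖) = fun _ => 0 := by
    funext x
    simp [logRadius]
  have h2 := (logNorm (n := n)).norm_gradient_sq θ
  have h3 : gradient (fun _ : Euc n => (0 : ℝ)) (θ : Euc n) = 0 := by simp [gradient]
  rw [h1, h3, norm_zero] at h2
  have h4 : ‖gradient (fun x : Euc n => Real.log ‖x‖) (θ : Euc n)‖ = 1 := by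
    rw [← pow_left_inj₀ (norm_nonneg _) zero_le_one two_ne_zero, h2]
    norm_num
  simp [areaDensity, h4]

/-- The area density varies by a bounded factor over the sphere. -/
lemma areaDensity_le (hL : LogGauge L) (hn : 3 ≤ n)
    (hp : ∀ θ : Sph n, ‖gradient (logRadius L) (θ : Euc n)‖ ≤ 1 / 4) (θ θ' : Sph n) :
    areaDensity L θ ≤ 2 * Real.exp 2 ^ (n - 1) * areaDensity L θ' := by
  have h1 := hL.adm_logRadius.abs_sub_le hn hp θ θ'
  rw [logRadius_sph, logRadius_sph] at h1
  have h2 : Real.exp (-L θ) ≤ Real.exp 2 * Real.exp (-L θ') := by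
    rw [← Real.exp_add]
    apply Real.exp_le_exp.2
    linarith only [(abs_le.1 h1).2]
  have h3 : ‖gradient L (θ : Euc n)‖ ≤ 2 * ‖gradient L (θ' : Euc n)‖ := by
    have h4 := hL.one_le_norm_gradient θ'
    have h5 := hL.norm_gradient_sq θ
    have h6 := hp θ
    have h7 : ‖gradient L (θ : Euc n)‖ ≤ 2 := by
      nlinarith only [h5, h6, norm_nonneg (gradient (logRadius L) (θ : Euc n)),
        norm_nonneg (gradient L (θ : Euc n))]
    linarith only [h4, h7]
  calc areaDensity L θ ≤ (Real.exp 2 * Real.exp (-L θ')) ^ (n - 1) *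
        (2 * ‖gradient L (θ' : Euc n)‖) := by
        unfold areaDensity
        gcongr
    _ = _ := by
        rw [areaDensity, mul_pow]
        ring

lemma sarea_mul_areaDensity_le (hL : LogGauge L) (hn : 3 ≤ n)
    (hp : ∀ θ : Sph n, ‖gradient (logRadius L) (θ : Euc n)‖ ≤ 1 / 4) (θ : Sph n) :
    sarea n * areaDensity L θ ≤
      2 * Real.exp 2 ^ (n - 1) * ∫ θ : Sph n, areaDensity L θ ∂(sphMeas n) := by
  rw [← integral_const_mul]
  have h2 : ∫ _θ : Sph n, areaDensity L θ ∂(sphMeas n) = sarea n * areaDensity L θ := by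
    rw [integral_const, smul_eq_mul, sarea]
  rw [← h2]
  have h3 : Integrable (fun θ' : Sph n => 2 * Real.exp 2 ^ (n - 1) * areaDensity L θ')
      (sphMeas n) := sph_integrable (continuous_const.mul hL.continuous_areaDensity)
  exact integral_mono (integrable_const _) h3 fun θ' => hL.areaDensity_le hn hp θ θ'

lemma sarea_mul_integral_le (hL : LogGauge L) (hn : 3 ≤ n)
    (hp : ∀ θ : Sph n, ‖gradient (logRadius L) (θ : Euc n)‖ ≤ 1 / 4) :
    sarea n * ∫ θ : Sph n, areaDensity L θ * ‖unitGrad L (θ : Euc n) - θ‖ ^ 2 ∂(sphMeas n) ≤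
      2 * Real.exp 2 ^ (n - 1) * (∫ θ : Sph n, areaDensity L θ ∂(sphMeas n)) *
        dirichlet (logRadius L) (logRadius L) := by
  have hd := hL.adm_logRadius
  rw [← integral_const_mul, dirichlet, ← integral_const_mul]
  refine integral_mono_of_nonneg (.of_forall fun θ => ?_) ?_ (.of_forall fun θ => ?_)
  · have := hL.areaDensity_pos θ
    have := sarea_pos (n := n) (by omega)
    show 0 ≤ sarea n * (areaDensity L θ * ‖unitGrad L (θ : Euc n) - θ‖ ^ 2)
    positivity
  · exact sph_integrable (continuous_const.mul (hd.continuous_grad.inner hd.continuous_grad))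
  · show sarea n * (areaDensity L θ * ‖unitGrad L (θ : Euc n) - θ‖ ^ 2) ≤
      2 * Real.exp 2 ^ (n - 1) * (∫ θ : Sph n, areaDensity L θ ∂(sphMeas n)) *
        ⟪gradient (logRadius L) (θ : Euc n), gradient (logRadius L) (θ : Euc n)⟫
    rw [← mul_assoc, real_inner_self_eq_norm_sq]
    have := hL.areaDensity_pos θ
    have := sarea_pos (n := n) (by omega)
    exact mul_le_mul (hL.sarea_mul_areaDensity_le hn hp θ) (hL.norm_unitGrad_sub_sq_le θ) (sq_nonneg _)
      ((by positivity : 0 ≤ sarea n * areaDensity L θ).trans (hL.sarea_mul_areaDensity_le hn hp θ))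

/-- The average over the level set of the squared deviation of the normal from the radial
direction is controlled by the Dirichlet energy of the logarithmic radial function. -/
lemma average_level_le (hL : LogGauge L) (hn : 3 ≤ n)
    (hp : ∀ θ : Sph n, ‖gradient (logRadius L) (θ : Euc n)‖ ≤ 1 / 4) :
    ⨍ x in {x | x ≠ 0 ∧ L x = 0}, ‖unitGrad L x - ‖x‖⁻¹ • x‖ ^ 2 ∂μH[(n : ℝ) - 1] ≤
      2 * Real.exp 2 ^ (n - 1) / sarea n * dirichlet (logRadius L) (logRadius L) := by
  have hκ : (0 : ℝ) < hausdorffRatio (n - 1) := hausdorffRatio_pos _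
  have hs := sarea_pos (n := n) (by omega)
  have : Nontrivial (Euc n) := by
    have : Nonempty (Fin n) := ⟨⟨0, by omega⟩⟩
    infer_instance
  have hA : 0 < ∫ θ : Sph n, areaDensity L θ ∂(sphMeas n) := by
    have hne : Nonempty (Sph n) := (NormedSpace.sphere_nonempty.2 zero_le_one).to_subtype
    obtain ⟨θ⟩ := hne
    have h1 := (mul_pos hs (hL.areaDensity_pos θ)).trans_le (hL.sarea_mul_areaDensity_le hn hp θ)
    exact pos_of_mul_pos_right h1 (by positivity)
  rw [setAverage_eq, ← setIntegral_one_eq_measureReal, hL.setIntegral_level (by omega),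
    hL.setIntegral_level (by omega), smul_eq_mul]
  simp only [mul_one, normalize_radialMap]
  have h2 : ∀ θ : Sph n, unitGrad L (radialMap L θ) = unitGrad L (θ : Euc n) := fun θ =>
    hL.unitGrad_smul (Real.exp_pos _) (sph_ne_zero θ)
  simp only [h2]
  have h3 := hL.sarea_mul_integral_le hn hp
  rw [mul_inv, inv_inv, mul_mul_mul_comm, mul_inv_cancel₀ hκ.ne', one_mul, inv_mul_le_iff₀ hA]
  rw [← le_div_iff₀' hs] at h3
  refine h3.trans (le_of_eq ?_)
  ring

/-- The total positive mean curvature of the level set as an integral over the sphere. -/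
lemma setIntegral_divg (hL : LogGauge L) (hn : 2 ≤ n) :
    ∫ x in {x | x ≠ 0 ∧ L x = 0}, max (divg (unitGrad L) x) 0 ∂μH[(n : ℝ) - 1] =
      (hausdorffRatio (n - 1) : ℝ)⁻¹ * ∫ θ : Sph n, Real.exp ((n - 2) * logRadius L θ) *
        (‖gradient L (θ : Euc n)‖ * max (divg (unitGrad L) θ) 0) ∂(sphMeas n) := by
  rw [hL.setIntegral_level hn]
  congr 1
  refine integral_congr_ae (.of_forall fun θ => ?_)
  have he := Real.exp_pos (-L θ)
  show areaDensity L θ * max (divg (unitGrad L) (radialMap L θ)) 0 =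
    Real.exp ((n - 2) * logRadius L θ) * (‖gradient L (θ : Euc n)‖ * max (divg (unitGrad L) θ) 0)
  rw [radialMap, hL.divg_unitGrad_smul he (sph_ne_zero θ), areaDensity, logRadius_sph]
  have h1 : max ((Real.exp (-L θ))⁻¹ * divg (unitGrad L) (θ : Euc n)) 0 =
      (Real.exp (-L θ))⁻¹ * max (divg (unitGrad L) (θ : Euc n)) 0 := by
    rw [mul_max_of_nonneg _ _ (inv_pos.2 he).le, mul_zero]
  have h2 : Real.exp ((n - 2) * -L θ) = Real.exp (-L θ) ^ (n - 2) := by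
    rw [← Real.exp_nat_mul, Nat.cast_sub hn, Nat.cast_ofNat]
  rw [h1, h2, show n - 1 = n - 2 + 1 by omega, pow_succ]
  field_simp

end LogGauge

lemma sphereArea_eq (hn : 2 ≤ n) : sphereArea n = (hausdorffRatio (n - 1) : ℝ)⁻¹ * sarea n := by
  have h1 : sphere (0 : Euc n) 1 = {x | x ≠ 0 ∧ Real.log ‖x‖ = 0} := by
    ext x
    rw [mem_sphere_zero_iff_norm]
    constructor
    · intro h
      refine ⟨fun h0 => by simp [h0] at h, by simp [h]⟩
    · rintro ⟨h0, h⟩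
      exact Real.eq_one_of_pos_of_log_eq_zero (norm_pos_iff.2 h0) h
  rw [sphereArea, ← Measure.real, ← setIntegral_one_eq_measureReal, h1,
    LogGauge.logNorm.setIntegral_level hn]
  simp [LogGauge.areaDensity_logNorm, sarea]

lemma volume_unitBall (hn : 0 < n) : (volume (ball (0 : Euc n) 1)).toReal = sarea n / n := by
  rw [sarea, sphMeas, Measure.toSphere_real_apply_univ, finrank_euclideanSpace_fin,
    mul_div_cancel_left₀ _ (by positivity), Measure.real]

namespace SmoothBody

variable (K : SmoothBody n) (c : Euc n)

lemma measurableSet_bdry : MeasurableSet K.bdry :=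
  (isClosed_singleton.preimage K.smooth.continuous).measurableSet

lemma restrict_bdry :
    (μH[(n : ℝ) - 1] : Measure (Euc n)).restrict K.bdry =
      ((μH[(n : ℝ) - 1] : Measure (Euc n)).restrict {x | K.F (c + x) = 0}).map (c + ·) :=
  (((IsometryEquiv.addLeft c).measurePreserving_hausdorffMeasure ((n : ℝ) - 1)).restrict_preimage
    K.measurableSet_bdry).map_eq.symm

lemma setIntegral_bdry (f : Euc n → ℝ) :
    ∫ x in K.bdry, f x ∂μH[(n : ℝ) - 1] =
      ∫ x in {x | K.F (c + x) = 0}, f (c + x) ∂μH[(n : ℝ) - 1] := by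
  rw [K.restrict_bdry c, (measurableEmbedding_addLeft c).integral_map]

lemma setAverage_bdry (f : Euc n → ℝ) :
    ⨍ x in K.bdry, f x ∂μH[(n : ℝ) - 1] =
      ⨍ x in {x | K.F (c + x) = 0}, f (c + x) ∂μH[(n : ℝ) - 1] := by
  rw [setAverage_eq, setAverage_eq, ← setIntegral_one_eq_measureReal,
    ← setIntegral_one_eq_measureReal, K.setIntegral_bdry c, K.setIntegral_bdry c]

lemma volume_body : volume K.body = volume {x | K.F (c + x) < 0} :=
  (measure_preimage_add volume c K.body).symm

/-- The level set of a near-radial function coincides with that of its logarithmic gauge. -/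
lemma _root_.NearRadial.level_eq {G : Euc n → ℝ} {ε : ℝ} (hG : NearRadial G ε) (hε : ε < 1) :
    {x | G x = 0} = {x | x ≠ 0 ∧ logGauge G x = 0} := by
  ext x
  constructor
  · intro h
    have hx := hG.ne_zero hε h
    exact ⟨hx, (hG.logGauge_eq_zero_iff hε hx).2 h⟩
  · rintro ⟨hx, h⟩
    exact (hG.logGauge_eq_zero_iff hε hx).1 h

end SmoothBody

end Assembly

/-- For every `n ≥ 4` there exist `ε₃ = ε₃(n) > 0` and `c(n) > 0` such
that for every `K ⊆ ℝⁿ` which is a `C¹` `ε₃`-perturbation of a ball, there is `x̄ ∈ ℝⁿ` with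
`(∫_{∂K} H⁺ dH^{n-1})^{1/(n-2)} / |K|^{1/n} − ((n-1)·H^{n-1}(S^{n-1}))^{1/(n-2)} / |B₁|^{1/n}
  ≥ c(n) · ⨍_{∂K} |ν(x) − (x−x̄)/|x−x̄||² dH^{n-1}(x)`. -/
theorem volumetric_minkowski_stability (n : ℕ) (hn : 4 ≤ n) :
    ∃ ε₃ c : ℝ, 0 < ε₃ ∧ 0 < c ∧ ∀ K : SmoothBody n, K.IsPerturbedBall ε₃ →
      ∃ xbar : Euc n,
        (∫ x in K.bdry, max (K.meanCurv x) 0 ∂μH[(n : ℝ) - 1]) ^ (((n : ℝ) - 2)⁻¹)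
            / (volume K.body).toReal ^ ((n : ℝ)⁻¹)
          - (((n : ℝ) - 1) * sphereArea n) ^ (((n : ℝ) - 2)⁻¹)
            / (volume (ball (0 : Euc n) 1)).toReal ^ ((n : ℝ)⁻¹)
        ≥ c * ⨍ x in K.bdry, ‖K.normal x - ‖x - xbar‖⁻¹ • (x - xbar)‖ ^ 2 ∂μH[(n : ℝ) - 1] := by
  obtain ⟨ε₀, c₀, hε₀, hc₀, hcore⟩ := core_inequality hn
  have hn4 : (4 : ℝ) ≤ n := by exact_mod_cast hn
  have hκ : (0 : ℝ) < (hausdorffRatio (n - 1) : ℝ)⁻¹ := inv_pos.2 (hausdorffRatio_pos _)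
  obtain ⟨κ, hκd⟩ : ∃ κ, κ = (hausdorffRatio (n - 1) : ℝ)⁻¹ := ⟨_, rfl⟩
  rw [← hκd] at hκ
  have hs := sarea_pos (n := n) (by omega)
  obtain ⟨p, hp⟩ : ∃ p, p = ((n : ℝ) - 2)⁻¹ := ⟨_, rfl⟩
  have hp0 : 0 ≤ p := by rw [hp]; exact inv_nonneg.2 (by linarith only [hn4])
  obtain ⟨δ, hδ⟩ : ∃ δ, δ = min (1 / 8) (ε₀ / 2) := ⟨_, rfl⟩
  have hδ0 : 0 < δ := by rw [hδ]; positivity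
  have hδ1 : δ ≤ 1 / 8 := hδ ▸ min_le_left _ _
  have hδ2 : δ ≤ ε₀ / 2 := hδ ▸ min_le_right _ _
  have hden : (0 : ℝ) < 1 + 192 * n := by linarith only [hn4]
  refine ⟨δ / (1 + 192 * n), κ ^ p * c₀ * (sarea n / (2 * Real.exp 2 ^ (n - 1))),
    by positivity, by positivity, fun K hK => ?_⟩
  obtain ⟨cen, hnear, hmom⟩ := K.exists_center (by omega) (by
    rw [← mul_div_assoc, div_le_one hden]
    nlinarith only [hδ1, hδ0, hn4]) hK
  rw [mul_div_cancel₀ _ hden.ne'] at hnear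
  refine ⟨cen, ?_⟩
  have hG := K.nearRadial hnear
  have hδlt : δ < 1 := by linarith only [hδ1]
  have hL := hG.logGauge hδlt
  obtain ⟨L, hLd⟩ : ∃ L, L = logGauge (fun y => K.F (cen + y)) := ⟨_, rfl⟩
  have hgrad := hG.norm_gradient_logRadius_le (by linarith only [hδ1])
  have hlevel := hG.level_eq hδlt
  have hvol := hG.volume_neg hδlt (by omega)
  have hinner := fun v => hG.integral_inner_neg hδlt (by omega) v
  have hcurv : ∫ x in K.bdry, max (K.meanCurv x) 0 ∂μH[(n : ℝ) - 1] =
      ∫ x in {x | x ≠ 0 ∧ L x = 0}, max (divg (unitGrad L) x) 0 ∂μH[(n : ℝ) - 1] := by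
    rw [K.setIntegral_bdry cen, hLd, ← hlevel]
    refine setIntegral_congr_fun ?_ fun x hx => ?_
    · exact (isClosed_singleton.preimage hG.smooth.continuous).measurableSet
    · show max (K.meanCurv (cen + x)) 0 = max (divg (unitGrad (logGauge _)) x) 0
      rw [K.meanCurv_eq_divg, hG.divg_unitGrad_eq hδlt hx]
  have havg : ⨍ x in K.bdry, ‖K.normal x - ‖x - cen‖⁻¹ • (x - cen)‖ ^ 2 ∂μH[(n : ℝ) - 1] =
      ⨍ x in {x | x ≠ 0 ∧ L x = 0}, ‖unitGrad L x - ‖x‖⁻¹ • x‖ ^ 2 ∂μH[(n : ℝ) - 1] := by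
    rw [K.setAverage_bdry cen, hLd, ← hlevel, setAverage_eq, setAverage_eq]
    congr 1
    refine setIntegral_congr_fun ?_ fun x hx => ?_
    · exact (isClosed_singleton.preimage hG.smooth.continuous).measurableSet
    · show ‖K.normal (cen + x) - ‖cen + x - cen‖⁻¹ • (cen + x - cen)‖ ^ 2 =
        ‖unitGrad (logGauge _) x - ‖x‖⁻¹ • x‖ ^ 2
      rw [K.normal_eq_unitGrad, hG.unitGrad_eq hδlt hx, add_sub_cancel_left]
  rw [← hLd] at hL hgrad hvol hinner
  have hp4 : ∀ θ : Sph n, ‖gradient (logRadius L) (θ : Euc n)‖ ≤ 1 / 4 := fun θ =>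
    (hgrad θ).trans (by linarith only [hδ1])
  obtain ⟨B, hB, hB2, hJ0, hJ⟩ := hcore (logRadius L) hL.adm_logRadius
    (fun θ => (hgrad θ).trans (by linarith only [hδ2])) (fun v => by
      have h1 := hinner v
      rw [hmom v, eq_comm, div_eq_zero_iff] at h1
      exact h1.resolve_right (by linarith only [hn4]))
  have hJle := hL.integral_Jfun_le hn hB hB2 hp4
  rw [hcurv, havg, hL.setIntegral_divg (by omega), K.volume_body cen, hvol, sphereArea_eq (by omega),
    volume_unitBall (by omega), ← hκd, ← hp, mul_left_comm]
  rw [← hp] at hJ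
  have havg' := hL.average_level_le (by omega) hp4
  rw [Real.mul_rpow hκ.le (hJ0.trans hJle), Real.mul_rpow hκ.le
    (mul_nonneg (by linarith only [hn4]) hs.le), mul_div_assoc, mul_div_assoc, ← mul_sub]
  have hκp : 0 < κ ^ p := Real.rpow_pos_of_pos hκ p
  have hmono := Real.rpow_le_rpow hJ0 hJle hp0
  calc _ ≤ κ ^ p * c₀ * (sarea n / (2 * Real.exp 2 ^ (n - 1))) *
        (2 * Real.exp 2 ^ (n - 1) / sarea n * dirichlet (logRadius L) (logRadius L)) := by
        gcongr
    _ = κ ^ p * (c₀ * dirichlet (logRadius L) (logRadius L)) := by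
        have := Real.exp_pos 2
        field_simp
    _ ≤ _ := by
        gcongr
        refine hJ.trans ?_
        gcongr
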